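/- arXiv:1501.01513 — 2 statements merged into one kernel-verified Lean document; each statement's English description precedes it below -/
import Mathlib

section
/- The following are equivalent: (i) C has the WLP; (ii) for general ω ∈ R_1, the multiplication by (ω + T) map C_{p_1} → C_{p_1+1} is injective and the multiplication by (ω + T) map C_{p_2} → C_{p_2+1} is surjective. -/
open MvPolynomial

set_option synthInstance.maxHeartbeats 1000000
set_option maxHeartbeats 1000000

noncomputable section

namespace SRWLP

variable (k : Type) [Field k]

/-- An (abstract) simplicial complex on the vertex set `Fin n`:
a collection of finite subsets (faces) closed under passing to subsets. -/
structure SC (n : ℕ) where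
  faces : Finset (Finset (Fin n))
  down_closed : ∀ s ∈ faces, ∀ t ⊆ s, t ∈ faces

variable {n : ℕ}

/-- `dimP D = dim D + 1`, i.e. the maximal cardinality of a face of `D`. -/
def dimP (D : SC n) : ℕ := D.faces.sup Finset.card

/-- The Stanley–Reisner ideal of `D`: the ideal generated by the squarefree
monomials corresponding to non-faces. -/
def srIdeal (D : SC n) : Ideal (MvPolynomial (Fin n) k) :=
  Ideal.span { p | ∃ s : Finset (Fin n), s ∉ D.faces ∧ p = ∏ i ∈ s, X i }

/-- `x_σ`, the product of the variables indexed by the face `σ`. -/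
def xFace (σ : Finset (Fin n)) : MvPolynomial (Fin n) k := ∏ i ∈ σ, X i

variable {ι : Type} [Fintype ι]

/-- The degree-`m` graded component of the standard graded algebra
`k[Xᵢ : i ∈ ι] ⧸ J`, as a `k`-submodule. -/
def qComp (J : Ideal (MvPolynomial ι k)) (m : ℕ) :
    Submodule k (MvPolynomial ι k ⧸ J) :=
  (homogeneousSubmodule ι k m).map (Ideal.Quotient.mkₐ k J).toLinearMap

/-- Graded components indexed by `ℤ` (zero in negative degrees). -/
def qCompZ (J : Ideal (MvPolynomial ι k)) (m : ℤ) :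
    Submodule k (MvPolynomial ι k ⧸ J) :=
  if 0 ≤ m then qComp k J m.toNat else ⊥

/-- The Hilbert function of `k[Xᵢ] ⧸ J`. -/
def HFq (J : Ideal (MvPolynomial ι k)) (m : ℕ) : ℕ := Module.finrank k (qComp k J m)

/-- The Hilbert function, with `ℤ` argument. -/
def HFZ (J : Ideal (MvPolynomial ι k)) (m : ℤ) : ℕ := Module.finrank k (qCompZ k J m)

/-- A property `P` of tuples `c : τ → k` holds *generically* (i.e. for all choices
in a suitable nonempty Zariski-open subset of the affine space `k^τ`) if there is a
nonzero polynomial `g` such that `P c` holds whenever `g` does not vanish at `c`. -/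
def Generic (τ : Type) (P : (τ → k) → Prop) : Prop :=
  ∃ g : MvPolynomial τ k, g ≠ 0 ∧ ∀ c : τ → k, eval c g ≠ 0 → P c

/-- The linear form with coefficient tuple `c`. -/
def linForm (c : ι → k) : MvPolynomial ι k := ∑ i, C (c i) * X i

/-- The ideal `J` together with the `d` linear forms encoded by `c`. -/
def redIdeal (J : Ideal (MvPolynomial ι k)) {d : ℕ} (c : Fin d × ι → k) :
    Ideal (MvPolynomial ι k) :=
  J ⊔ Ideal.span (Set.range fun j : Fin d => linForm k fun i => c (j, i))

/-- `depth (k[Xᵢ]⧸J) ≥ t` : there is a regular sequence of length `t` consisting of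
elements of the graded maximal ideal. -/
def depthGE (J : Ideal (MvPolynomial ι k)) (t : ℕ) : Prop :=
  ∃ rs : List (MvPolynomial ι k), rs.length = t ∧
    (∀ f ∈ rs, f ∈ Ideal.span (Set.range (X : ι → MvPolynomial ι k))) ∧
    RingTheory.Sequence.IsRegular (MvPolynomial ι k ⧸ J)
      (rs.map (Ideal.Quotient.mk J))

/-- `k[Xᵢ]⧸J` is Cohen–Macaulay of Krull dimension `d`. -/
def isCM (J : Ideal (MvPolynomial ι k)) (d : ℕ) : Prop :=
  ringKrullDim (MvPolynomial ι k ⧸ J) = (d : ℕ) ∧ depthGE k J d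

/-- The socle of `k[Xᵢ]⧸J` (the annihilator of the graded maximal ideal). -/
def socle (J : Ideal (MvPolynomial ι k)) : Submodule k (MvPolynomial ι k ⧸ J) :=
  ⨅ i : ι, LinearMap.ker (LinearMap.mulLeft k (Ideal.Quotient.mk J (X i)))

/-- `k[Xᵢ]⧸J` is Artinian Gorenstein: Artinian with one-dimensional socle. -/
def artGor (J : Ideal (MvPolynomial ι k)) : Prop :=
  IsArtinianRing (MvPolynomial ι k ⧸ J) ∧ Module.finrank k (socle k J) = 1

/-- `k[Xᵢ]⧸J` is Gorenstein of Krull dimension `d`: it is Cohen–Macaulay of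
dimension `d` and a general Artinian reduction is Artinian Gorenstein. -/
def isGor (J : Ideal (MvPolynomial ι k)) (d : ℕ) : Prop :=
  isCM k J d ∧ Generic k (Fin d × ι) fun c => artGor k (redIdeal k J c)

/-- Multiplication by `ω` from the degree-`m` component to the degree-`(m+1)`
component of `k[Xᵢ]⧸J` has maximal rank (is injective or surjective). -/
def mulMaxRank (J : Ideal (MvPolynomial ι k)) (ω : MvPolynomial ι k ⧸ J) (m : ℕ) : Prop :=
  (∀ x ∈ qComp k J m, ω * x = 0 → x = 0) ∨
  (∀ y ∈ qComp k J (m + 1), ∃ x ∈ qComp k J m, ω * x = y)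

/-- The Weak Lefschetz Property for the Artinian algebra `k[Xᵢ]⧸J`: for a general
linear form `ω`, multiplication `ω : (⧸J)ₘ → (⧸J)ₘ₊₁` has maximal rank for all `m`. -/
def artWLP (J : Ideal (MvPolynomial ι k)) : Prop :=
  Generic k ι fun c => ∀ m : ℕ,
    mulMaxRank k J (Ideal.Quotient.mk J (linForm k c)) m

/-- The Weak Lefschetz Property for `k[Xᵢ]⧸J` of Krull dimension `d ≥ 1`:
Cohen–Macaulay, and a general Artinian reduction has the WLP. -/
def hasWLP (J : Ideal (MvPolynomial ι k)) (d : ℕ) : Prop :=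
  isCM k J d ∧ Generic k (Fin d × ι) fun c => artWLP k (redIdeal k J c)

/-- The Strong Lefschetz Property for the Artinian algebra `k[Xᵢ]⧸J`. -/
def artSLP (J : Ideal (MvPolynomial ι k)) : Prop :=
  ∃ r : ℕ, qComp k J r ≠ ⊥ ∧ (∀ j : ℕ, r < j → qComp k J j = ⊥) ∧
    (∀ i ≤ r, HFq k J i = HFq k J (r - i)) ∧
    Generic k ι fun c => ∀ i : ℕ, 2 * i ≤ r →
      (∀ x ∈ qComp k J i,
          Ideal.Quotient.mk J (linForm k c) ^ (r - 2 * i) * x = 0 → x = 0) ∧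
      (∀ y ∈ qComp k J (r - i), ∃ x ∈ qComp k J i,
          Ideal.Quotient.mk J (linForm k c) ^ (r - 2 * i) * x = y)

/-- The Strong Lefschetz Property for `k[Xᵢ]⧸J` of Krull dimension `d ≥ 1`. -/
def hasSLP (J : Ideal (MvPolynomial ι k)) (d : ℕ) : Prop :=
  isCM k J d ∧ Generic k (Fin d × ι) fun c => artSLP k (redIdeal k J c)

/-- `D` is Gorenstein* over `k`: every element of the vertex set is a vertex,
`k[D]` is Gorenstein (of dimension `dim D + 1`), and for every vertex `i` there is a
face `τ` with `τ ∪ {i}` not a face. -/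
def gorStar (D : SC n) : Prop :=
  (∀ i : Fin n, {i} ∈ D.faces) ∧
  isGor k (srIdeal k D) (dimP D) ∧
  (∀ i : Fin n, ∃ τ ∈ D.faces, insert i τ ∉ D.faces)

/-! `R[T]` is modelled as the polynomial ring in `n+1` variables, the last
variable playing the role of `T`. -/

/-- The inclusion `R = k[x₁,…,xₙ] → R[T] = k[x₁,…,xₙ,T]`. -/
def toT : MvPolynomial (Fin n) k →ₐ[k] MvPolynomial (Fin (n + 1)) k :=
  rename Fin.castSucc

/-- The variable `T` of `R[T]`. -/
def Tv (n : ℕ) : MvPolynomial (Fin (n + 1)) k := X (Fin.last n)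

/-- Extension of an ideal of `R` to `R[T]`. -/
def extI (J : Ideal (MvPolynomial (Fin n) k)) : Ideal (MvPolynomial (Fin (n + 1)) k) :=
  Ideal.map (toT k) J

/-- The ideal `T·J` of `R[T]`, for an ideal `J` of `R`. -/
def TmulI (J : Ideal (MvPolynomial (Fin n) k)) : Ideal (MvPolynomial (Fin (n + 1)) k) :=
  Ideal.span ((fun f => Tv k n * toT k f) '' (J : Set (MvPolynomial (Fin n) k)))

/-- `I_L = (I_D : x_σ)`, the Stanley–Reisner ideal of the link of `σ` in `D`
(extended to `R`). -/
def linkIdeal (D : SC n) (σ : Finset (Fin n)) : Ideal (MvPolynomial (Fin n) k) :=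
  Submodule.colon (srIdeal k D) (Ideal.span {xFace k σ})

/-- `J_st = (I, x_σ, T·I_L) ⊂ R[T]`, the Stanley–Reisner ideal of the stellar
subdivision `D_σ`. -/
def Jst (D : SC n) (σ : Finset (Fin n)) : Ideal (MvPolynomial (Fin (n + 1)) k) :=
  extI k (srIdeal k D) ⊔ Ideal.span {toT k (xFace k σ)} ⊔ TmulI k (linkIdeal k D σ)

/-- `I_C = (I, T^{q+1}, T·I_L) ⊂ R[T]`. -/
def IC (D : SC n) (σ : Finset (Fin n)) (q : ℕ) : Ideal (MvPolynomial (Fin (n + 1)) k) :=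
  extI k (srIdeal k D) ⊔ Ideal.span {Tv k n ^ (q + 1)} ⊔ TmulI k (linkIdeal k D σ)

/-- `I_G = (I, T^{q+1} - x_σ, T·I_L) ⊂ R[T]`. -/
def IG (D : SC n) (σ : Finset (Fin n)) (q : ℕ) : Ideal (MvPolynomial (Fin (n + 1)) k) :=
  extI k (srIdeal k D) ⊔ Ideal.span {Tv k n ^ (q + 1) - toT k (xFace k σ)} ⊔
    TmulI k (linkIdeal k D σ)

/-- The ideal of `R[T]` generated by `d` general linear forms of `R`
(involving only the `x`-variables). -/
def xForms {d : ℕ} (c : Fin d × Fin n → k) : Ideal (MvPolynomial (Fin (n + 1)) k) :=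
  Ideal.span (Set.range fun j : Fin d => toT k (linForm k fun i => c (j, i)))

/-- Property `M_{q,p₁}` for the Artinian algebra `B = R⧸J_B`: for a general linear
form `ω`, multiplication by `ω^q : B_{p₁-q} → B_{p₁}` is injective. -/
def propM (JB : Ideal (MvPolynomial (Fin n) k)) (q p₁ : ℕ) : Prop :=
  Generic k (Fin n) fun c => ∀ x ∈ qCompZ k JB ((p₁ : ℤ) - (q : ℤ)),
    Ideal.Quotient.mk JB (linForm k c) ^ q * x = 0 → x = 0

section Regular
variable {k : Type} [Field k] {ι : Type}

/-- The contraction of `J` from the localization at the origin. -/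
def sat (J : Ideal (MvPolynomial ι k)) : Ideal (MvPolynomial ι k) where
  carrier := {p | ∃ u, constantCoeff u ≠ 0 ∧ u * p ∈ J}
  zero_mem' := ⟨1, by simp⟩
  add_mem' := by
    rintro p q ⟨u, hu, hp⟩ ⟨v, hv, hq⟩
    refine ⟨u * v, by simpa using ⟨hu, hv⟩, ?_⟩
    have h1 := J.mul_mem_left v hp
    have h2 := J.mul_mem_left u hq
    convert J.add_mem h1 h2 using 1
    ring
  smul_mem' := by
    rintro r p ⟨u, hu, hp⟩
    refine ⟨u, hu, ?_⟩
    convert J.mul_mem_left r hp using 1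
    simp only [smul_eq_mul]
    ring

theorem le_sat (J : Ideal (MvPolynomial ι k)) : J ≤ sat J :=
  fun p hp => ⟨1, by simp, by simpa using hp⟩

theorem mem_sup_span_singleton_iff {A : Type*} [CommRing A] {J : Ideal A} {a p : A} :
    p ∈ J ⊔ Ideal.span {a} ↔ ∃ c, p - a * c ∈ J := by
  constructor
  · intro h
    obtain ⟨y, hy, z, hz, rfl⟩ := Submodule.mem_sup.1 h
    obtain ⟨c, rfl⟩ := Ideal.mem_span_singleton'.1 hz
    exact ⟨c, by simpa [mul_comm] using hy⟩
  · rintro ⟨c, hc⟩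
    have : p = (p - a * c) + a * c := by ring
    rw [this]
    exact Ideal.add_mem _ (Ideal.mem_sup_left hc)
      (Ideal.mem_sup_right (Ideal.mul_mem_right _ _ (Ideal.mem_span_singleton_self a)))

theorem exists_unit_mul_mem_of_fg {J K : Ideal (MvPolynomial ι k)} (hK : K.FG)
    (h : K ≤ sat J) : ∃ u, constantCoeff u ≠ 0 ∧ ∀ p ∈ K, u * p ∈ J := by
  classical
  obtain ⟨S, rfl⟩ := hK
  induction S using Finset.induction_on with
  | empty =>
    refine ⟨1, by simp, fun p hp => ?_⟩
    have : p = 0 := by simpa using hp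
    simp [this]
  | insert a S ha ih =>
    obtain ⟨u, hu, hS⟩ := ih ((Submodule.span_mono (by simp)).trans h)
    obtain ⟨v, hv, hav⟩ := h (Submodule.subset_span (Finset.mem_coe.2 (Finset.mem_insert_self a S)))
    refine ⟨u * v, by simpa using ⟨hu, hv⟩, fun p hp => ?_⟩
    rw [Finset.coe_insert] at hp
    obtain ⟨c, z, hz, rfl⟩ := Submodule.mem_span_insert.1 hp
    have e : u * v * (c • a + z) = (u * c) * (v * a) + v * (u * z) := by
      simp only [smul_eq_mul]; ring
    rw [e]
    exact J.add_mem (J.mul_mem_left _ hav) (J.mul_mem_left _ (hS z hz))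

theorem le_sat_of_le_sat_sup {J K : Ideal (MvPolynomial ι k)} (hK : K.FG)
    (h : K ≤ sat (J ⊔ RingHom.ker (constantCoeff (R := k) (σ := ι)) * K)) : K ≤ sat J := by
  obtain ⟨u, hu, hp⟩ := exists_unit_mul_mem_of_fg hK h
  have hle : K ≤ J ⊔ RingHom.ker (constantCoeff (R := k) (σ := ι)) • K := by
    intro p hpK
    set a := constantCoeff u
    have e : p = C a⁻¹ * (u * p) + (1 - C a⁻¹ * u) * p := by ring
    rw [e]
    refine Ideal.add_mem _ (Ideal.mul_mem_left _ _ (hp p hpK)) (Ideal.mem_sup_right ?_)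
    refine Ideal.mul_mem_mul ?_ hpK
    simp [RingHom.mem_ker, a, inv_mul_cancel₀ hu]
  obtain ⟨r, hr, hrK⟩ :=
    Submodule.exists_sub_one_mem_and_smul_le_of_fg_of_le_sup hK le_rfl hle
  intro p hpK
  refine ⟨r, ?_, hrK (Submodule.smul_mem_pointwise_smul p r K hpK)⟩
  rw [RingHom.mem_ker, map_sub, map_one, sub_eq_zero] at hr
  simp [hr]

/-- A list is a regular sequence on the localization of the quotient by `J` at the origin. -/
def IsLocRegSeq : Ideal (MvPolynomial ι k) → List (MvPolynomial ι k) → Prop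
  | _, [] => True
  | J, f :: fs => (∀ p, f * p ∈ J → p ∈ sat J) ∧ IsLocRegSeq (J ⊔ Ideal.span {f}) fs

/-- A list is a (weakly) regular sequence on the quotient by `J`. -/
def IsRegSeq : Ideal (MvPolynomial ι k) → List (MvPolynomial ι k) → Prop
  | _, [] => True
  | J, f :: fs => (∀ p, f * p ∈ J → p ∈ J) ∧ IsRegSeq (J ⊔ Ideal.span {f}) fs

theorem IsRegSeq.isLocRegSeq {J : Ideal (MvPolynomial ι k)} {l : List (MvPolynomial ι k)}
    (h : IsRegSeq J l) :
    IsLocRegSeq J l := by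
  induction l generalizing J with
  | nil => trivial
  | cons f fs ih => exact ⟨fun p hp => le_sat J (h.1 p hp), ih h.2⟩

theorem sup_ofList_cons (J : Ideal (MvPolynomial ι k)) (f : MvPolynomial ι k)
    (l : List (MvPolynomial ι k)) :
    J ⊔ Ideal.ofList (f :: l) = J ⊔ Ideal.span {f} ⊔ Ideal.ofList l := by
  rw [Ideal.ofList_cons, sup_assoc]

theorem lreg_append {J : Ideal (MvPolynomial ι k)} {l l' : List (MvPolynomial ι k)} :
    IsLocRegSeq J (l ++ l') ↔ IsLocRegSeq J l ∧ IsLocRegSeq (J ⊔ Ideal.ofList l) l' := by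
  induction l generalizing J with
  | nil => simp [IsLocRegSeq]
  | cons f fs ih =>
    rw [List.cons_append, IsLocRegSeq, IsLocRegSeq, ih, sup_ofList_cons, and_assoc]

theorem isRegSeq_append {J : Ideal (MvPolynomial ι k)} {l l' : List (MvPolynomial ι k)} :
    IsRegSeq J (l ++ l') ↔ IsRegSeq J l ∧ IsRegSeq (J ⊔ Ideal.ofList l) l' := by
  induction l generalizing J with
  | nil => simp [IsRegSeq]
  | cons f fs ih =>
    rw [List.cons_append, IsRegSeq, IsRegSeq, ih, sup_ofList_cons, and_assoc]

/-- The ideal contains the homogeneous components of its members. -/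
def IsHomogIdeal (J : Ideal (MvPolynomial ι k)) : Prop := ∀ p ∈ J, ∀ e, homogeneousComponent e p ∈ J

theorem IsHomogIdeal.sup {J K : Ideal (MvPolynomial ι k)} (hJ : IsHomogIdeal J)
    (hK : IsHomogIdeal K) : IsHomogIdeal (J ⊔ K) := by
  intro p hp e
  obtain ⟨y, hy, z, hz, rfl⟩ := Submodule.mem_sup.1 hp
  rw [map_add]
  exact Ideal.add_mem _ (Ideal.mem_sup_left (hJ y hy e)) (Ideal.mem_sup_right (hK z hz e))

theorem homogeneousComponent_mul_of_isHomogeneous {f p : MvPolynomial ι k} {a : ℕ}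
    (hf : f.IsHomogeneous a) (e : ℕ) :
    homogeneousComponent (e + a) (f * p) = f * homogeneousComponent e p := by
  conv_lhs => rw [← sum_homogeneousComponent p, Finset.mul_sum, map_sum]
  have h : ∀ i, homogeneousComponent (e + a) (f * homogeneousComponent i p) =
      if i = e then f * homogeneousComponent i p else 0 := by
    intro i
    rw [homogeneousComponent_of_mem (n := i + a)]
    · simp only [add_left_inj, eq_comm]
    · rw [mem_homogeneousSubmodule, add_comm]
      exact hf.mul (homogeneousComponent_isHomogeneous i p)
  simp only [h]
  rw [Finset.sum_ite_eq']
  split_ifs with hh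
  · rfl
  · rw [homogeneousComponent_eq_zero, mul_zero]
    simpa using hh

theorem homogeneousComponent_mul_of_lt {f p : MvPolynomial ι k} {a : ℕ}
    (hf : f.IsHomogeneous a) {e : ℕ} (he : e < a) :
    homogeneousComponent e (f * p) = 0 := by
  conv_lhs => rw [← sum_homogeneousComponent p, Finset.mul_sum, map_sum]
  refine Finset.sum_eq_zero fun i _ => ?_
  rw [homogeneousComponent_of_mem (n := a + i), if_neg (by omega)]
  exact hf.mul (homogeneousComponent_isHomogeneous i p)

theorem IsHomogIdeal.span_singleton {f : MvPolynomial ι k} {a : ℕ} (hf : f.IsHomogeneous a) :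
    IsHomogIdeal (Ideal.span {f}) := by
  intro p hp e
  obtain ⟨c, rfl⟩ := Ideal.mem_span_singleton.1 hp
  rcases lt_or_ge e a with h | h
  · rw [homogeneousComponent_mul_of_lt hf h]; exact Ideal.zero_mem _
  · obtain ⟨b, rfl⟩ := Nat.exists_eq_add_of_le' h
    rw [homogeneousComponent_mul_of_isHomogeneous hf]
    exact Ideal.mul_mem_right _ _ (Ideal.mem_span_singleton_self f)

theorem IsHomogIdeal.sup_ofList {J : Ideal (MvPolynomial ι k)} (hJ : IsHomogIdeal J)
    {l : List (MvPolynomial ι k)}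
    (hl : ∀ f ∈ l, ∃ a, f.IsHomogeneous a) : IsHomogIdeal (J ⊔ Ideal.ofList l) := by
  induction l generalizing J with
  | nil => simpa using hJ
  | cons f fs ih =>
    rw [sup_ofList_cons]
    obtain ⟨a, ha⟩ := hl f (by simp)
    exact ih (hJ.sup (IsHomogIdeal.span_singleton ha)) fun g hg => hl g (List.mem_cons_of_mem _ hg)

theorem IsHomogIdeal.mem_of_comp {J : Ideal (MvPolynomial ι k)} {p : MvPolynomial ι k}
    (h : ∀ e, homogeneousComponent e p ∈ J) : p ∈ J := by
  rw [← sum_homogeneousComponent p]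
  exact J.sum_mem fun i _ => h i

theorem IsHomogIdeal.sat_le {J : Ideal (MvPolynomial ι k)} (hJ : IsHomogIdeal J) : sat J ≤ J := by
  rintro p ⟨u, hu, hup⟩
  refine IsHomogIdeal.mem_of_comp fun e => ?_
  induction e using Nat.strong_induction_on with
  | _ e ih =>
    set p' := ∑ i ∈ Finset.range e, homogeneousComponent i p with hp'
    have hp'J : p' ∈ J := J.sum_mem fun i hi => ih i (Finset.mem_range.1 hi)
    have h1 : u * (p - p') ∈ J := by
      rw [mul_sub]; exact J.sub_mem hup (J.mul_mem_left _ hp'J)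
    have h2 := hJ _ h1 e
    have hlow : ∀ i, homogeneousComponent i (p - p') =
        if i < e then 0 else homogeneousComponent i p := by
      intro i
      rw [map_sub, hp', map_sum]
      have : ∀ j, homogeneousComponent i (homogeneousComponent j p) =
          if i = j then homogeneousComponent j p else 0 := fun j =>
        homogeneousComponent_of_mem (homogeneousComponent_mem j p)
      simp only [this]
      rw [Finset.sum_ite_eq]
      simp only [Finset.mem_range]
      split_ifs <;> simp
    have h3 : homogeneousComponent e (u * (p - p')) =
        C (constantCoeff u) * homogeneousComponent e p := by
      conv_lhs => rw [← sum_homogeneousComponent (p - p'), Finset.mul_sum, map_sum]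
      have h4 : ∀ i, homogeneousComponent e (u * homogeneousComponent i (p - p')) =
          if i = e then C (constantCoeff u) * homogeneousComponent e p else 0 := by
        intro i
        rw [hlow]
        rcases lt_trichotomy i e with h | h | h
        · simp [h, h.ne]
        · subst h
          simp only [lt_irrefl, if_false, if_true]
          have := homogeneousComponent_mul_of_isHomogeneous (p := u)
            (homogeneousComponent_isHomogeneous i p) 0
          rw [zero_add, mul_comm, homogeneousComponent_zero] at this
          rw [this, mul_comm]; rfl
        · rw [if_neg (by omega), if_neg h.ne', mul_comm]
          exact homogeneousComponent_mul_of_lt (homogeneousComponent_isHomogeneous i p) h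
      simp only [h4]
      rw [Finset.sum_ite_eq']
      split_ifs with hh
      · rfl
      · have : homogeneousComponent e (p - p') = 0 :=
            homogeneousComponent_eq_zero _ _ (by simpa using hh)
        rw [hlow, if_neg (lt_irrefl _)] at this
        rw [this, mul_zero]
    rw [h3] at h2
    have := J.mul_mem_left (C (constantCoeff u)⁻¹) h2
    rwa [← mul_assoc, ← C_mul, inv_mul_cancel₀ hu, C_1, one_mul] at this

theorem IsLocRegSeq.isRegSeq {J : Ideal (MvPolynomial ι k)} {l : List (MvPolynomial ι k)}
    (hJ : IsHomogIdeal J)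
    (hl : ∀ f ∈ l, ∃ a, f.IsHomogeneous a) (h : IsLocRegSeq J l) : IsRegSeq J l := by
  induction l generalizing J with
  | nil => trivial
  | cons f fs ih =>
    obtain ⟨a, ha⟩ := hl f (by simp)
    exact ⟨fun p hp => hJ.sat_le (h.1 p hp), ih (hJ.sup (IsHomogIdeal.span_singleton ha))
      (fun g hg => hl g (List.mem_cons_of_mem _ hg)) h.2⟩

variable [Fintype ι]

theorem IsLocRegSeq.swap {J : Ideal (MvPolynomial ι k)} {a b : MvPolynomial ι k}
    {l : List (MvPolynomial ι k)} (ha : constantCoeff a = 0) (h : IsLocRegSeq J (a :: b :: l)) :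
    IsLocRegSeq J (b :: a :: l) := by
  obtain ⟨hA, hB, hl⟩ := h
  refine ⟨?_, ?_, by rwa [sup_right_comm]⟩
  · let K : Ideal (MvPolynomial ι k) := Submodule.comap (LinearMap.mulLeft (MvPolynomial ι k) b) J
    have hKm : ∀ p, p ∈ K ↔ b * p ∈ J := fun p => Iff.rfl
    have : K ≤ sat J := by
      refine le_sat_of_le_sat_sup (IsNoetherian.noetherian K) fun p hp => ?_
      obtain ⟨u, hu, hup⟩ := hB p (Ideal.mem_sup_left ((hKm p).1 hp))
      obtain ⟨c, hc⟩ := mem_sup_span_singleton_iff.1 hup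
      have h1 : a * (b * c) ∈ J := by
        have := J.sub_mem (J.mul_mem_left u ((hKm p).1 hp)) (J.mul_mem_left b hc)
        convert this using 1
        ring
      obtain ⟨v, hv, hvc⟩ := hA _ h1
      refine ⟨v * u, by simpa using ⟨hv, hu⟩, ?_⟩
      have e : v * u * p = v * (u * p - a * c) + a * (v * c) := by ring
      rw [e]
      refine Ideal.add_mem _ (Ideal.mem_sup_left (J.mul_mem_left _ hc)) (Ideal.mem_sup_right ?_)
      refine Ideal.mul_mem_mul ha ((hKm _).2 ?_)
      convert hvc using 1
      ring
    exact fun p hp => this hp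
  · intro q hq
    obtain ⟨c, hc⟩ := mem_sup_span_singleton_iff.1 hq
    have h1 : b * c ∈ J ⊔ Ideal.span {a} := mem_sup_span_singleton_iff.2
      ⟨q, by convert J.neg_mem hc using 1; ring⟩
    obtain ⟨u, hu, huc⟩ := hB c h1
    obtain ⟨e, he⟩ := mem_sup_span_singleton_iff.1 huc
    have h2 : a * (u * q - b * e) ∈ J := by
      convert J.add_mem (J.mul_mem_left u hc) (J.mul_mem_left b he) using 1
      ring
    obtain ⟨v, hv, hve⟩ := hA _ h2
    refine ⟨v * u, by simpa using ⟨hv, hu⟩, mem_sup_span_singleton_iff.2 ⟨v * e, ?_⟩⟩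
    convert hve using 1
    ring

theorem IsLocRegSeq.perm {J : Ideal (MvPolynomial ι k)} {l l' : List (MvPolynomial ι k)}
    (hp : l.Perm l') (hl : ∀ f ∈ l, constantCoeff f = 0) (h : IsLocRegSeq J l) :
    IsLocRegSeq J l' := by
  induction hp generalizing J with
  | nil => trivial
  | cons x _ ih => exact ⟨h.1, ih (fun f hf => hl f (List.mem_cons_of_mem _ hf)) h.2⟩
  | swap x y l => exact h.swap (hl _ (by simp))
  | trans h1 _ ih1 ih2 => exact ih2 (fun f hf => hl f (h1.mem_iff.2 hf)) (ih1 hl h)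

theorem IsHomogIdeal.eq_of_le_sup_mul {J K : Ideal (MvPolynomial ι k)} (hJ : IsHomogIdeal J)
    (h : K ≤ J ⊔ RingHom.ker (constantCoeff (R := k) (σ := ι)) * K) : K ≤ J :=
  (le_sat_of_le_sat_sup (IsNoetherian.noetherian K) (h.trans (le_sat _))).trans hJ.sat_le

end Regular

section Exchange
variable {k : Type} [Field k] {ι : Type}

theorem constantCoeff_of_mem_span {fs : List (MvPolynomial ι k)}
    (hfs : ∀ f ∈ fs, constantCoeff f = 0) {g : MvPolynomial ι k}
    (hg : g ∈ Submodule.span k {x | x ∈ fs}) : constantCoeff g = 0 := by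
  have : Submodule.span k {x | x ∈ fs} ≤
      (RingHom.ker (constantCoeff (R := k) (σ := ι))).restrictScalars k :=
    Submodule.span_le.2 hfs
  exact this hg

theorem mem_ofList_of_mem_span {fs : List (MvPolynomial ι k)} {g : MvPolynomial ι k}
    (hg : g ∈ Submodule.span k {x | x ∈ fs}) : g ∈ Ideal.ofList fs := by
  have : Submodule.span k {x | x ∈ fs} ≤ (Ideal.ofList fs).restrictScalars k :=
    Submodule.span_le.2 fun x hx => Ideal.subset_span hx
  exact this hg

theorem isRegSeq_of_isWeaklyRegular {J : Ideal (MvPolynomial ι k)} {rs : List (MvPolynomial ι k)}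
    (h : RingTheory.Sequence.IsWeaklyRegular (MvPolynomial ι k ⧸ J)
      (rs.map (Ideal.Quotient.mk J))) : IsRegSeq J rs := by
  have key : ∀ rs₁ rs₂ : List (MvPolynomial ι k), rs₁ ++ rs₂ = rs →
      IsRegSeq (J ⊔ Ideal.ofList rs₁) rs₂ := by
    intro rs₁ rs₂
    induction rs₂ generalizing rs₁ with
    | nil => intro _; trivial
    | cons f fs ih =>
      intro e
      refine ⟨fun p hp => ?_, ?_⟩
      · have hi : rs₁.length < (rs.map (Ideal.Quotient.mk J)).length := by simp [← e]
        have := h.regular_mod_prev rs₁.length hi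
        have e1 : (rs.map (Ideal.Quotient.mk J))[rs₁.length] = Ideal.Quotient.mk J f := by
          simp [← e]
        have e2 : (rs.map (Ideal.Quotient.mk J)).take rs₁.length =
            rs₁.map (Ideal.Quotient.mk J) := by
          simp [← e, List.map_append]
        rw [e1, e2] at this
        have hmem : ∀ x : MvPolynomial ι k, Ideal.Quotient.mk J x ∈
            (Ideal.ofList (rs₁.map (Ideal.Quotient.mk J)) •
              (⊤ : Submodule (MvPolynomial ι k ⧸ J) (MvPolynomial ι k ⧸ J))) ↔
            x ∈ J ⊔ Ideal.ofList rs₁ := by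
          intro x
          rw [smul_eq_mul, Ideal.mul_top, ← Ideal.map_ofList, ← Ideal.mem_comap,
            Ideal.comap_map_of_surjective _ Ideal.Quotient.mk_surjective,
            ← RingHom.ker_eq_comap_bot, Ideal.mk_ker, sup_comm]
        have hz := this (a₁ := Submodule.Quotient.mk (Ideal.Quotient.mk J p)) (a₂ := 0) (by
          simp only [smul_zero]
          rw [← Submodule.Quotient.mk_smul, Submodule.Quotient.mk_eq_zero]
          exact (hmem (f * p)).2 hp)
        rw [Submodule.Quotient.mk_eq_zero, hmem] at hz
        exact hz
      · have := ih (rs₁ ++ [f]) (by simpa using e)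
        rwa [Ideal.ofList_append, Ideal.ofList_singleton, ← sup_assoc] at this
  simpa using key [] rs rfl

variable [Fintype ι]

theorem exists_associatedPrime_of_mul_mem {Q : Ideal (MvPolynomial ι k)} {h p : MvPolynomial ι k}
    (hp : p ∉ sat Q) (hhp : h * p ∈ Q) :
    ∃ P ∈ associatedPrimes (MvPolynomial ι k) (MvPolynomial ι k ⧸ Q),
      P ≤ RingHom.ker (constantCoeff (R := k) (σ := ι)) ∧ h ∈ P := by
  let N := Submodule.span (MvPolynomial ι k) {Submodule.Quotient.mk (p := Q) p}
  have hN : ∀ r, r ∈ Module.annihilator (MvPolynomial ι k) N ↔ r * p ∈ Q := by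
    intro r
    change r ∈ N.annihilator ↔ _
    rw [Submodule.mem_annihilator_span_singleton, ← Submodule.Quotient.mk_smul,
      Submodule.Quotient.mk_eq_zero]
    rfl
  have hle : Module.annihilator (MvPolynomial ι k) N ≤
      RingHom.ker (constantCoeff (R := k) (σ := ι)) := by
    intro r hr
    by_contra hc
    exact hp ⟨r, hc, (hN r).1 hr⟩
  have := RingHom.ker_isPrime (constantCoeff (R := k) (σ := ι))
  obtain ⟨P, hP, hPle⟩ := Ideal.exists_minimalPrimes_le hle
  have hPN := Module.associatedPrimes.minimalPrimes_annihilator_subset_associatedPrimes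
    (MvPolynomial ι k) N hP
  exact ⟨P, associatedPrimes.subset_of_injective N.subtype_injective hPN, hPle,
    hP.1.2 ((hN h).2 hhp)⟩

theorem exists_linear_combination_forall_mem_sat [Infinite k] {Q : Ideal (MvPolynomial ι k)}
    {r f : MvPolynomial ι k} {fs : List (MvPolynomial ι k)}
    (hr : constantCoeff r = 0) (hreg : ∀ p, r * p ∈ Q → p ∈ sat Q) {N : ℕ}
    (hN : RingHom.ker (constantCoeff (R := k) (σ := ι)) ^ N ≤ Q ⊔ Ideal.ofList (f :: fs)) :
    ∃ a : k, a ≠ 0 ∧ ∃ g ∈ Submodule.span k {x | x ∈ fs},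
      ∀ p, (C a * f + g) * p ∈ Q → p ∈ sat Q := by
  let V := Submodule.span k {x | x ∈ fs}
  let L : k × V →ₗ[k] MvPolynomial ι k :=
    (LinearMap.toSpanSingleton k _ f).coprod V.subtype
  have hL : ∀ x, L x = C x.1 * f + (x.2 : MvPolynomial ι k) := fun x => by
    simp [L, C_mul']
  let A := {P ∈ associatedPrimes (MvPolynomial ι k) (MvPolynomial ι k ⧸ Q) |
    P ≤ RingHom.ker (constantCoeff (R := k) (σ := ι))}
  have hA : A.Finite := (associatedPrimes.finite _ _).subset fun _ h => h.1
  let T : Set (Subspace k (k × V)) :=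
    insert (LinearMap.ker (LinearMap.fst k k V))
      ((fun P : Ideal (MvPolynomial ι k) => (P.restrictScalars k).comap L) '' A)
  have hT : T.Finite := (hA.image _).insert _
  have htop : ⊤ ∉ T := by
    rintro (h | ⟨P, ⟨hP, hPm⟩, h⟩)
    · have : ((1 : k), (0 : V)) ∈ LinearMap.ker (LinearMap.fst k k V) := h ▸ Submodule.mem_top
      simp at this
    · have hmem : ∀ x, L x ∈ P := fun x => by
        have : x ∈ (P.restrictScalars k).comap L := by
          rw [show (P.restrictScalars k).comap L = ⊤ from h]; trivial
        exact this
      have hPp : P.IsPrime := hP.1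
      obtain ⟨z, hz⟩ := (Submodule.isAssociatedPrime_iff.1 hP).2
      obtain ⟨z, rfl⟩ := Submodule.Quotient.mk_surjective _ z
      have hzP : ∀ x, x ∈ P ↔ x * z ∈ Q := fun x => by
        rw [hz, Submodule.mem_colon_singleton, Submodule.mem_bot, ← Submodule.Quotient.mk_smul,
          Submodule.Quotient.mk_eq_zero]
        rfl
      have hQP : Q ≤ P := fun x hx => (hzP x).2 (Q.mul_mem_right _ hx)
      have hfP : Ideal.ofList (f :: fs) ≤ P := by
        refine Ideal.span_le.2 fun x hx => ?_
        rcases List.mem_cons.1 (show x ∈ f :: fs from hx) with rfl | hx'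
        · simpa [hL] using hmem (1, 0)
        · simpa [hL] using hmem (0, ⟨x, Submodule.subset_span hx'⟩)
      have hmP := Ideal.IsPrime.le_of_pow_le (hN.trans (sup_le hQP hfP))
      obtain ⟨u, hu, huz⟩ := hreg z ((hzP r).1 (hmP hr))
      exact hu (hPm ((hzP u).2 huz))
  obtain ⟨x, hx⟩ : ∃ x : k × V, ∀ p ∈ T, x ∉ p := by
    by_contra! hc
    have := hT.to_subtype
    obtain ⟨p, hp⟩ := Subspace.exists_eq_top_of_iUnion_eq_univ (p := fun p : T => p.1)
      (Set.eq_univ_of_forall fun x => by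
        obtain ⟨p, hp, hx⟩ := hc x
        exact Set.mem_iUnion.2 ⟨⟨p, hp⟩, hx⟩)
    exact htop (hp ▸ p.2)
  refine ⟨x.1, fun h0 => hx _ (Set.mem_insert _ _) (by simpa using h0), x.2, x.2.2,
    fun p hp => ?_⟩
  by_contra hps
  obtain ⟨P, hP, hPm, hmem⟩ := exists_associatedPrime_of_mul_mem hps hp
  exact hx _ (Set.mem_insert_of_mem _ ⟨P, ⟨hP, hPm⟩, rfl⟩) (show L x ∈ P by rwa [hL])

theorem IsLocRegSeq.exchange [Infinite k] {J : Ideal (MvPolynomial ι k)}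
    {rs fs : List (MvPolynomial ι k)} (hlen : rs.length = fs.length)
    (hrs : ∀ f ∈ rs, constantCoeff f = 0) (hfs : ∀ f ∈ fs, constantCoeff f = 0)
    (h : IsLocRegSeq J rs) {N : ℕ}
    (hN : RingHom.ker (constantCoeff (R := k) (σ := ι)) ^ N ≤ J ⊔ Ideal.ofList fs) :
    IsLocRegSeq J fs := by
  induction fs generalizing J rs with
  | nil => trivial
  | cons f fs ih =>
    obtain rfl | ⟨rs', r, rfl⟩ := List.eq_nil_or_concat rs
    · simp at hlen
    rw [List.concat_eq_append] at *
    obtain ⟨h1, h2, -⟩ := lreg_append.1 h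
    have hN' := hN.trans (sup_le_sup_right (le_sup_left : J ≤ J ⊔ Ideal.ofList rs') _)
    obtain ⟨a, ha, g, hg, hreg⟩ := exists_linear_combination_forall_mem_sat
      (hrs r (by simp)) h2 hN'
    have hfs' : ∀ f ∈ fs, constantCoeff f = 0 := fun x hx => hfs x (List.mem_cons_of_mem _ hx)
    have hgc := constantCoeff_of_mem_span hfs' hg
    have hg' := mem_ofList_of_mem_span hg
    set y := C a * f + g with hy
    have hyc : constantCoeff y = 0 := by simp [hy, hgc, hfs f (by simp)]
    have h3 : IsLocRegSeq J (y :: rs') := by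
      refine IsLocRegSeq.perm (l := rs' ++ [y]) (List.perm_append_singleton _ _) ?_
        (lreg_append.2 ⟨h1, hreg, trivial⟩)
      intro x hx
      rcases List.mem_append.1 hx with hx | hx
      · exact hrs x (by simp [hx])
      · rw [List.mem_singleton.1 hx, hyc]
    have hf : f ∈ J ⊔ Ideal.span {y} ⊔ Ideal.ofList fs := by
      have e : f = C a⁻¹ * (y - g) := by
        rw [hy, add_sub_cancel_right, ← mul_assoc, ← C_mul, inv_mul_cancel₀ ha, C_1, one_mul]
      rw [e]
      exact Ideal.mul_mem_left _ _ (Ideal.sub_mem _ (Ideal.mem_sup_left (Ideal.mem_sup_right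
        (Ideal.mem_span_singleton_self y))) (Ideal.mem_sup_right hg'))
    have h4 : IsLocRegSeq (J ⊔ Ideal.span {y}) fs := by
      refine ih (by simpa using hlen) (fun x hx => hrs x (by simp [hx])) hfs' h3.2 (hN.trans ?_)
      rw [Ideal.ofList_cons]
      refine sup_le (le_sup_left.trans le_sup_left) (sup_le ?_ le_sup_right)
      rwa [Ideal.span_singleton_le_iff_mem]
    have h5 : IsLocRegSeq J (fs ++ [y]) := by
      refine IsLocRegSeq.perm (l := y :: fs) (List.perm_append_singleton _ _).symm ?_ ⟨h3.1, h4⟩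
      intro x hx
      rcases List.mem_cons.1 hx with rfl | hx
      exacts [hyc, hfs' x hx]
    refine IsLocRegSeq.perm (l := fs ++ [f]) (List.perm_append_singleton _ _) ?_ ?_
    · intro x hx
      exact hfs x (by simpa [or_comm] using hx)
    · obtain ⟨h6, h7, -⟩ := lreg_append.1 h5
      refine lreg_append.2 ⟨h6, fun p hp => h7 p ?_, trivial⟩
      rw [hy, add_mul, mul_assoc]
      exact Ideal.add_mem _ (Ideal.mul_mem_left _ _ hp)
        (Ideal.mul_mem_right _ _ (Ideal.mem_sup_right hg'))

end Exchange

section Gorenstein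
variable {k : Type} [Field k] {ι : Type}

theorem ker_constantCoeff_eq_span :
    RingHom.ker (constantCoeff (R := k) (σ := ι)) = Ideal.span (Set.range X) := by
  apply le_antisymm
  · intro p hp
    rw [← Set.image_univ, mem_ideal_span_X_image]
    intro m hm
    by_contra! hc
    have : m = 0 := Finsupp.ext fun i => hc i (Set.mem_univ i)
    rw [this, mem_support_iff] at hm
    exact hm hp
  · refine Ideal.span_le.2 ?_
    rintro _ ⟨i, rfl⟩
    simp [RingHom.mem_ker]

theorem homogeneousComponent_eq_zero_of_mem_pow {p : MvPolynomial ι k} {N e : ℕ}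
    (hp : p ∈ RingHom.ker (constantCoeff (R := k) (σ := ι)) ^ N) (he : e < N) :
    homogeneousComponent e p = 0 := by
  rw [ker_constantCoeff_eq_span] at hp
  have := (mem_pow_idealOfVars_iff' N p).1 hp
  ext m
  rw [coeff_homogeneousComponent, coeff_zero]
  split_ifs with h
  · exact this m (by omega)
  · rfl

theorem mul_sub_C_mul_mem {J : Ideal (MvPolynomial ι k)} {w : MvPolynomial ι k}
    (hw : ∀ i, X i * w ∈ J) (r : MvPolynomial ι k) : r * w - C (constantCoeff r) * w ∈ J := by
  have h : r - C (constantCoeff r) ∈ RingHom.ker (constantCoeff (R := k) (σ := ι)) := by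
    simp [RingHom.mem_ker]
  rw [ker_constantCoeff_eq_span] at h
  rw [← sub_mul]
  have : Ideal.span (Set.range X) ≤ Submodule.comap (LinearMap.mulRight (MvPolynomial ι k) w)
      J := by
    refine Ideal.span_le.2 ?_
    rintro _ ⟨i, rfl⟩
    exact hw i
  exact this h

theorem exists_mul_notMem_forall_X_mul_mem {J : Ideal (MvPolynomial ι k)} {N : ℕ}
    (hN : RingHom.ker (constantCoeff (R := k) (σ := ι)) ^ N ≤ J) {p : MvPolynomial ι k}
    (hp : p ∉ J) : ∃ r, r * p ∉ J ∧ ∀ i, X i * (r * p) ∈ J := by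
  have key : ∀ N, (∀ y ∈ RingHom.ker (constantCoeff (R := k) (σ := ι)) ^ N, y * p ∈ J) →
      ∃ r, r * p ∉ J ∧ ∀ i, X i * (r * p) ∈ J := by
    intro N
    induction N with
    | zero => intro h; exact absurd (by simpa using h 1 (by simp)) hp
    | succ N ih =>
      intro h
      by_cases hy : ∀ y ∈ RingHom.ker (constantCoeff (R := k) (σ := ι)) ^ N, y * p ∈ J
      · exact ih hy
      · push Not at hy
        obtain ⟨y, hy, hyp⟩ := hy
        refine ⟨y, hyp, fun i => ?_⟩
        rw [← mul_assoc, mul_comm (X i)]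
        exact h _ (pow_succ (RingHom.ker (constantCoeff (R := k) (σ := ι))) N ▸
          Ideal.mul_mem_mul hy (by simp [RingHom.mem_ker]))
  exact key N fun y hy => J.mul_mem_right _ (hN hy)

/-- The quotient by `J` has a simple essential socle generated in degree `s`. -/
def HasSocleDegree (J : Ideal (MvPolynomial ι k)) (s : ℕ) : Prop :=
  ∃ w : MvPolynomial ι k, w.IsHomogeneous s ∧ w ∉ J ∧ (∀ i, X i * w ∈ J) ∧
    ∀ p, p ∉ J → ∃ r, r * p - w ∈ J

theorem IsHomogIdeal.exists_comp_notMem {J : Ideal (MvPolynomial ι k)} {p : MvPolynomial ι k}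
    (hp : p ∉ J) :
    ∃ e, homogeneousComponent e p ∉ J := by
  by_contra! hc
  exact hp (IsHomogIdeal.mem_of_comp hc)

theorem IsHomogIdeal.mul_mem_comp {J : Ideal (MvPolynomial ι k)} (hJ : IsHomogIdeal J)
    {f p : MvPolynomial ι k} {a : ℕ}
    (hf : f.IsHomogeneous a) (h : f * p ∈ J) (e : ℕ) : f * homogeneousComponent e p ∈ J := by
  rw [← homogeneousComponent_mul_of_isHomogeneous hf]
  exact hJ _ h _

theorem homogeneousComponent_self {p : MvPolynomial ι k} {e : ℕ} (hp : p.IsHomogeneous e) :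
    homogeneousComponent e p = p := by
  rw [homogeneousComponent_of_mem hp, if_pos rfl]

theorem exists_homogeneous_mul_sub_mem {J : Ideal (MvPolynomial ι k)} (hJ : IsHomogIdeal J)
    {s e : ℕ} {p r w : MvPolynomial ι k} (hw : w.IsHomogeneous s) (hwJ : w ∉ J)
    (hp : p.IsHomogeneous e) (h : r * p - w ∈ J) :
    ∃ a r', s = a + e ∧ r'.IsHomogeneous a ∧ r' * p - w ∈ J := by
  have h1 := hJ _ h s
  rw [map_sub, homogeneousComponent_self hw, mul_comm] at h1
  rcases lt_or_ge s e with hlt | hge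
  · rw [homogeneousComponent_mul_of_lt hp hlt, zero_sub, neg_mem_iff] at h1
    exact absurd h1 hwJ
  · obtain ⟨a, rfl⟩ := Nat.exists_eq_add_of_le' hge
    rw [homogeneousComponent_mul_of_isHomogeneous hp, mul_comm] at h1
    exact ⟨a, _, rfl, homogeneousComponent_isHomogeneous _ _, h1⟩

theorem exists_pow_le_of_isArtinianRing {J : Ideal (MvPolynomial ι k)} (hJ : IsHomogIdeal J)
    (h : IsArtinianRing (MvPolynomial ι k ⧸ J)) :
    ∃ N, RingHom.ker (constantCoeff (R := k) (σ := ι)) ^ N ≤ J := by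
  set m := RingHom.ker (constantCoeff (R := k) (σ := ι))
  obtain ⟨N, hN⟩ := IsArtinian.monotone_stabilizes (R := MvPolynomial ι k ⧸ J)
    (M := MvPolynomial ι k ⧸ J)
    ⟨fun i => OrderDual.toDual ((m ^ i).map (Ideal.Quotient.mk J)),
      fun i j hij => Ideal.map_mono (Ideal.pow_le_pow_right hij)⟩
  refine ⟨N, fun p hp => IsHomogIdeal.mem_of_comp fun e => ?_⟩
  have h1 := hN (max N (e + 1)) (le_max_left _ _)
  replace h1 : (m ^ N).map (Ideal.Quotient.mk J) =
    (m ^ (max N (e + 1))).map (Ideal.Quotient.mk J) := h1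
  have h2 : Ideal.Quotient.mk J p ∈ (m ^ (max N (e + 1))).map (Ideal.Quotient.mk J) :=
    h1 ▸ Ideal.mem_map_of_mem _ hp
  obtain ⟨y, hy, hyp⟩ := (Ideal.mem_map_iff_of_surjective _ Ideal.Quotient.mk_surjective).1 h2
  have h3 := hJ _ (Ideal.Quotient.eq.1 hyp) e
  rw [map_sub, homogeneousComponent_eq_zero_of_mem_pow hy (by omega), zero_sub, neg_mem_iff] at h3
  exact h3

theorem mk_mem_socle {J : Ideal (MvPolynomial ι k)} {p : MvPolynomial ι k} :
    Ideal.Quotient.mk J p ∈ socle k J ↔ ∀ i, X i * p ∈ J := by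
  simp only [socle, Submodule.mem_iInf, LinearMap.mem_ker, LinearMap.mulLeft_apply]
  refine forall_congr' fun i => ?_
  rw [← map_mul, Ideal.Quotient.eq_zero_iff_mem]

theorem hasSocleDegree_of_artGor {J : Ideal (MvPolynomial ι k)} (hJ : IsHomogIdeal J)
    (h : artGor k J) :
    (∃ N, RingHom.ker (constantCoeff (R := k) (σ := ι)) ^ N ≤ J) ∧ ∃ s, HasSocleDegree J s := by
  obtain ⟨N, hN⟩ := exists_pow_le_of_isArtinianRing hJ h.1
  refine ⟨⟨N, hN⟩, ?_⟩
  obtain ⟨v, hv0, hv⟩ := finrank_eq_one_iff'.1 h.2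
  obtain ⟨⟨v, hvs⟩, rfl⟩ : ∃ v' : socle k J, v = v' := ⟨v, rfl⟩
  obtain ⟨z, rfl⟩ := Ideal.Quotient.mk_surjective v
  rw [mk_mem_socle] at hvs
  have hz : z ∉ J := fun h => hv0 (Subtype.ext (Ideal.Quotient.eq_zero_iff_mem.2 h))
  obtain ⟨s, hs⟩ := IsHomogIdeal.exists_comp_notMem hz
  have hX : ∀ i, X i * homogeneousComponent s z ∈ J := fun i =>
    hJ.mul_mem_comp (isHomogeneous_X k i) (hvs i) s
  have hsc : ∀ p, (∀ i, X i * p ∈ J) → ∃ c : k, C c * z - p ∈ J := by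
    intro p hp
    obtain ⟨c, hc⟩ := hv ⟨Ideal.Quotient.mk J p, mk_mem_socle.2 hp⟩
    refine ⟨c, ?_⟩
    have := congrArg Subtype.val hc
    rw [← Ideal.Quotient.eq, map_mul]
    refine Eq.trans ?_ this
    change _ = c • Ideal.Quotient.mk J z
    exact (Algebra.smul_def (A := MvPolynomial ι k ⧸ J) c _).symm
  refine ⟨s, homogeneousComponent s z, homogeneousComponent_isHomogeneous _ _, hs, hX,
    fun p hp => ?_⟩
  obtain ⟨r, hr, hrX⟩ := exists_mul_notMem_forall_X_mul_mem hN hp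
  obtain ⟨a, ha⟩ := hsc _ hrX
  obtain ⟨b, hb⟩ := hsc _ hX
  have ha0 : a ≠ 0 := by
    rintro rfl
    rw [C_0, zero_mul, zero_sub, neg_mem_iff] at ha
    exact hr ha
  refine ⟨C (b * a⁻¹) * r, ?_⟩
  have e : C (b * a⁻¹) * r * p - homogeneousComponent s z =
      (C b * z - homogeneousComponent s z) - C (b * a⁻¹) * (C a * z - r * p) := by
    have : C (b * a⁻¹) * (C a * z) = C b * z := by
      rw [← mul_assoc, ← C_mul, inv_mul_cancel_right₀ ha0]
    rw [mul_sub, this]; ring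
  rw [e]
  exact J.sub_mem hb (J.mul_mem_left _ ha)

end Gorenstein

section Substitution
variable {k : Type} [Field k] {ι : Type}

open scoped Classical in
/-- The substitution replacing the variable `v` by `h`. -/
def subst (v : ι) (h : MvPolynomial ι k) : MvPolynomial ι k →ₐ[k] MvPolynomial ι k :=
  aeval (Function.update X v h)

theorem subst_X_self (v : ι) (h : MvPolynomial ι k) : subst v h (X v) = h := by
  simp [subst]

theorem subst_X_of_ne {v i : ι} (hi : i ≠ v) (h : MvPolynomial ι k) : subst v h (X i) = X i := by
  classical simp [subst, Function.update_of_ne hi]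

theorem subst_of_notMem_vars {v : ι} {p : MvPolynomial ι k} (hp : v ∉ p.vars)
    (h : MvPolynomial ι k) : subst v h p = p := by
  have : (subst v h : MvPolynomial ι k →+* MvPolynomial ι k) p = RingHom.id _ p := by
    refine hom_congr_vars ?_ ?_ rfl
    · ext x
      simp [algHom_C]
    · intro i hi _
      have : i ≠ v := fun e => hp (e ▸ hi)
      simp [subst_X_of_ne this]
  simpa using this

theorem exists_sub_subst_eq (v : ι) (h p : MvPolynomial ι k) :
    ∃ y, p - subst v h p = (X v - h) * y := by
  induction p using MvPolynomial.induction_on with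
  | C a => exact ⟨0, by simp [algHom_C]⟩
  | add p q hp hq =>
    obtain ⟨y, hy⟩ := hp
    obtain ⟨z, hz⟩ := hq
    exact ⟨y + z, by rw [map_add, mul_add, ← hy, ← hz]; ring⟩
  | mul_X p i hp =>
    obtain ⟨y, hy⟩ := hp
    by_cases hi : i = v
    · subst hi
      refine ⟨y * X i + subst i h p, ?_⟩
      rw [map_mul, subst_X_self, mul_add, ← mul_assoc, ← hy]
      ring
    · refine ⟨y * X i, ?_⟩
      rw [map_mul, subst_X_of_ne hi, ← mul_assoc, ← hy]
      ring

/-- The ideal is generated by polynomials not involving the variable `v`. -/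
def Indep (v : ι) (J : Ideal (MvPolynomial ι k)) : Prop :=
  ∃ G : Set (MvPolynomial ι k), J = Ideal.span G ∧ ∀ g ∈ G, v ∉ g.vars

theorem Indep.sup_span {v : ι} {J : Ideal (MvPolynomial ι k)} (hJ : Indep v J)
    {f : MvPolynomial ι k} (hf : v ∉ f.vars) : Indep v (J ⊔ Ideal.span {f}) := by
  obtain ⟨G, rfl, hG⟩ := hJ
  refine ⟨G ∪ {f}, (Ideal.span_union _ _).symm, ?_⟩
  rintro g (hg | rfl)
  exacts [hG g hg, hf]

theorem Indep.exists_sub_subst_eq {v : ι} {J : Ideal (MvPolynomial ι k)} (hJ : Indep v J)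
    (h : MvPolynomial ι k) {x : MvPolynomial ι k} (hx : x ∈ J) :
    ∃ y ∈ J, x - subst v h x = (X v - h) * y := by
  obtain ⟨G, rfl, hG⟩ := hJ
  induction hx using Submodule.span_induction with
  | mem g hg => exact ⟨0, Ideal.zero_mem _, by simp [subst_of_notMem_vars (hG g hg)]⟩
  | zero => exact ⟨0, Ideal.zero_mem _, by simp⟩
  | add p q _ _ hp hq =>
    obtain ⟨y, hyJ, hy⟩ := hp
    obtain ⟨z, hzJ, hz⟩ := hq
    exact ⟨y + z, Ideal.add_mem _ hyJ hzJ, by rw [map_add, mul_add, ← hy, ← hz]; ring⟩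
  | smul a p hp ih =>
    obtain ⟨y, hyJ, hy⟩ := ih
    obtain ⟨z, hz⟩ := SRWLP.exists_sub_subst_eq v h a
    refine ⟨z * p + subst v h a * y, Ideal.add_mem _ (Ideal.mul_mem_left _ _ hp)
      (Ideal.mul_mem_left _ _ hyJ), ?_⟩
    have e : (X v - h) * (z * p + subst v h a * y) =
      ((X v - h) * z) * p + subst v h a * ((X v - h) * y) := by ring
    rw [e, ← hz, ← hy, smul_eq_mul, map_mul]
    ring

theorem Indep.subst_mem {v : ι} {J : Ideal (MvPolynomial ι k)} (hJ : Indep v J)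
    (h : MvPolynomial ι k) {x : MvPolynomial ι k} (hx : x ∈ J) : subst v h x ∈ J := by
  obtain ⟨y, hy, e⟩ := hJ.exists_sub_subst_eq h hx
  rw [show subst v h x = x - (X v - h) * y by rw [← e]; ring]
  exact J.sub_mem hx (J.mul_mem_left _ hy)

theorem X_sub_ne_zero {v : ι} {h : MvPolynomial ι k} (hh : v ∉ h.vars) : X v - h ≠ 0 := by
  intro e
  rw [sub_eq_zero] at e
  exact hh (by rw [← e, vars_X]; simp)

theorem Indep.mem_of_mul_mem {v : ι} {J : Ideal (MvPolynomial ι k)} (hJ : Indep v J)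
    {h : MvPolynomial ι k} (hh : v ∉ h.vars) {p : MvPolynomial ι k} (hp : (X v - h) * p ∈ J) :
    p ∈ J := by
  obtain ⟨y, hy, e⟩ := hJ.exists_sub_subst_eq h hp
  rw [map_mul, map_sub, subst_X_self, subst_of_notMem_vars hh, sub_self, zero_mul, sub_zero] at e
  rwa [mul_left_cancel₀ (X_sub_ne_zero hh) e]

theorem Indep.mem_of_X_mul_mem {v : ι} {J : Ideal (MvPolynomial ι k)} (hJ : Indep v J)
    {p : MvPolynomial ι k} (hp : X v * p ∈ J) : p ∈ J :=
  hJ.mem_of_mul_mem (h := 0) (by simp) (by simpa using hp)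

end Substitution

section Complex
variable {k : Type} [Field k] {n : ℕ}

/-- The ideal of polynomials all of whose monomials have support not contained, together with
`τ`, in a face of `D`; this is the Stanley–Reisner ideal of the star of `τ` when `τ` is a face. -/
def starIdeal (k : Type) [Field k] (D : SC n) (τ : Finset (Fin n)) :
    Ideal (MvPolynomial (Fin n) k) :=
  Ideal.span ((fun m => monomial m (1 : k)) '' {m | m.support ∪ τ ∉ D.faces})

theorem mem_starIdeal {D : SC n} {τ : Finset (Fin n)} {p : MvPolynomial (Fin n) k} :
    p ∈ starIdeal k D τ ↔ ∀ m ∈ p.support, m.support ∪ τ ∉ D.faces := by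
  rw [starIdeal, mem_ideal_span_monomial_image]
  refine forall₂_congr fun m _ => ⟨?_, fun h => ⟨m, h, le_rfl⟩⟩
  rintro ⟨m', hm', hle⟩ hm
  exact hm' (D.down_closed _ hm _ (Finset.union_subset_union_left (Finsupp.support_mono hle)))

theorem starIdeal_mono (D : SC n) {τ τ' : Finset (Fin n)} (h : τ ⊆ τ') :
    starIdeal k D τ ≤ starIdeal k D τ' := by
  intro p hp
  rw [mem_starIdeal] at hp ⊢
  exact fun m hm hmf => hp m hm (D.down_closed _ hmf _ (Finset.union_subset_union_right h))

theorem starIdeal_isHomogIdeal (D : SC n) (τ : Finset (Fin n)) :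
    IsHomogIdeal (starIdeal k D τ) := by
  intro p hp e
  rw [mem_starIdeal] at hp ⊢
  intro m hm
  refine hp m ?_
  rw [mem_support_iff, coeff_homogeneousComponent] at hm
  rw [mem_support_iff]
  intro h
  simp [h] at hm

theorem X_mul_mem_starIdeal {D : SC n} {τ : Finset (Fin n)} {v : Fin n}
    {p : MvPolynomial (Fin n) k} :
    X v * p ∈ starIdeal k D τ ↔ p ∈ starIdeal k D (insert v τ) := by
  have h : ∀ m : Fin n →₀ ℕ, (Finsupp.single v 1 + m).support ∪ τ = m.support ∪ insert v τ := by
    intro m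
    ext i
    simp only [Finset.mem_union, Finsupp.mem_support_iff, Finsupp.add_apply, Finset.mem_insert,
      Finsupp.single_apply]
    by_cases hi : v = i
    · simp [hi]
    · simp [hi, Ne.symm hi]
  rw [mem_starIdeal, mem_starIdeal, support_X_mul]
  simp only [Finset.mem_map, addLeftEmbedding_apply, forall_exists_index, and_imp,
    forall_apply_eq_imp_iff₂, h]

theorem xFace_mul_mem_starIdeal {D : SC n} {σ τ : Finset (Fin n)} {p : MvPolynomial (Fin n) k} :
    xFace k σ * p ∈ starIdeal k D τ ↔ p ∈ starIdeal k D (σ ∪ τ) := by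
  induction σ using Finset.induction_on generalizing p with
  | empty => simp [xFace]
  | insert v σ hv ih =>
    rw [xFace, Finset.prod_insert hv, ← xFace, mul_comm (X v), mul_assoc, ih, X_mul_mem_starIdeal,
      Finset.insert_union]

theorem starIdeal_indep (D : SC n) {τ : Finset (Fin n)} {v : Fin n} (hv : v ∈ τ) :
    Indep v (starIdeal k D τ) := by
  refine ⟨(fun m => monomial m (1 : k)) '' {m | m.support ∪ τ ∉ D.faces ∧ m v = 0}, ?_, ?_⟩
  · refine le_antisymm (fun p hp => ?_) (Ideal.span_mono (Set.image_mono fun m hm => hm.1))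
    rw [mem_ideal_span_monomial_image]
    intro m hm
    refine ⟨m.erase v, ⟨?_, by simp⟩, fun i => ?_⟩
    · have := mem_starIdeal.1 hp m hm
      have e : (m.erase v).support ∪ τ = m.support ∪ τ := by
        ext i
        by_cases hi : i = v <;> simp [hi, hv]
      rwa [e]
    · by_cases hi : i = v
      · simp [hi]
      · rw [Finsupp.erase_ne hi]
  · rintro _ ⟨m, hm, rfl⟩
    rw [vars_monomial one_ne_zero]
    simpa using hm.2

theorem srIdeal_eq_starIdeal (D : SC n) : srIdeal k D = starIdeal k D ∅ := by
  apply le_antisymm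
  · refine Ideal.span_le.2 ?_
    rintro _ ⟨s, hs, rfl⟩
    have := (xFace_mul_mem_starIdeal (k := k) (D := D) (σ := s) (τ := ∅) (p := 1)).2 ?_
    · rw [mul_one] at this
      exact this
    · rw [mem_starIdeal]
      intro m hm
      rw [Finset.union_empty]
      exact fun h => hs (D.down_closed _ h _ Finset.subset_union_right)
  · refine Ideal.span_le.2 ?_
    rintro _ ⟨m, hm, rfl⟩
    have h1 : (∏ i ∈ m.support, X i : MvPolynomial (Fin n) k) ∈ srIdeal k D :=
      Ideal.subset_span ⟨m.support, by simpa using hm, rfl⟩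
    refine Ideal.mem_of_dvd _ ?_ h1
    simp only
    rw [monomial_eq, C_1, one_mul]
    refine Finset.prod_dvd_prod_of_dvd _ _ fun i hi => dvd_pow_self _ (by simpa using hi)

theorem linkIdeal_eq_starIdeal (D : SC n) (σ : Finset (Fin n)) :
    linkIdeal k D σ = starIdeal k D σ := by
  ext p
  rw [linkIdeal, srIdeal_eq_starIdeal, Ideal.span, Submodule.colon_span,
      Submodule.mem_colon_singleton,
    smul_eq_mul, mul_comm, xFace_mul_mem_starIdeal, Finset.union_empty]

end Complex

section LinearForms
variable {k : Type} [Field k] {ι : Type} [Fintype ι]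

theorem linForm_isHomogeneous (c : ι → k) : (linForm k c).IsHomogeneous 1 :=
  IsHomogeneous.sum _ _ _ fun i _ => by
    simpa using (isHomogeneous_C ι (c i)).mul (isHomogeneous_X k i)

theorem linForm_add (c c' : ι → k) : linForm k (c + c') = linForm k c + linForm k c' := by
  simp [linForm, add_mul, Finset.sum_add_distrib]

theorem linForm_smul (a : k) (c : ι → k) : linForm k (a • c) = C a * linForm k c := by
  simp [linForm, Finset.mul_sum, mul_assoc]

theorem linForm_single [DecidableEq ι] (v : ι) : linForm k (Pi.single v 1) = X v := by
  rw [linForm, Finset.sum_eq_single v]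
  · simp
  · intro i _ hi
    simp [hi]
  · simp

theorem notMem_vars_linForm {c : ι → k} {v : ι} (h : c v = 0) : v ∉ (linForm k c).vars := by
  classical
  intro hv
  obtain ⟨i, hi, hvi⟩ := Finset.mem_biUnion.1 (vars_sum_subset _ _ hv)
  rcases eq_or_ne (c i) 0 with h0 | h0
  · simp [h0] at hvi
  · have := vars_mul _ _ hvi
    simp only [vars_C, vars_X, Finset.empty_union, Finset.mem_singleton] at this
    exact h0 (this ▸ h)

end LinearForms

section Congr
variable {k : Type} [Field k] {ι : Type}

theorem sup_span_singleton_congr {A : Type*} [CommRing A] {J : Ideal A} {f g : A}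
    (h : f - g ∈ J) : J ⊔ Ideal.span {f} = J ⊔ Ideal.span {g} := by
  have key : ∀ {f g : A}, f - g ∈ J → J ⊔ Ideal.span {f} ≤ J ⊔ Ideal.span {g} := by
    intro f g h
    refine sup_le le_sup_left ((Ideal.span_singleton_le_iff_mem _).2 ?_)
    exact mem_sup_span_singleton_iff.2 ⟨1, by simpa using h⟩
  exact le_antisymm (key h) (key (neg_sub f g ▸ J.neg_mem h))

theorem sup_ofList_map_congr {α : Type*} {J : Ideal (MvPolynomial ι k)} {L : List α}
    {F G : α → MvPolynomial ι k} (h : ∀ c, F c - G c ∈ J) :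
    J ⊔ Ideal.ofList (L.map F) = J ⊔ Ideal.ofList (L.map G) := by
  induction L generalizing J with
  | nil => simp
  | cons c L ih =>
    rw [List.map_cons, List.map_cons, sup_ofList_cons, sup_ofList_cons,
      sup_span_singleton_congr (h c)]
    exact ih fun c => Ideal.mem_sup_left (h c)

theorem IsRegSeq.map_congr {α : Type*} {J : Ideal (MvPolynomial ι k)} {L : List α}
    {F G : α → MvPolynomial ι k} (h : ∀ c, F c - G c ∈ J) (hF : IsRegSeq J (L.map F)) :
    IsRegSeq J (L.map G) := by
  induction L generalizing J with
  | nil => trivial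
  | cons c L ih =>
    refine ⟨fun p hp => hF.1 p ?_, ?_⟩
    · have e : F c * p = (F c - G c) * p + G c * p := by ring
      rw [e]
      exact J.add_mem (J.mul_mem_right _ (h c)) hp
    · rw [← sup_span_singleton_congr (h c)]
      exact ih (fun c => Ideal.mem_sup_left (h c)) hF.2

/-- `B` is the quotient of `A` by the variable `v` and is independent of that variable. -/
structure IsVarQuotient (v : ι) (A B : Ideal (MvPolynomial ι k)) : Prop where
  indep : Indep v B
  le : A ≤ B
  mul_mem : ∀ p ∈ B, X v * p ∈ A

theorem IsVarQuotient.mul_mem_iff {v : ι} {A B : Ideal (MvPolynomial ι k)} (h : IsVarQuotient v A B)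
    {p : MvPolynomial ι k} : X v * p ∈ A ↔ p ∈ B :=
  ⟨fun hp => h.indep.mem_of_X_mul_mem (h.le hp), h.mul_mem p⟩

theorem mul_mem_sup_of_mul_mem {A B K : Ideal (MvPolynomial ι k)} {x : MvPolynomial ι k}
    (h : ∀ p ∈ B, x * p ∈ A) : ∀ p ∈ B ⊔ K, x * p ∈ A ⊔ K := by
  intro p hp
  obtain ⟨y, hy, z, hz, rfl⟩ := Submodule.mem_sup.1 hp
  rw [mul_add]
  exact Ideal.add_mem _ (Ideal.mem_sup_left (h y hy))
    (Ideal.mem_sup_right (Ideal.mul_mem_left _ _ hz))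

theorem IsVarQuotient.sup_span {v : ι} {A B : Ideal (MvPolynomial ι k)} (h : IsVarQuotient v A B)
    {f : MvPolynomial ι k} (hf : v ∉ f.vars) :
    IsVarQuotient v (A ⊔ Ideal.span {f}) (B ⊔ Ideal.span {f}) where
  indep := h.indep.sup_span hf
  le := sup_le_sup_right h.le _
  mul_mem := mul_mem_sup_of_mul_mem h.mul_mem

theorem IsVarQuotient.sup_ofList {v : ι} {A B : Ideal (MvPolynomial ι k)} (h : IsVarQuotient v A B)
    {l : List (MvPolynomial ι k)} (hl : ∀ f ∈ l, v ∉ f.vars) :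
    IsVarQuotient v (A ⊔ Ideal.ofList l) (B ⊔ Ideal.ofList l) := by
  induction l generalizing A B with
  | nil => simpa using h
  | cons f l ih =>
    rw [sup_ofList_cons, sup_ofList_cons]
    exact ih (h.sup_span (hl f (by simp))) fun g hg => hl g (List.mem_cons_of_mem _ hg)

theorem IsVarQuotient.isRegSeq {v : ι} {A B : Ideal (MvPolynomial ι k)} (h : IsVarQuotient v A B)
    {l : List (MvPolynomial ι k)} (hl : ∀ f ∈ l, v ∉ f.vars) (hA : IsRegSeq A l) :
    IsRegSeq B l := by
  induction l generalizing A B with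
  | nil => trivial
  | cons f l ih =>
    refine ⟨fun p hp => h.mul_mem_iff.1 (hA.1 _ ?_),
      ih (h.sup_span (hl f (by simp))) (fun g hg => hl g (List.mem_cons_of_mem _ hg)) hA.2⟩
    rw [mul_left_comm]
    exact h.mul_mem_iff.2 hp

theorem subst_subst {v : ι} {h : MvPolynomial ι k} (hh : v ∉ h.vars) (p : MvPolynomial ι k) :
    subst v h (subst v h p) = subst v h p := by
  have : (subst v h).comp (subst v h) = subst v h := by
    ext i
    by_cases hi : i = v
    · subst hi
      simp [subst_X_self, subst_of_notMem_vars hh]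
    · simp [subst_X_of_ne hi]
  exact DFunLike.congr_fun this p

theorem IsVarQuotient.le_or_mul_mem_iff [Fintype ι] {v : ι} {A B : Ideal (MvPolynomial ι k)}
    (hAB : IsVarQuotient v A B)
    {c : ι → k} (hc : c v = 0)
    (hreg : ∀ p, (X v - linForm k c) * p ∈ A → p ∈ A) {N s : ℕ}
    (hN : RingHom.ker (constantCoeff (R := k) (σ := ι)) ^ N ≤ A ⊔ Ideal.span {X v - linForm k c})
    (hG : HasSocleDegree (A ⊔ Ideal.span {X v - linForm k c}) s) :
    B ⊔ Ideal.span {X v - linForm k c} ≤ A ⊔ Ideal.span {X v - linForm k c} ∨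
      ∀ p, X v * p ∈ A ⊔ Ideal.span {X v - linForm k c} ↔
        p ∈ B ⊔ Ideal.span {X v - linForm k c} := by
  set h := linForm k c with hh_def
  have hh : v ∉ h.vars := notMem_vars_linForm hc
  set b := A ⊔ Ideal.span {X v - h} with hb
  set b2 := B ⊔ Ideal.span {X v - h} with hb2
  have hle : b ≤ b2 := sup_le_sup_right hAB.le _
  have hf0 : X v - h ∈ b2 := Ideal.mem_sup_right (Ideal.mem_span_singleton_self _)
  by_cases hall : ∀ p, X v * p ∈ b → p ∈ b2
  · exact Or.inr fun p => ⟨hall p, mul_mem_sup_of_mul_mem hAB.mul_mem p⟩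
  refine Or.inl ?_
  push Not at hall
  obtain ⟨q, hq, hqb⟩ := hall
  obtain ⟨r, hr, hrX⟩ := exists_mul_notMem_forall_X_mul_mem (hN.trans hle) hqb
  obtain ⟨y, hy⟩ := exists_sub_subst_eq v h (r * q)
  obtain ⟨p, hp⟩ : ∃ p, p = subst v h (r * q) := ⟨_, rfl⟩
  have hpe : p = r * q - (X v - h) * y := by rw [hp, ← hy]; ring
  have hsp : subst v h p = p := by rw [hp, subst_subst hh]
  have hpb2 : p ∉ b2 := fun hmem => hr (by
    rw [show r * q = p + (X v - h) * y by rw [hpe]; ring]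
    exact b2.add_mem hmem (b2.mul_mem_right _ hf0))
  have hvp : X v * p ∈ b := by
    rw [hpe, show X v * (r * q - (X v - h) * y) = r * (X v * q) - (X v - h) * (X v * y) by ring]
    exact b.sub_mem (b.mul_mem_left _ hq) (b.mul_mem_right _
      (Ideal.mem_sup_right (Ideal.mem_span_singleton_self _)))
  have hXp : ∀ i, i ≠ v → X i * p ∈ B := by
    intro i hi
    have h1 : X i * p ∈ b2 := by
      rw [hpe, mul_sub]
      exact b2.sub_mem (hrX i) (b2.mul_mem_left _ (b2.mul_mem_right _ hf0))
    obtain ⟨t, ht⟩ := mem_sup_span_singleton_iff.1 h1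
    have h2 := hAB.indep.subst_mem h ht
    rwa [map_sub, map_mul, map_mul, map_sub, subst_X_self, subst_X_of_ne hi,
      subst_of_notMem_vars hh, sub_self, zero_mul, sub_zero, hsp] at h2
  have hhp : h * p ∈ B := by
    rw [hh_def, linForm, Finset.sum_mul]
    refine B.sum_mem fun i _ => ?_
    by_cases hi : i = v
    · simp [hi, hc]
    · rw [mul_assoc]
      exact B.mul_mem_left _ (hXp i hi)
  obtain ⟨e, he⟩ := mem_sup_span_singleton_iff.1 hvp
  have hep : e - p ∈ B := by
    refine hAB.indep.mem_of_mul_mem hh ?_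
    rw [show (X v - h) * (e - p) = h * p - (X v * p - (X v - h) * e) by ring]
    exact B.sub_mem hhp (hAB.le he)
  have heb2 : e ∉ b2 := fun hmem => hpb2 (by
    rw [show p = e - (e - p) by ring]
    exact b2.sub_mem hmem (Ideal.mem_sup_left hep))
  have hXe : ∀ i, X i * e ∈ b := by
    intro i
    by_cases hi : i = v
    · rw [hi, show X v * e = X v * (e - p) + X v * p by ring]
      exact b.add_mem (Ideal.mem_sup_left (hAB.mul_mem _ hep)) hvp
    · refine Ideal.mem_sup_left (hreg _ ?_)
      rw [show (X v - h) * (X i * e) = X v * (X i * p) - X i * (X v * p - (X v - h) * e) by ring]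
      exact A.sub_mem (hAB.mul_mem _ (hXp i hi)) (A.mul_mem_left _ he)
  obtain ⟨w, -, hwb, -, hwr⟩ := hG
  obtain ⟨t, ht⟩ := hwr e fun hmem => heb2 (hle hmem)
  have h3 := b.sub_mem ht (mul_sub_C_mul_mem hXe t)
  have h4 : C (constantCoeff t) * e - w ∈ b := by convert h3 using 1; ring
  have ht0 : constantCoeff t ≠ 0 := by
    intro h0
    rw [h0, C_0, zero_mul, zero_sub, neg_mem_iff] at h4
    exact hwb h4
  have hwb2 : w ∉ b2 := by
    intro hmem
    have h5 := b2.mul_mem_left (C (constantCoeff t)⁻¹) (b2.add_mem (hle h4) hmem)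
    rw [sub_add_cancel, ← mul_assoc, ← C_mul, inv_mul_cancel₀ ht0, C_1, one_mul] at h5
    exact heb2 h5
  intro x hx
  by_contra hxb
  obtain ⟨u, hu⟩ := hwr x hxb
  refine hwb2 ?_
  rw [show w = u * x - (u * x - w) by ring]
  exact b2.sub_mem (b2.mul_mem_left _ hx) (hle hu)

theorem HasSocleDegree.of_X_mul_mem_iff {b b2 : Ideal (MvPolynomial ι k)} (hb : IsHomogIdeal b)
    {v : ι} {s : ℕ}
    (hG : HasSocleDegree b s) (h : ∀ p, X v * p ∈ b ↔ p ∈ b2) (h1 : (1 : MvPolynomial ι k) ∉ b2) :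
    ∃ a, s = a + 1 ∧ HasSocleDegree b2 a := by
  obtain ⟨w, hw, hwb, hXw, hr⟩ := hG
  have hv : X v ∉ b := fun hm => h1 ((h 1).1 (by simpa using hm))
  obtain ⟨r, hr1⟩ := hr _ hv
  obtain ⟨a, r', rfl, hr', hr'w⟩ := exists_homogeneous_mul_sub_mem hb hw hwb (isHomogeneous_X k v)
      hr1
  refine ⟨a, rfl, r', hr', fun hm => hwb ?_, fun i => (h _).1 ?_, fun p hp => ?_⟩
  · rw [show w = X v * r' - (r' * X v - w) by ring]
    exact b.sub_mem ((h _).2 hm) hr'w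
  · rw [show X v * (X i * r') = X i * (r' * X v - w) + X i * w by ring]
    exact b.add_mem (b.mul_mem_left _ hr'w) (hXw i)
  · obtain ⟨t, ht⟩ := hr _ fun hm => hp ((h p).1 hm)
    refine ⟨t, (h _).1 ?_⟩
    rw [show X v * (t * p - r') = (t * (X v * p) - w) - (r' * X v - w) by ring]
    exact b.sub_mem ht hr'w

end Congr

section Step
variable {k : Type} [Field k] {n : ℕ}

theorem IsRegSeq.perm {J : Ideal (MvPolynomial (Fin n) k)} (hJ : IsHomogIdeal J)
    {l l' : List (MvPolynomial (Fin n) k)} (hp : l.Perm l')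
    (hl : ∀ f ∈ l, f.IsHomogeneous 1) (h : IsRegSeq J l) : IsRegSeq J l' := by
  refine IsLocRegSeq.isRegSeq hJ (fun f hf => ⟨1, hl f (hp.mem_iff.2 hf)⟩)
      (h.isLocRegSeq.perm hp fun f hf => ?_)
  rw [constantCoeff_eq]
  exact (hl f hf).coeff_eq_zero (by simp)

/-- Linear change making the form with coefficients `c` free of the variable `v`. -/
def elimForm (c₀ : Fin n → k) (v : Fin n) (c : Fin n → k) : MvPolynomial (Fin n) k :=
  linForm k (c - (c v / c₀ v) • c₀)

theorem elimForm_eq (c₀ : Fin n → k) (v : Fin n) (c : Fin n → k) :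
    elimForm c₀ v c = linForm k c - C (c v / c₀ v) * linForm k c₀ := by
  rw [elimForm, sub_eq_add_neg, ← neg_smul, linForm_add, linForm_smul, C_neg]
  ring

theorem notMem_vars_elimForm {c₀ : Fin n → k} {v : Fin n} (h0 : c₀ v ≠ 0) (c : Fin n → k) :
    v ∉ (elimForm c₀ v c).vars :=
  notMem_vars_linForm (by simp [h0])

theorem isVarQuotient_starIdeal (D : SC n) (τ : Finset (Fin n)) (v : Fin n) :
    IsVarQuotient v (starIdeal k D τ) (starIdeal k D (insert v τ)) where
  indep := starIdeal_indep D (Finset.mem_insert_self v τ)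
  le := starIdeal_mono D (Finset.subset_insert v τ)
  mul_mem := fun _ hp => X_mul_mem_starIdeal.2 hp

/-- `starIdeal k D τ` together with a list of linear forms. -/
def starReduction (D : SC n) (L : List (Fin n → k)) (τ : Finset (Fin n)) :
    Ideal (MvPolynomial (Fin n) k) :=
  starIdeal k D τ ⊔ Ideal.ofList (L.map (linForm k))

theorem starReduction_isHomogIdeal (D : SC n) (L : List (Fin n → k)) (τ : Finset (Fin n)) :
    IsHomogIdeal (starReduction D L τ) :=
  (starIdeal_isHomogIdeal D τ).sup_ofList fun f hf => by
    obtain ⟨c, -, rfl⟩ := List.mem_map.1 hf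
    exact ⟨1, linForm_isHomogeneous c⟩

theorem linForm_sub_elimForm_mem (J : Ideal (MvPolynomial (Fin n) k)) (c₀ : Fin n → k) (v : Fin n)
    (c : Fin n → k) : linForm k c - elimForm c₀ v c ∈ J ⊔ Ideal.span {linForm k c₀} := by
  rw [elimForm_eq, sub_sub_cancel]
  exact Ideal.mem_sup_right (Ideal.mul_mem_left _ _ (Ideal.mem_span_singleton_self _))

/-- The linear form in the other variables to which `X v` becomes equal modulo `linForm k c₀`. -/
def solveForm (c₀ : Fin n → k) (v : Fin n) : Fin n → k :=
  Pi.single v 1 + (-(c₀ v)⁻¹) • c₀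

theorem X_sub_linForm_solveForm (c₀ : Fin n → k) (v : Fin n) :
    X v - linForm k (solveForm c₀ v) = C (c₀ v)⁻¹ * linForm k c₀ := by
  rw [solveForm, linForm_add, linForm_smul, linForm_single, C_neg]
  ring

theorem linForm_eq_C_mul {c₀ : Fin n → k} {v : Fin n} (h0 : c₀ v ≠ 0) :
    linForm k c₀ = C (c₀ v) * (X v - linForm k (solveForm c₀ v)) := by
  rw [X_sub_linForm_solveForm, ← mul_assoc, ← C_mul, mul_inv_cancel₀ h0, C_1, one_mul]

theorem solveForm_self {c₀ : Fin n → k} {v : Fin n} (h0 : c₀ v ≠ 0) : solveForm c₀ v v = 0 := by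
  simp [solveForm, h0]

theorem span_X_sub_linForm_solveForm {c₀ : Fin n → k} {v : Fin n} (h0 : c₀ v ≠ 0) :
    Ideal.span {X v - linForm k (solveForm c₀ v)} = Ideal.span {linForm k c₀} := by
  rw [X_sub_linForm_solveForm]
  exact Ideal.span_singleton_mul_left_unit ((inv_ne_zero h0).isUnit.map C) _

theorem sup_ofList_elimForm (J : Ideal (MvPolynomial (Fin n) k)) (c₀ : Fin n → k)
    (L : List (Fin n → k)) (v : Fin n) :
    J ⊔ Ideal.ofList ((c₀ :: L).map (linForm k)) =
      J ⊔ Ideal.ofList (L.map (elimForm c₀ v)) ⊔ Ideal.span {linForm k c₀} := by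
  rw [List.map_cons, sup_ofList_cons, sup_ofList_map_congr (linForm_sub_elimForm_mem J c₀ v),
    sup_right_comm]

theorem isRegSeq_elimForm_iff {J : Ideal (MvPolynomial (Fin n) k)} (hJ : IsHomogIdeal J)
    (c₀ : Fin n → k)
    (L : List (Fin n → k)) (v : Fin n) :
    IsRegSeq J ((c₀ :: L).map (linForm k)) ↔
      IsRegSeq J (L.map (elimForm c₀ v) ++ [linForm k c₀]) := by
  have hh : ∀ f ∈ linForm k c₀ :: L.map (elimForm c₀ v), f.IsHomogeneous 1 := by
    intro f hf
    rcases List.mem_cons.1 hf with rfl | hf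
    · exact linForm_isHomogeneous _
    · obtain ⟨c, -, rfl⟩ := List.mem_map.1 hf
      exact linForm_isHomogeneous _
  have hperm : (L.map (elimForm c₀ v) ++ [linForm k c₀]).Perm
    (linForm k c₀ :: L.map (elimForm c₀ v)) := List.perm_append_singleton _ _
  constructor
  · intro h
    exact IsRegSeq.perm hJ hperm.symm hh
      ⟨h.1, h.2.map_congr (linForm_sub_elimForm_mem J c₀ v)⟩
  · intro h
    have h' := IsRegSeq.perm hJ hperm (fun f hf => hh f (hperm.mem_iff.1 hf)) h
    refine ⟨h'.1, h'.2.map_congr fun c => ?_⟩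
    rw [← neg_mem_iff, neg_sub]
    exact linForm_sub_elimForm_mem J c₀ v c

theorem forall_mem_map_elimForm {c₀ : Fin n → k} {v : Fin n} (h0 : c₀ v ≠ 0)
    (L : List (Fin n → k)) : ∀ f ∈ L.map (elimForm c₀ v), v ∉ f.vars := by
  intro f hf
  obtain ⟨c, -, rfl⟩ := List.mem_map.1 hf
  exact notMem_vars_elimForm h0 c

theorem isRegSeq_starIdeal_insert {D : SC n} {τ : Finset (Fin n)} {v : Fin n} {c₀ : Fin n → k}
    (h0 : c₀ v ≠ 0) {L : List (Fin n → k)}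
    (h : IsRegSeq (starIdeal k D τ) ((c₀ :: L).map (linForm k))) :
    IsRegSeq (starIdeal k D (insert v τ)) ((c₀ :: L).map (linForm k)) := by
  rw [isRegSeq_elimForm_iff (starIdeal_isHomogIdeal D _) c₀ L v] at h ⊢
  have hv := forall_mem_map_elimForm h0 L
  refine isRegSeq_append.2 ⟨(isVarQuotient_starIdeal D τ v).isRegSeq hv (isRegSeq_append.1 h).1,
      fun p hp => ?_, trivial⟩
  refine ((isVarQuotient_starIdeal D τ v).sup_ofList hv).indep.mem_of_mul_mem
    (notMem_vars_linForm (solveForm_self h0)) ?_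
  rw [X_sub_linForm_solveForm, mul_assoc]
  exact Ideal.mul_mem_left _ _ hp

theorem starReduction_insert_le_or {D : SC n} {τ : Finset (Fin n)} {v : Fin n} {c₀ : Fin n → k}
    (h0 : c₀ v ≠ 0) {L : List (Fin n → k)}
    (h : IsRegSeq (starIdeal k D τ) ((c₀ :: L).map (linForm k)))
    {N s : ℕ} (hN : RingHom.ker (constantCoeff (R := k) (σ := Fin n)) ^ N ≤
        starReduction D (c₀ :: L) τ)
    (hG : HasSocleDegree (starReduction D (c₀ :: L) τ) s) :
    starReduction D (c₀ :: L) (insert v τ) ≤ starReduction D (c₀ :: L) τ ∨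
      ∀ p, X v * p ∈ starReduction D (c₀ :: L) τ ↔ p ∈ starReduction D (c₀ :: L) (insert v τ) := by
  have hv := forall_mem_map_elimForm h0 L
  simp only [starReduction, sup_ofList_elimForm _ c₀ L v, ← span_X_sub_linForm_solveForm h0]
    at hN hG ⊢
  refine ((isVarQuotient_starIdeal D τ v).sup_ofList hv).le_or_mul_mem_iff (solveForm_self h0)
      (fun p hp => ?_) hN hG
  refine (isRegSeq_append.1 ((isRegSeq_elimForm_iff (starIdeal_isHomogIdeal D _) c₀ L v).1 h)).2.1 p
      ?_
  rw [linForm_eq_C_mul h0, mul_assoc]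
  exact Ideal.mul_mem_left _ _ hp

end Step

section Nakayama
variable {k : Type} [Field k] {ι : Type}

theorem IsHomogIdeal.le_of_le_sup_ofList [Fintype ι] {J₁ J₂ : Ideal (MvPolynomial ι k)}
    (h₁ : IsHomogIdeal J₁)
    (hle : J₁ ≤ J₂) {l : List (MvPolynomial ι k)} (hl : ∀ f ∈ l, f.IsHomogeneous 1)
    (hreg : IsRegSeq J₂ l) (h : J₂ ≤ J₁ ⊔ Ideal.ofList l) : J₂ ≤ J₁ := by
  induction l using List.reverseRecOn with
  | nil => simpa using h
  | append_singleton l f ih =>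
    obtain ⟨hreg1, hreg2, -⟩ := isRegSeq_append.1 hreg
    have hl' : ∀ g ∈ l, g.IsHomogeneous 1 := fun g hg => hl g (by simp [hg])
    refine ih hl' hreg1 (le_sup_left.trans (b := J₂ ⊔ Ideal.ofList l) ?_)
    refine IsHomogIdeal.eq_of_le_sup_mul (h₁.sup_ofList fun g hg => ⟨1, hl' g hg⟩) fun x hx => ?_
    rw [Ideal.ofList_append, Ideal.ofList_singleton, ← sup_assoc] at h
    have hx' : x ∈ J₁ ⊔ Ideal.ofList l ⊔ Ideal.span {f} :=
      sup_le h (le_sup_right.trans le_sup_left) hx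
    obtain ⟨q, hq⟩ := mem_sup_span_singleton_iff.1 hx'
    have hfq : f * q ∈ J₂ ⊔ Ideal.ofList l := by
      rw [show f * q = x - (x - f * q) by ring]
      exact Ideal.sub_mem _ hx (sup_le_sup_right hle _ hq)
    rw [show x = (x - f * q) + f * q by ring]
    refine Ideal.add_mem _ (Ideal.mem_sup_left hq) (Ideal.mem_sup_right ?_)
    refine Ideal.mul_mem_mul ?_ (hreg2 q hfq)
    rw [RingHom.mem_ker, constantCoeff_eq]
    exact (hl f (by simp)).coeff_eq_zero (by simp)

theorem IsRegSeq.eq_zero_of_mem_span {J : Ideal (MvPolynomial ι k)} {l : List (MvPolynomial ι k)}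
    (h : IsRegSeq J l) (hJ : J ≤ RingHom.ker (constantCoeff (R := k) (σ := ι)))
    (hl : ∀ f ∈ l, constantCoeff f = 0) {g : MvPolynomial ι k}
    (hg : g ∈ Submodule.span k {x | x ∈ l}) (hgJ : g ∈ J) : g = 0 := by
  induction l generalizing J g with
  | nil => simpa using hg
  | cons f l ih =>
    have e : {x | x ∈ f :: l} = insert f {x | x ∈ l} := by ext; simp
    rw [e] at hg
    obtain ⟨a, g', hg', rfl⟩ := Submodule.mem_span_insert.1 hg
    have h0 : g' = 0 := by
      refine ih h.2 (sup_le hJ ((Ideal.span_singleton_le_iff_mem _).2 (hl f (by simp))))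
        (fun x hx => hl x (List.mem_cons_of_mem _ hx)) hg' ?_
      refine mem_sup_span_singleton_iff.2 ⟨-C a, ?_⟩
      convert hgJ using 1
      rw [smul_eq_C_mul]
      ring
    rw [h0, add_zero, smul_eq_C_mul] at hgJ ⊢
    have := hJ (h.1 (C a) (by rwa [mul_comm]))
    rw [RingHom.mem_ker, constantCoeff_C] at this
    simp [this]

theorem exists_mem_span_sub_mem {J : Ideal (MvPolynomial ι k)} (hJ : IsHomogIdeal J)
    {l : List (MvPolynomial ι k)} (hl : ∀ f ∈ l, f.IsHomogeneous 1) {y : MvPolynomial ι k}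
    (hy : y.IsHomogeneous 1) (h : y ∈ J ⊔ Ideal.ofList l) :
    ∃ g ∈ Submodule.span k {x | x ∈ l}, y - g ∈ J := by
  induction l generalizing y with
  | nil => exact ⟨0, Submodule.zero_mem _, by simpa using h⟩
  | cons f l ih =>
    rw [sup_ofList_cons, sup_right_comm] at h
    have hf := hl f (by simp)
    have hl' : ∀ g ∈ l, g.IsHomogeneous 1 := fun g hg => hl g (List.mem_cons_of_mem _ hg)
    obtain ⟨q, hq⟩ := mem_sup_span_singleton_iff.1 h
    have h1 := hJ.sup_ofList (fun g hg => ⟨1, hl' g hg⟩) _ hq 1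
    have h2 := homogeneousComponent_mul_of_isHomogeneous (p := q) hf 0
    rw [zero_add, homogeneousComponent_zero] at h2
    rw [map_sub, homogeneousComponent_self hy, h2] at h1
    obtain ⟨g, hg, hyg⟩ := ih hl' (hy.sub (by simpa using hf.mul (isHomogeneous_C ι (coeff 0 q))))
        h1
    have e : {x | x ∈ f :: l} = insert f {x | x ∈ l} := by ext; simp
    refine ⟨coeff 0 q • f + g, ?_, ?_⟩
    · rw [e]
      exact Submodule.mem_span_insert.2 ⟨_, g, hg, rfl⟩
    · convert hyg using 1
      rw [smul_eq_C_mul]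
      ring

theorem HasSocleDegree.le_of_le {A B : Ideal (MvPolynomial ι k)} (hA : IsHomogIdeal A) {a : ℕ}
    (hGA : HasSocleDegree A a)
    (hGB : HasSocleDegree B a) (hle : A ≤ B) : B ≤ A := by
  obtain ⟨u, hu, huA, -, hrA⟩ := hGA
  obtain ⟨w, hw, hwB, -, -⟩ := hGB
  intro x hx
  by_contra hxA
  obtain ⟨r, hr⟩ := hrA x hxA
  have huB : u ∈ B := by
    rw [show u = r * x - (r * x - u) by ring]
    exact B.sub_mem (B.mul_mem_left _ hx) (hle hr)
  obtain ⟨t, ht⟩ := hrA w fun h => hwB (hle h)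
  obtain ⟨b, t', hb, ht', htw⟩ := exists_homogeneous_mul_sub_mem hA hu huA hw ht
  obtain rfl : b = 0 := by omega
  rw [(totalDegree_eq_zero_iff_eq_C (p := t')).1 (by simpa using ht'.totalDegree_le)] at htw
  set c := coeff 0 t'
  by_cases hc : c = 0
  · rw [hc, C_0, zero_mul, zero_sub, neg_mem_iff] at htw
    exact huA htw
  · have h5 := B.mul_mem_left (C c⁻¹) (B.add_mem (hle htw) huB)
    rw [sub_add_cancel, ← mul_assoc, ← C_mul, inv_mul_cancel₀ hc, C_1, one_mul] at h5
    exact hwB h5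

theorem exists_ne_zero_C_mul_sub_mem {J : Ideal (MvPolynomial ι k)} {w e : MvPolynomial ι k}
    (hw : w ∉ J) (hr : ∀ p, p ∉ J → ∃ r, r * p - w ∈ J) (he : e ∉ J) (hXe : ∀ i, X i * e ∈ J) :
    ∃ a : k, a ≠ 0 ∧ C a * e - w ∈ J := by
  obtain ⟨r, hr⟩ := hr e he
  have h1 := J.sub_mem hr (mul_sub_C_mul_mem hXe r)
  have h2 : C (constantCoeff r) * e - w ∈ J := by convert h1 using 1; ring
  refine ⟨_, fun h0 => hw ?_, h2⟩
  rwa [h0, C_0, zero_mul, zero_sub, neg_mem_iff] at h2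

theorem HasSocleDegree.exists_X_sub_mem {b K : Ideal (MvPolynomial ι k)} (hb : IsHomogIdeal b)
    (hK : IsHomogIdeal K) {a : ℕ}
    (hGb : HasSocleDegree b (a + 1)) (hGK : HasSocleDegree K a) {v w : ι}
    (hv : ∀ p, X v * p ∈ b ↔ p ∈ K)
    (hw : ∀ p, X w * p ∈ b ↔ p ∈ K) : ∃ c : k, X v - C c * X w ∈ b := by
  obtain ⟨z, hz, hzb, hXz, hrz⟩ := hGb
  obtain ⟨u, hu, huK, hXu, hru⟩ := hGK
  have key : ∀ x : ι, (∀ p, X x * p ∈ b ↔ p ∈ K) → ∃ β : k, β ≠ 0 ∧ C β * (X x * u) - z ∈ b :=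
    fun x hx => exists_ne_zero_C_mul_sub_mem hzb hrz (fun h => huK ((hx u).1 h)) fun i => by
      rw [mul_left_comm]
      exact (hx _).2 (hXu i)
  obtain ⟨β, hβ, hβz⟩ := key v hv
  obtain ⟨γ, -, hγz⟩ := key w hw
  refine ⟨β⁻¹ * γ, ?_⟩
  set y := X v - C (β⁻¹ * γ) * X w with hy
  have hyu : y * u ∈ b := by
    have h1 := b.mul_mem_left (C β⁻¹) (b.sub_mem hβz hγz)
    convert h1 using 1
    have h2 : (C β⁻¹ : MvPolynomial ι k) * C β = 1 := by rw [← C_mul, inv_mul_cancel₀ hβ, C_1]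
    rw [hy, C_mul]
    linear_combination (-X v * u) * h2
  have hyK : ∀ p ∈ K, y * p ∈ b := fun p hp => by
    rw [hy, sub_mul, mul_assoc]
    exact b.sub_mem ((hv p).2 hp) (b.mul_mem_left _ ((hw p).2 hp))
  have hyh : y.IsHomogeneous 1 := (isHomogeneous_X k v).sub (by
    simpa using (isHomogeneous_C ι (β⁻¹ * γ)).mul (isHomogeneous_X k w))
  by_contra hyb
  obtain ⟨r, hr⟩ := hrz y hyb
  obtain ⟨a', r', ha', hr'h, hr'⟩ := exists_homogeneous_mul_sub_mem hb hz hzb hyh hr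
  obtain rfl : a' = a := by omega
  have hr'K : r' ∉ K := fun h => hzb (by
    rw [show z = y * r' - (r' * y - z) by ring]
    exact b.sub_mem (hyK _ h) hr')
  obtain ⟨t, ht⟩ := hru r' hr'K
  obtain ⟨b', t', hb', ht'h, ht'⟩ := exists_homogeneous_mul_sub_mem hK hu huK hr'h ht
  obtain rfl : b' = 0 := by omega
  rw [(totalDegree_eq_zero_iff_eq_C (p := t')).1 (by simpa using ht'h.totalDegree_le)] at ht'
  set c := coeff 0 t'
  have hcz : C c * z ∈ b := by
    rw [show C c * z = y * (C c * r' - u) + y * u - C c * (r' * y - z) by ring]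
    exact b.sub_mem (b.add_mem (hyK _ ht') hyu) (b.mul_mem_left _ hr')
  by_cases hc : c = 0
  · rw [hc, C_0, zero_mul, zero_sub, neg_mem_iff] at ht'
    exact huK ht'
  · have := b.mul_mem_left (C c⁻¹) hcz
    rw [← mul_assoc, ← C_mul, inv_mul_cancel₀ hc, C_1, one_mul] at this
    exact hzb this

end Nakayama

section Faces
variable {k : Type} [Field k] {n : ℕ} {D : SC n}

theorem one_mem_starIdeal {τ : Finset (Fin n)} :
    (1 : MvPolynomial (Fin n) k) ∈ starIdeal k D τ ↔ τ ∉ D.faces := by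
  classical
  rw [mem_starIdeal, support_one]
  simp

theorem xFace_mem_starIdeal {σ τ : Finset (Fin n)} :
    xFace k σ ∈ starIdeal k D τ ↔ σ ∪ τ ∉ D.faces := by
  rw [← one_mem_starIdeal (k := k), ← xFace_mul_mem_starIdeal, mul_one]

theorem X_mem_starIdeal {v : Fin n} {τ : Finset (Fin n)} :
    (X v : MvPolynomial (Fin n) k) ∈ starIdeal k D τ ↔ insert v τ ∉ D.faces := by
  rw [← one_mem_starIdeal (k := k), ← X_mul_mem_starIdeal, mul_one]

theorem starIdeal_le_ker {τ : Finset (Fin n)} (hτ : τ ∈ D.faces) :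
    starIdeal k D τ ≤ RingHom.ker (constantCoeff (R := k) (σ := Fin n)) := by
  intro p hp
  by_contra hc
  exact mem_starIdeal.1 hp 0 (mem_support_iff.2 hc) (by simpa using hτ)

theorem constantCoeff_of_mem_map_linForm {L : List (Fin n → k)} {f : MvPolynomial (Fin n) k}
    (hf : f ∈ L.map (linForm k)) : constantCoeff f = 0 := by
  obtain ⟨c, -, rfl⟩ := List.mem_map.1 hf
  rw [constantCoeff_eq]
  exact (linForm_isHomogeneous c).coeff_eq_zero (by simp)

theorem isHomogeneous_of_mem_map_linForm {L : List (Fin n → k)} {f : MvPolynomial (Fin n) k}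
    (hf : f ∈ L.map (linForm k)) : f.IsHomogeneous 1 := by
  obtain ⟨c, -, rfl⟩ := List.mem_map.1 hf
  exact linForm_isHomogeneous c

theorem one_notMem_starReduction {τ : Finset (Fin n)} (hτ : τ ∈ D.faces) (L : List (Fin n → k)) :
    (1 : MvPolynomial (Fin n) k) ∉ starReduction D L τ := by
  intro h
  have : starReduction D L τ ≤ RingHom.ker (constantCoeff (R := k) (σ := Fin n)) :=
    sup_le (starIdeal_le_ker hτ) (Ideal.span_le.2 fun f hf => constantCoeff_of_mem_map_linForm hf)
  simpa [RingHom.mem_ker] using this h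

theorem starReduction_mono (D : SC n) (L : List (Fin n → k)) {τ τ' : Finset (Fin n)} (h : τ ⊆ τ') :
    starReduction D L τ ≤ starReduction D L τ' :=
  sup_le_sup_right (starIdeal_mono D h) _

theorem isRegSeq_starIdeal {c₀ : Fin n → k} (h0 : ∀ v, c₀ v ≠ 0) {L : List (Fin n → k)}
    (h : IsRegSeq (starIdeal k D ∅) ((c₀ :: L).map (linForm k))) (τ : Finset (Fin n)) :
    IsRegSeq (starIdeal k D τ) ((c₀ :: L).map (linForm k)) := by
  induction τ using Finset.induction_on with
  | empty => exact h
  | insert v τ _ ih => exact isRegSeq_starIdeal_insert (h0 v) ih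

theorem starIdeal_insert_le_of_starReduction {τ : Finset (Fin n)} {v : Fin n} {L : List (Fin n → k)}
    (h : IsRegSeq (starIdeal k D (insert v τ)) (L.map (linForm k)))
    (hle : starReduction D L (insert v τ) ≤ starReduction D L τ) :
    starIdeal k D (insert v τ) ≤ starIdeal k D τ :=
  (starIdeal_isHomogIdeal D τ).le_of_le_sup_ofList (starIdeal_mono D (Finset.subset_insert v τ))
    (fun _ hf => isHomogeneous_of_mem_map_linForm hf) h (le_sup_left.trans hle)

theorem exists_facet_of_not_starIdeal_insert_le {ρ : Finset (Fin n)} {v : Fin n}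
    (h : ¬ starIdeal k D (insert v ρ) ≤ starIdeal k D ρ) :
    ∃ F ∈ D.faces, ρ ⊆ F ∧ insert v F ∉ D.faces ∧ ∀ i, insert i F ∈ D.faces → i ∈ F := by
  obtain ⟨p, hp, hpρ⟩ := SetLike.not_le_iff_exists.1 h
  rw [mem_starIdeal] at hp hpρ
  push Not at hpρ
  obtain ⟨m, hm, hmρ⟩ := hpρ
  obtain ⟨F, hle, hF⟩ := D.faces.exists_le_maximal hmρ
  refine ⟨F, hF.prop, Finset.subset_union_right.trans hle, fun hvF => ?_, fun i hi => ?_⟩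
  · refine hp m hm (D.down_closed _ hvF _ ?_)
    rw [Finset.union_insert]
    exact Finset.insert_subset_insert _ hle
  · exact hF.le_of_ge hi (Finset.subset_insert i F) (Finset.mem_insert_self i F)

theorem not_starReduction_insert_le_of_erase {c₀ : Fin n → k} (h0 : ∀ v, c₀ v ≠ 0)
    {L : List (Fin n → k)}
    (h : IsRegSeq (starIdeal k D ∅) ((c₀ :: L).map (linForm k))) {ρ : Finset (Fin n)} {v w : Fin n}
    (hvw : v ≠ w) (hface : insert v (insert w ρ) ∈ D.faces) {s : ℕ}
    (hG : HasSocleDegree (starReduction D (c₀ :: L) ρ) s)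
    (hv : ∀ p, X v * p ∈ starReduction D (c₀ :: L) ρ ↔ p ∈ starReduction D (c₀ :: L) (insert v ρ))
    (hw : ∀ p, X w * p ∈ starReduction D (c₀ :: L) ρ ↔ p ∈ starReduction D (c₀ :: L) (insert w ρ))
    (hnle : ¬ starReduction D (c₀ :: L) (insert v ρ) ≤ starReduction D (c₀ :: L) ρ) :
    ¬ starReduction D (c₀ :: L) (insert v (insert w ρ)) ≤
        starReduction D (c₀ :: L) (insert w ρ) := by
  intro hle
  have hvρ : insert v ρ ∈ D.faces :=
    D.down_closed _ hface _ (Finset.insert_subset_insert _ (Finset.subset_insert _ _))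
  have hwρ : insert w ρ ∈ D.faces := D.down_closed _ hface _ (Finset.subset_insert _ _)
  obtain ⟨a, rfl, hGv⟩ := hG.of_X_mul_mem_iff (starReduction_isHomogIdeal D _ _) hv
      (one_notMem_starReduction hvρ _)
  obtain ⟨a', ha', hGw⟩ := hG.of_X_mul_mem_iff (starReduction_isHomogIdeal D _ _) hw
      (one_notMem_starReduction hwρ _)
  obtain rfl : a = a' := by omega
  have hvw_le : starReduction D (c₀ :: L) (insert v ρ) ≤ starReduction D (c₀ :: L) (insert w ρ) :=
    (starReduction_mono D _ (Finset.insert_subset_insert _ (Finset.subset_insert _ _))).trans hle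
  have heq := le_antisymm hvw_le (HasSocleDegree.le_of_le (starReduction_isHomogIdeal D _ _) hGv hGw
      hvw_le)
  obtain ⟨c, hc⟩ := hG.exists_X_sub_mem (starReduction_isHomogIdeal D _ _)
      (starReduction_isHomogIdeal D _ _) hGv hv
    (fun p => by rw [heq]; exact hw p)
  have hyh : (X v - C c * X w : MvPolynomial (Fin n) k).IsHomogeneous 1 :=
    (isHomogeneous_X k v).sub (by simpa using (isHomogeneous_C _ c).mul (isHomogeneous_X k w))
  obtain ⟨g, hg, hyg⟩ := exists_mem_span_sub_mem (starIdeal_isHomogIdeal D ρ)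
    (fun _ hf => isHomogeneous_of_mem_map_linForm hf) hyh hc
  obtain ⟨F, hF, hρF, hvF, hmax⟩ := exists_facet_of_not_starIdeal_insert_le (k := k) (D := D)
      (ρ := ρ)
    (v := v) fun h => hnle (sup_le_sup_right h _)
  have hJle := starIdeal_insert_le_of_starReduction (isRegSeq_starIdeal h0 h _) hle
  have hwF : w ∉ F := by
    intro hwF
    have h1 : insert w ρ ⊆ F := Finset.insert_subset hwF hρF
    have h2 : xFace k F ∈ starIdeal k D (insert v (insert w ρ)) := by
      rw [xFace_mem_starIdeal, Finset.union_insert, Finset.union_eq_left.2 h1]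
      exact hvF
    refine xFace_mem_starIdeal.1 (hJle h2) ?_
    rwa [Finset.union_eq_left.2 h1]
  have hgF : g ∈ starIdeal k D F := by
    rw [show g = X v - C c * X w - (X v - C c * X w - g) by ring]
    refine Ideal.sub_mem _ (Ideal.sub_mem _ (X_mem_starIdeal.2 hvF) (Ideal.mul_mem_left _ _
      (X_mem_starIdeal.2 fun hw' => hwF (hmax w hw')))) (starIdeal_mono D hρF hyg)
  have hg0 : g = 0 := (isRegSeq_starIdeal h0 h F).eq_zero_of_mem_span (starIdeal_le_ker hF)
    (fun _ hf => constantCoeff_of_mem_map_linForm hf) hg hgF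
  rw [hg0, sub_zero] at hyg
  refine mem_starIdeal.1 hyg (Finsupp.single v 1) ?_ ?_
  · rw [mem_support_iff, coeff_sub, coeff_C_mul, coeff_X, coeff_X]
    simp [Finsupp.single_left_inj, Ne.symm hvw]
  · rw [Finsupp.support_single _ one_ne_zero]
    exact hvρ

theorem hasSocleDegree_starReduction_and_mul_mem_iff {c₀ : Fin n → k} (h0 : ∀ v, c₀ v ≠ 0)
    {L : List (Fin n → k)}
    (h : IsRegSeq (starIdeal k D ∅) ((c₀ :: L).map (linForm k)))
    {N s : ℕ} (hN : RingHom.ker (constantCoeff (R := k) (σ := Fin n)) ^ N ≤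
        starReduction D (c₀ :: L) ∅)
    (hG : HasSocleDegree (starReduction D (c₀ :: L) ∅) s)
    (hstar : ∀ i : Fin n, ∃ τ ∈ D.faces, insert i τ ∉ D.faces)
    (τ : Finset (Fin n)) (hτ : τ ∈ D.faces) :
    (∃ a, s = a + τ.card ∧ HasSocleDegree (starReduction D (c₀ :: L) τ) a) ∧
      ∀ v ∉ τ, insert v τ ∈ D.faces → ¬ starReduction D (c₀ :: L) (insert v τ) ≤
          starReduction D (c₀ :: L) τ := by
  induction τ using Finset.induction_on with
  | empty =>
    refine ⟨⟨s, by simp, hG⟩, fun v _ _ hle => ?_⟩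
    obtain ⟨ρ, hρ, hvρ⟩ := hstar v
    have h1 := starIdeal_insert_le_of_starReduction (isRegSeq_starIdeal h0 h _) hle
    refine xFace_mem_starIdeal.1 (h1 ((xFace_mem_starIdeal (σ := ρ)).2 ?_)) (by simpa using hρ)
    rwa [Finset.union_insert, Finset.union_empty]
  | insert w ρ hwρ ih =>
    obtain ⟨⟨a, ha, hGρ⟩, hnle⟩ := ih (D.down_closed _ hτ _ (Finset.subset_insert _ _))
    have hiff : ∀ v ∉ ρ, insert v ρ ∈ D.faces →
        ∀ p, X v * p ∈ starReduction D (c₀ :: L) ρ ↔ p ∈ starReduction D (c₀ :: L) (insert v ρ) :=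
            fun v hv hvf =>
      (starReduction_insert_le_or (h0 v) (isRegSeq_starIdeal h0 h ρ)
          (hN.trans (starReduction_mono D _ (Finset.empty_subset ρ)))
        hGρ).resolve_left (hnle v hv hvf)
    constructor
    · obtain ⟨a', rfl, hG'⟩ := hGρ.of_X_mul_mem_iff (starReduction_isHomogIdeal D _ _)
          (hiff w hwρ hτ)
        (one_notMem_starReduction hτ _)
      exact ⟨a', by rw [Finset.card_insert_of_notMem hwρ, ha]; ring, hG'⟩
    · intro v hv hvf
      rw [Finset.mem_insert, not_or] at hv
      have hvρ : insert v ρ ∈ D.faces :=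
        D.down_closed _ hvf _ (Finset.insert_subset_insert _ (Finset.subset_insert _ _))
      exact not_starReduction_insert_le_of_erase h0 h hv.1 hvf hGρ (hiff v hv.2 hvρ) (hiff w hwρ hτ)
        (hnle v hv.2 hvρ)

end Faces

section Facet
variable {k : Type} [Field k] {n : ℕ} {D : SC n}

theorem IsRegSeq.linearIndependent {J : Ideal (MvPolynomial (Fin n) k)} {m : ℕ}
    {v : Fin m → MvPolynomial (Fin n) k} (h : IsRegSeq J (List.ofFn v))
    (hJ : J ≤ RingHom.ker (constantCoeff (R := k) (σ := Fin n)))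
    (hv : ∀ i, constantCoeff (v i) = 0) : LinearIndependent k v := by
  induction m with
  | zero => exact linearIndependent_empty_type
  | succ m ih =>
    rw [List.ofFn_succ', List.concat_eq_append, isRegSeq_append] at h
    refine linearIndependent_finSucc'.2 ⟨ih h.1 fun i => hv _, fun hmem => ?_⟩
    have h1 : v (Fin.last m) ∈ J ⊔ Ideal.ofList (List.ofFn fun i : Fin m => v i.castSucc) := by
      refine Ideal.mem_sup_right (mem_ofList_of_mem_span ?_)
      have hset : {x | x ∈ List.ofFn fun i : Fin m => v i.castSucc} =
          Set.range fun i : Fin m => v i.castSucc :=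
        Set.ext fun x => List.mem_ofFn' _ x
      rw [hset]
      exact hmem
    have h2 := h.2.1 1 (by simpa using h1)
    have h3 : J ⊔ Ideal.ofList (List.ofFn fun i : Fin m => v i.castSucc) ≤
        RingHom.ker (constantCoeff (R := k) (σ := Fin n)) := by
      refine sup_le hJ (Ideal.span_le.2 fun f hf => ?_)
      obtain ⟨i, rfl⟩ := (List.mem_ofFn' _ _).1 hf
      exact hv _
    simpa [RingHom.mem_ker] using h3 h2

theorem mem_starIdeal_of_coeff_eq_zero {F : Finset (Fin n)} (hF : ∀ i, insert i F ∈ D.faces → i ∈ F)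
    {g : MvPolynomial (Fin n) k} (hg : g.IsHomogeneous 1)
    (h : ∀ i ∈ F, coeff (Finsupp.single i 1) g = 0) : g ∈ starIdeal k D F := by
  refine mem_starIdeal.2 fun m hm hmF => ?_
  have hdeg : m.degree = 1 := by
    by_contra hc
    exact mem_support_iff.1 hm (hg.coeff_eq_zero hc)
  obtain ⟨i, rfl⟩ := (Finsupp.sum_eq_one_iff m).1 hdeg
  rw [Finsupp.support_single _ one_ne_zero, ← Finset.insert_eq] at hmF
  exact mem_support_iff.1 hm (h i (hF i hmF))

theorem X_mem_starReduction_of_facet {F : Finset (Fin n)} (hFD : F ∈ D.faces)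
    (hF : ∀ i, insert i F ∈ D.faces → i ∈ F) {v : Fin F.card → Fin n → k}
    (h : IsRegSeq (starIdeal k D F) ((List.ofFn v).map (linForm k))) (i : Fin n) :
    (X i : MvPolynomial (Fin n) k) ∈ starReduction D (List.ofFn v) F := by
  rw [List.map_ofFn] at h
  by_cases hi : i ∈ F
  swap
  · exact Ideal.mem_sup_left (X_mem_starIdeal.2 fun h' => hi (hF i h'))
  have hc : ∀ j, constantCoeff ((linForm k ∘ v) j) = 0 := fun j => by
    rw [constantCoeff_eq]
    exact (linForm_isHomogeneous (v j)).coeff_eq_zero (by simp)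
  have hli := h.linearIndependent (starIdeal_le_ker hFD) hc
  let V := Submodule.span k (Set.range (linForm k ∘ v))
  have hVset : Set.range (linForm k ∘ v) = {x | x ∈ List.ofFn (linForm k ∘ v)} := by
    ext x
    simp [List.mem_ofFn]
  have hVh : V ≤ homogeneousSubmodule (Fin n) k 1 := by
    refine Submodule.span_le.2 ?_
    rintro _ ⟨j, rfl⟩
    exact linForm_isHomogeneous (v j)
  let φ : V →ₗ[k] (F → k) :=
    (LinearMap.pi fun i : F => lcoeff k (Finsupp.single (i : Fin n) 1)).comp V.subtype
  have hφ : ∀ g : V, ∀ i : F, φ g i = coeff (Finsupp.single (i : Fin n) 1) (g : MvPolynomial _ k) :=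
    fun g i => rfl
  have hinj : Function.Injective φ := by
    rw [← LinearMap.ker_eq_bot, LinearMap.ker_eq_bot']
    intro g hg
    refine Subtype.ext (h.eq_zero_of_mem_span (starIdeal_le_ker hFD) (fun f hf => ?_)
      (by rw [← hVset]; exact g.2) (mem_starIdeal_of_coeff_eq_zero hF (hVh g.2) fun i hi => ?_))
    · obtain ⟨j, rfl⟩ := (List.mem_ofFn' _ _).1 hf
      exact hc j
    · rw [← hφ g ⟨i, hi⟩, hg]
      rfl
  have hfd : FiniteDimensional k V := FiniteDimensional.span_of_finite k (Set.finite_range _)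
  have hsurj : Function.Surjective φ := by
    refine (LinearMap.injective_iff_surjective_of_finrank_eq_finrank ?_).1 hinj
    rw [finrank_span_eq_card hli]
    simp
  obtain ⟨g, hg⟩ := hsurj (Pi.single ⟨i, hi⟩ 1)
  have h1 : X i - (g : MvPolynomial (Fin n) k) ∈ starIdeal k D F := by
    refine mem_starIdeal_of_coeff_eq_zero hF ((isHomogeneous_X k i).sub (hVh g.2)) fun j hj => ?_
    rw [coeff_sub, ← hφ g ⟨j, hj⟩, hg, coeff_X, Pi.single_apply]
    simp [Finsupp.single_left_inj, eq_comm]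
  rw [← sub_add_cancel (X i) (g : MvPolynomial (Fin n) k)]
  refine Ideal.add_mem _ (Ideal.mem_sup_left h1) (Ideal.mem_sup_right ?_)
  rw [List.map_ofFn]
  exact mem_ofList_of_mem_span (by rw [← hVset]; exact g.2)

theorem HasSocleDegree.eq_zero_of_X_mem {J : Ideal (MvPolynomial (Fin n) k)} {a : ℕ}
    (h : HasSocleDegree J a)
    (hX : ∀ i, X i ∈ J) : a = 0 := by
  by_contra ha
  obtain ⟨w, hw, hwJ, -, -⟩ := h
  have h1 : w ∈ Ideal.span (Set.range (X (R := k) (σ := Fin n))) := by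
    rw [← ker_constantCoeff_eq_span, RingHom.mem_ker, constantCoeff_eq]
    exact hw.coeff_eq_zero (by simpa using Ne.symm ha)
  refine hwJ (Ideal.span_le.2 ?_ h1)
  rintro _ ⟨i, rfl⟩
  exact hX i

theorem exists_facet_card_eq_dimP {τ : Finset (Fin n)} (hτ : τ ∈ D.faces) :
    ∃ F ∈ D.faces, F.card = dimP D ∧ ∀ i, insert i F ∈ D.faces → i ∈ F := by
  obtain ⟨F, hF, hcard⟩ := Finset.exists_mem_eq_sup D.faces ⟨τ, hτ⟩ Finset.card
  refine ⟨F, hF, hcard.symm, fun i hi => ?_⟩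
  by_contra hiF
  have h1 := Finset.le_sup (f := Finset.card) hi
  rw [Finset.card_insert_of_notMem hiF, hcard] at h1
  omega

/-- For a Gorenstein* complex, the socle degrees of general Artinian reductions of the
Stanley–Reisner rings of the complex and of the link of `σ`. -/
theorem hasSocleDegree_of_gorStar [Infinite k] (hD : gorStar k D) {σ : Finset (Fin n)}
    (hσ : σ ∈ D.faces)
    (hd : 0 < dimP D) {c : Fin (dimP D) × Fin n → k} (hc : artGor k (redIdeal k (srIdeal k D) c))
    (h0 : ∀ (j : Fin (dimP D)) v, c (j, v) ≠ 0) :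
    HasSocleDegree (starIdeal k D ∅ ⊔ Ideal.ofList (List.ofFn fun j => linForm k fun i => c (j, i)))
        (dimP D) ∧
    ∃ a, dimP D = a + σ.card ∧
      HasSocleDegree (starIdeal k D σ ⊔ Ideal.ofList
          (List.ofFn fun j => linForm k fun i => c (j, i))) a := by
  let L : List (Fin n → k) := List.ofFn fun j => fun i => c (j, i)
  have hL : L.map (linForm k) = List.ofFn fun j => linForm k fun i => c (j, i) := by
    simp only [L, List.map_ofFn]
    rfl
  have hbb : ∀ τ, starIdeal k D τ ⊔ Ideal.ofList (List.ofFn fun j => linForm k fun i => c (j, i)) =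
      starReduction D L τ := fun τ => by rw [starReduction, hL]
  rw [hbb, hbb]
  have hred : redIdeal k (srIdeal k D) c = starReduction D L ∅ := by
    rw [← hbb, redIdeal, srIdeal_eq_starIdeal, Ideal.ofList]
    congr 2
    ext x
    simp [List.mem_ofFn]
  rw [hred] at hc
  obtain ⟨⟨N, hN⟩, s, hG⟩ := hasSocleDegree_of_artGor (starReduction_isHomogIdeal D L ∅) hc
  obtain ⟨-, ⟨⟨-, rs, hlen, hrs, hreg⟩, -⟩, hstar⟩ := hD
  have hPR : IsRegSeq (starIdeal k D ∅) (L.map (linForm k)) := by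
    rw [srIdeal_eq_starIdeal] at hreg
    refine IsLocRegSeq.isRegSeq (starIdeal_isHomogIdeal D ∅)
        (fun f hf => ⟨1, isHomogeneous_of_mem_map_linForm hf⟩) ?_
    refine IsLocRegSeq.exchange (rs := rs) (by rw [hlen, hL, List.length_ofFn]) (fun f hf => ?_)
      (fun f hf => constantCoeff_of_mem_map_linForm hf)
      (isRegSeq_of_isWeaklyRegular hreg.toIsWeaklyRegular).isLocRegSeq hN
    rw [← RingHom.mem_ker, ker_constantCoeff_eq_span]
    exact hrs f hf
  obtain ⟨c₀, L', hLL⟩ : ∃ c₀ L', L = c₀ :: L' :=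
    List.exists_cons_of_ne_nil fun h => by
      have := congrArg List.length h
      simp [L] at this
      omega
  have hc₀ : ∀ v, c₀ v ≠ 0 := by
    have : c₀ ∈ L := by simp [hLL]
    obtain ⟨j, rfl⟩ := (List.mem_ofFn' _ _).1 this
    exact h0 j
  have key : ∀ τ ∈ D.faces, ∃ a, s = a + τ.card ∧ HasSocleDegree (starReduction D L τ) a :=
      fun τ hτ => by
    rw [hLL] at hPR hN hG ⊢
    exact (hasSocleDegree_starReduction_and_mul_mem_iff hc₀ hPR hN hG hstar τ hτ).1
  obtain ⟨F, hF, hFcard, hmax⟩ := exists_facet_card_eq_dimP hσ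
  obtain ⟨a, ha, hGF⟩ := key F hF
  have hPRF : IsRegSeq (starIdeal k D F) (L.map (linForm k)) := by
    rw [hLL] at hPR ⊢
    exact isRegSeq_starIdeal hc₀ hPR F
  have hX : ∀ i, (X i : MvPolynomial (Fin n) k) ∈ starReduction D L F := by
    obtain ⟨v, hv⟩ : ∃ v : Fin F.card → Fin n → k, L = List.ofFn v :=
      ⟨fun j i => c (j.cast hFcard, i), by rw [List.ofFn_congr hFcard]; rfl⟩
    rw [hv] at hPRF ⊢
    exact X_mem_starReduction_of_facet hF hmax hPRF
  obtain rfl : s = dimP D := by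
    rw [ha, hGF.eq_zero_of_X_mem hX, hFcard, zero_add]
  exact ⟨hG, key σ hσ⟩

end Facet

section LastVariable
variable {k : Type} [Field k] {n : ℕ}

/-- Polynomials in `n + 1` variables as univariate polynomials in the last variable. -/
def lastEquiv (k : Type) [Field k] (n : ℕ) :
    MvPolynomial (Fin (n + 1)) k ≃ₐ[k] Polynomial (MvPolynomial (Fin n) k) :=
  (renameEquiv k (finRotate (n + 1))).trans (finSuccEquiv k n)

theorem lastEquiv_apply (P : MvPolynomial (Fin (n + 1)) k) :
    lastEquiv k n P = finSuccEquiv k n (rename (finRotate (n + 1)) P) := rfl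

theorem lastEquiv_Tv : lastEquiv k n (Tv k n) = Polynomial.X := by
  rw [lastEquiv_apply, Tv, rename_X, finRotate_last, finSuccEquiv_X_zero]

theorem lastEquiv_toT (p : MvPolynomial (Fin n) k) :
    lastEquiv k n (toT k p) = Polynomial.C p := by
  induction p using MvPolynomial.induction_on with
  | C a => simp [toT, lastEquiv_apply, finSuccEquiv_apply]
  | add p q hp hq => rw [map_add, map_add, hp, hq, map_add]
  | mul_X p i hp =>
    rw [map_mul, map_mul, hp, map_mul, toT, rename_X, lastEquiv_apply, rename_X,
      finRotate_apply, Fin.coeSucc_eq_succ, finSuccEquiv_X_succ]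

theorem isHomogeneous_coeff_lastEquiv {P : MvPolynomial (Fin (n + 1)) k} {m : ℕ}
    (hP : P.IsHomogeneous m) (i j : ℕ) (h : i + j = m) :
    ((lastEquiv k n P).coeff i).IsHomogeneous j :=
  (hP.rename_isHomogeneous (f := finRotate (n + 1))).finSuccEquiv_coeff_isHomogeneous i j h

theorem coeff_lastEquiv_of_lt {P : MvPolynomial (Fin (n + 1)) k} {m i : ℕ}
    (hP : P.IsHomogeneous m) (h : m < i) : (lastEquiv k n P).coeff i = 0 := by
  refine Polynomial.coeff_eq_zero_of_natDegree_lt (lt_of_le_of_lt ?_ h)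
  rw [lastEquiv_apply, natDegree_finSuccEquiv]
  exact (degreeOf_le_totalDegree _ _).trans
    (hP.rename_isHomogeneous (f := finRotate (n + 1))).totalDegree_le

theorem eq_sum_toT_mul (P : MvPolynomial (Fin (n + 1)) k) :
    P = ∑ i ∈ Finset.range ((lastEquiv k n P).natDegree + 1),
      toT k ((lastEquiv k n P).coeff i) * Tv k n ^ i := by
  apply (lastEquiv k n).injective
  conv_lhs => rw [(lastEquiv k n P).as_sum_range_C_mul_X_pow]
  simp only [map_sum, map_mul, map_pow, lastEquiv_Tv, lastEquiv_toT]

/-- The ideal of polynomials in `T` whose constant coefficient lies in `b` and whose coefficients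
of `T, …, T ^ q` lie in the larger ideal `l`. -/
def coneIdeal {b l : Ideal (MvPolynomial (Fin n) k)} (hbl : b ≤ l) (q : ℕ) :
    Ideal (MvPolynomial (Fin (n + 1)) k) where
  carrier := {P | (lastEquiv k n P).coeff 0 ∈ b ∧
    ∀ i, 1 ≤ i → i ≤ q → (lastEquiv k n P).coeff i ∈ l}
  zero_mem' := by simp
  add_mem' := by
    rintro P Q ⟨hP, hP'⟩ ⟨hQ, hQ'⟩
    refine ⟨?_, fun i hi hq => ?_⟩
    · rw [map_add, Polynomial.coeff_add]
      exact b.add_mem hP hQ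
    · rw [map_add, Polynomial.coeff_add]
      exact l.add_mem (hP' i hi hq) (hQ' i hi hq)
  smul_mem' := by
    rintro P Q ⟨hQ, hQ'⟩
    refine ⟨?_, fun i hi hq => ?_⟩
    · rw [smul_eq_mul, map_mul, Polynomial.mul_coeff_zero]
      exact b.mul_mem_left _ hQ
    · rw [smul_eq_mul, map_mul, Polynomial.coeff_mul]
      refine l.sum_mem fun x hx => l.mul_mem_left _ ?_
      rw [Finset.HasAntidiagonal.mem_antidiagonal] at hx
      rcases Nat.eq_zero_or_pos x.2 with h0 | h0
      · rw [h0]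
        exact hbl hQ
      · exact hQ' _ h0 (by omega)

theorem mem_coneIdeal {b l : Ideal (MvPolynomial (Fin n) k)} {hbl : b ≤ l} {q : ℕ}
    {P : MvPolynomial (Fin (n + 1)) k} : P ∈ coneIdeal hbl q ↔ (lastEquiv k n P).coeff 0 ∈ b ∧
      ∀ i, 1 ≤ i → i ≤ q → (lastEquiv k n P).coeff i ∈ l := Iff.rfl

theorem coneIdeal_eq {I J K b l : Ideal (MvPolynomial (Fin n) k)} (hbl : b ≤ l)
    (hb : b = I ⊔ K) (hl : l = J ⊔ K) (q : ℕ) :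
    extI k I ⊔ Ideal.span {Tv k n ^ (q + 1)} ⊔ TmulI k J ⊔ extI k K = coneIdeal hbl q := by
  apply le_antisymm
  · refine sup_le (sup_le (sup_le ?_ ?_) ?_) ?_
    · refine Ideal.map_le_iff_le_comap.2 fun p hp => ?_
      have hpb : p ∈ b := hb ▸ Ideal.mem_sup_left hp
      refine (mem_coneIdeal (hbl := hbl)).2 ⟨?_, fun i hi _ => ?_⟩
      · simpa [lastEquiv_toT] using hpb
      · simp [lastEquiv_toT, Polynomial.coeff_C, show i ≠ 0 by omega]
    · rw [Ideal.span_singleton_le_iff_mem, mem_coneIdeal, map_pow, lastEquiv_Tv]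
      refine ⟨by simp, fun i _ hi => ?_⟩
      rw [Polynomial.coeff_X_pow, if_neg (by omega)]
      exact l.zero_mem
    · refine Ideal.span_le.2 ?_
      rintro _ ⟨f, hf, rfl⟩
      have hfl : f ∈ l := hl ▸ Ideal.mem_sup_left hf
      refine mem_coneIdeal.2 ?_
      simp only [map_mul, lastEquiv_Tv, lastEquiv_toT]
      refine ⟨by simp, fun i hi _ => ?_⟩
      obtain ⟨i, rfl⟩ := Nat.exists_eq_add_of_le' hi
      rw [Polynomial.coeff_X_mul, Polynomial.coeff_C]
      split_ifs
      exacts [hfl, l.zero_mem]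
    · refine Ideal.map_le_iff_le_comap.2 fun p hp => ?_
      have hpb : p ∈ b := hb ▸ Ideal.mem_sup_right hp
      refine (mem_coneIdeal (hbl := hbl)).2 ⟨?_, fun i hi _ => ?_⟩
      · simpa [lastEquiv_toT] using hpb
      · simp [lastEquiv_toT, Polynomial.coeff_C, show i ≠ 0 by omega]
  · set 𝔠 := extI k I ⊔ Ideal.span {Tv k n ^ (q + 1)} ⊔ TmulI k J ⊔ extI k K
    have hK : extI k K ≤ 𝔠 := le_sup_right
    have hI : extI k I ≤ 𝔠 := le_sup_left.trans (le_sup_left.trans le_sup_left)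
    have hJ : TmulI k J ≤ 𝔠 := le_sup_right.trans le_sup_left
    have hT : Tv k n ^ (q + 1) ∈ 𝔠 :=
      Ideal.mem_sup_left (Ideal.mem_sup_left (Ideal.mem_sup_right
        (Ideal.mem_span_singleton_self _)))
    have hb' : ∀ p ∈ b, toT k p ∈ 𝔠 := by
      intro p hp
      rw [hb] at hp
      obtain ⟨y, hy, z, hz, rfl⟩ := Submodule.mem_sup.1 hp
      rw [map_add]
      exact 𝔠.add_mem (hI (Ideal.mem_map_of_mem _ hy)) (hK (Ideal.mem_map_of_mem _ hz))
    have hl' : ∀ p ∈ l, Tv k n * toT k p ∈ 𝔠 := by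
      intro p hp
      rw [hl] at hp
      obtain ⟨y, hy, z, hz, rfl⟩ := Submodule.mem_sup.1 hp
      rw [map_add, mul_add]
      exact 𝔠.add_mem (hJ (Ideal.subset_span ⟨y, hy, rfl⟩))
        (𝔠.mul_mem_left _ (hK (Ideal.mem_map_of_mem _ hz)))
    intro P hP
    obtain ⟨h0, h1⟩ := mem_coneIdeal.1 hP
    rw [eq_sum_toT_mul P]
    refine 𝔠.sum_mem fun i _ => ?_
    rcases Nat.eq_zero_or_pos i with rfl | hi
    · rw [pow_zero, mul_one]
      exact hb' _ h0
    · rcases le_or_gt i q with hiq | hiq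
      · obtain ⟨i, rfl⟩ := Nat.exists_eq_add_of_le' hi
        rw [pow_succ, mul_left_comm, mul_comm (toT k _)]
        exact 𝔠.mul_mem_left _ (hl' _ (h1 _ hi hiq))
      · obtain ⟨j, rfl⟩ := Nat.exists_eq_add_of_le hiq
        rw [pow_add, ← mul_assoc, mul_right_comm]
        exact 𝔠.mul_mem_left _ hT

theorem HasSocleDegree.exists_homogeneous {J : Ideal (MvPolynomial (Fin n) k)} (hJ : IsHomogIdeal J)
    {s : ℕ}
    (hG : HasSocleDegree J s) : ∃ w, w ∉ J ∧ ∀ e p, p.IsHomogeneous e → p ∉ J →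
      ∃ a r, s = a + e ∧ r.IsHomogeneous a ∧ r * p - w ∈ J := by
  obtain ⟨w, hw, hwJ, -, hr⟩ := hG
  refine ⟨w, hwJ, fun e p hp hpJ => ?_⟩
  obtain ⟨r, hr⟩ := hr p hpJ
  exact exists_homogeneous_mul_sub_mem hJ hw hwJ hp hr

theorem HasSocleDegree.eq_of_X_mul_mem {J : Ideal (MvPolynomial (Fin n) k)} (hJ : IsHomogIdeal J)
    {s e : ℕ}
    (hG : HasSocleDegree J s) {p : MvPolynomial (Fin n) k} (hp : p.IsHomogeneous e)
    (hX : ∀ i, X i * p ∈ J) (hpJ : p ∉ J) : s = e := by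
  obtain ⟨w, hw, h⟩ := hG.exists_homogeneous hJ
  obtain ⟨a, r, rfl, hr, hrw⟩ := h e p hp hpJ
  rcases Nat.eq_zero_or_pos a with rfl | ha
  · simp
  · exfalso
    have h1 := mul_sub_C_mul_mem hX r
    rw [constantCoeff_eq, hr.coeff_eq_zero (by simpa using ha.ne), C_0, zero_mul, sub_zero] at h1
    apply hw
    simpa using J.sub_mem h1 hrw

theorem mem_coneIdeal_of_X_mul_mem {b l : Ideal (MvPolynomial (Fin n) k)} {hbl : b ≤ l} {q a : ℕ}
    (hb : IsHomogIdeal b) (hl : IsHomogIdeal l) (hGb : HasSocleDegree b (a + (q + 1)))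
    (hGl : HasSocleDegree l a) {m : ℕ}
    (hm : m < a + q) {P : MvPolynomial (Fin (n + 1)) k} (hP : P.IsHomogeneous m)
    (h : ∀ i, X i * P ∈ coneIdeal hbl q) : P ∈ coneIdeal hbl q := by
  have hX : ∀ i : Fin n, lastEquiv k n (X i.castSucc * P) =
      Polynomial.C (X i) * lastEquiv k n P := fun i => by
    rw [map_mul, ← lastEquiv_toT, toT, rename_X]
  have hXl : ∀ i j, 1 ≤ j → j ≤ q → X i * (lastEquiv k n P).coeff j ∈ l := fun i j hj hjq => by
    have := (mem_coneIdeal.1 (h i.castSucc)).2 j hj hjq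
    rwa [hX, Polynomial.coeff_C_mul] at this
  have hXb : ∀ i, X i * (lastEquiv k n P).coeff 0 ∈ b := fun i => by
    have := (mem_coneIdeal.1 (h i.castSucc)).1
    rwa [hX, Polynomial.coeff_C_mul] at this
  refine mem_coneIdeal.2 ⟨?_, fun i hi hiq => ?_⟩
  · by_contra hc
    have := hGb.eq_of_X_mul_mem hb (isHomogeneous_coeff_lastEquiv hP 0 m (zero_add m)) hXb hc
    omega
  · by_contra hc
    rcases lt_or_ge m i with hmi | hmi
    · rw [coeff_lastEquiv_of_lt hP hmi] at hc
      exact hc l.zero_mem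
    have := hGl.eq_of_X_mul_mem hl
      (isHomogeneous_coeff_lastEquiv hP i (m - i) (Nat.add_sub_cancel' hmi))
      (fun j => hXl j i hi hiq) hc
    have hT := (mem_coneIdeal.1 (h (Fin.last n))).2 (i + 1) (by omega) (by omega)
    change (lastEquiv k n (Tv k n * P)).coeff (i + 1) ∈ l at hT
    rw [map_mul, lastEquiv_Tv, Polynomial.coeff_X_mul] at hT
    exact hc hT

theorem coeff_lastEquiv_toT_mul (r : MvPolynomial (Fin n) k) (i j : ℕ) :
    (lastEquiv k n (toT k r * Tv k n ^ i)).coeff j = if j = i then r else 0 := by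
  rw [map_mul, lastEquiv_toT, map_pow, lastEquiv_Tv, Polynomial.coeff_C_mul_X_pow]

theorem isHomogeneous_toT_mul {r : MvPolynomial (Fin n) k} {a : ℕ} (hr : r.IsHomogeneous a)
    (i : ℕ) : (toT k r * Tv k n ^ i).IsHomogeneous (a + i) :=
  (hr.rename_isHomogeneous (f := Fin.castSucc)).mul (by
    simpa [Tv] using (isHomogeneous_X k (Fin.last n)).pow i)

/-- The `i`-th coefficient with respect to the last variable, as a linear map. -/
def lastCoeff (k : Type) [Field k] (n i : ℕ) :
    MvPolynomial (Fin (n + 1)) k →ₗ[k] MvPolynomial (Fin n) k where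
  toFun P := (lastEquiv k n P).coeff i
  map_add' P Q := by rw [map_add, Polynomial.coeff_add]
  map_smul' c P := by rw [map_smul, Polynomial.coeff_smul, RingHom.id_apply]

theorem exists_pairing_coneIdeal {b l : Ideal (MvPolynomial (Fin n) k)} {hbl : b ≤ l} {q a : ℕ}
    (hb : IsHomogIdeal b) (hl : IsHomogIdeal l) (hGb : HasSocleDegree b (a + (q + 1)))
    (hGl : HasSocleDegree l a) :
    ∃ β : MvPolynomial (Fin (n + 1)) k →ₗ[k] MvPolynomial (Fin (n + 1)) k →ₗ[k] k,
      (∀ P Q, P ∈ coneIdeal hbl q → β P Q = 0) ∧ (∀ P Q, Q ∈ coneIdeal hbl q → β P Q = 0) ∧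
      ∀ m m' P, m + m' = a + (q + 1) → P.IsHomogeneous m → P ∉ coneIdeal hbl q →
        ∃ Q, Q.IsHomogeneous m' ∧ β P Q ≠ 0 := by
  obtain ⟨wb, hwb, hrb⟩ := hGb.exists_homogeneous hb
  obtain ⟨wl, hwl, hrl⟩ := hGl.exists_homogeneous hl
  obtain ⟨φ, hφ, hφb⟩ := Submodule.exists_le_ker_of_notMem (p := b.restrictScalars k) hwb
  obtain ⟨ψ, hψ, hψl⟩ := Submodule.exists_le_ker_of_notMem (p := l.restrictScalars k) hwl
  let μ := LinearMap.mul k (MvPolynomial (Fin n) k)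
  let β : MvPolynomial (Fin (n + 1)) k →ₗ[k] MvPolynomial (Fin (n + 1)) k →ₗ[k] k :=
    (μ.compl₁₂ (lastCoeff k n 0) (lastCoeff k n 0)).compr₂ φ +
      ∑ i ∈ Finset.Icc 1 q,
        (μ.compl₁₂ (lastCoeff k n i) (lastCoeff k n (q + 1 - i))).compr₂ ψ
  have hβ : ∀ P Q, β P Q = φ ((lastEquiv k n P).coeff 0 * (lastEquiv k n Q).coeff 0) +
      ∑ i ∈ Finset.Icc 1 q,
        ψ ((lastEquiv k n P).coeff i * (lastEquiv k n Q).coeff (q + 1 - i)) := by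
    intro P Q
    simp only [β, LinearMap.add_apply, LinearMap.sum_apply]
    rfl
  refine ⟨β, fun P Q hP => ?_, fun P Q hQ => ?_, fun m m' P hm hP hPc => ?_⟩
  · rw [hβ, hφb (b.mul_mem_right _ hP.1), zero_add]
    refine Finset.sum_eq_zero fun i hi => ?_
    rw [Finset.mem_Icc] at hi
    exact hψl (l.mul_mem_right _ (hP.2 i hi.1 hi.2))
  · rw [hβ, hφb (b.mul_mem_left _ hQ.1), zero_add]
    refine Finset.sum_eq_zero fun i hi => ?_
    rw [Finset.mem_Icc] at hi
    exact hψl (l.mul_mem_left _ (hQ.2 _ (by omega) (by omega)))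
  · by_cases h0 : (lastEquiv k n P).coeff 0 ∈ b
    swap
    · obtain ⟨e, r, he, hr, hrw⟩ := hrb m _
        (isHomogeneous_coeff_lastEquiv hP 0 m (zero_add m)) h0
      refine ⟨toT k r * Tv k n ^ 0, ?_, ?_⟩
      · convert isHomogeneous_toT_mul hr 0 using 1
        omega
      · rw [hβ, Finset.sum_eq_zero, add_zero, coeff_lastEquiv_toT_mul, if_pos rfl, mul_comm,
          ← sub_add_cancel (r * _) wb, map_add, hφb hrw, zero_add]
        · exact hφ
        · intro i hi
          rw [Finset.mem_Icc] at hi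
          rw [coeff_lastEquiv_toT_mul, if_neg (by omega), mul_zero, map_zero]
    · rw [mem_coneIdeal] at hPc
      push Not at hPc
      obtain ⟨i, hi, hiq, hil⟩ := hPc h0
      have hmi : i ≤ m := by
        by_contra! hc
        rw [coeff_lastEquiv_of_lt hP hc] at hil
        exact hil l.zero_mem
      obtain ⟨e, r, he, hr, hrw⟩ := hrl (m - i) _
        (isHomogeneous_coeff_lastEquiv hP i (m - i) (Nat.add_sub_cancel' hmi)) hil
      refine ⟨toT k r * Tv k n ^ (q + 1 - i), ?_, ?_⟩
      · convert isHomogeneous_toT_mul hr (q + 1 - i) using 1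
        omega
      · rw [hβ, Finset.sum_eq_single_of_mem i (Finset.mem_Icc.2 ⟨hi, hiq⟩),
          coeff_lastEquiv_toT_mul, coeff_lastEquiv_toT_mul, if_neg (by omega), if_pos rfl,
          mul_zero, map_zero, zero_add, mul_comm, ← sub_add_cancel (r * _) wl, map_add, hψl hrw,
          zero_add]
        · exact hψ
        · intro j hj hji
          rw [Finset.mem_Icc] at hj
          rw [coeff_lastEquiv_toT_mul, if_neg (by omega), mul_zero, map_zero]

end LastVariable

section Graded
variable {k : Type} [Field k] {ι : Type} {J : Ideal (MvPolynomial ι k)}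

theorem mem_qComp {m : ℕ} {x : MvPolynomial ι k ⧸ J} :
    x ∈ qComp k J m ↔ ∃ P : MvPolynomial ι k, P.IsHomogeneous m ∧ Ideal.Quotient.mk J P = x :=
  Iff.rfl

theorem mk_mul_mem_qComp {f : MvPolynomial ι k} (hf : f.IsHomogeneous 1) {m : ℕ}
    {x : MvPolynomial ι k ⧸ J} (hx : x ∈ qComp k J m) :
    Ideal.Quotient.mk J f * x ∈ qComp k J (m + 1) := by
  obtain ⟨P, hP, rfl⟩ := mem_qComp.1 hx
  exact mem_qComp.2 ⟨f * P, by simpa [add_comm] using hf.mul hP, map_mul _ _ _⟩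

instance finiteDimensional_qComp [Fintype ι] (m : ℕ) : FiniteDimensional k (qComp k J m) := by
  have hle : homogeneousSubmodule ι k m ≤ restrictTotalDegree ι k m := fun p hp =>
    (mem_restrictTotalDegree ι m p).2 (IsHomogeneous.totalDegree_le hp)
  have : FiniteDimensional k (homogeneousSubmodule ι k m) := Submodule.finiteDimensional_of_le hle
  exact Module.Finite.map _ _

theorem finrank_qComp_le_of_pairing [Fintype ι] {m m' : ℕ}
    (β : MvPolynomial ι k →ₗ[k] MvPolynomial ι k →ₗ[k] k)
    (h₁ : ∀ P Q, P ∈ J → β P Q = 0) (h₂ : ∀ P Q, Q ∈ J → β P Q = 0)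
    (h : ∀ P, P.IsHomogeneous m → P ∉ J → ∃ Q, Q.IsHomogeneous m' ∧ β P Q ≠ 0) :
    Module.finrank k (qComp k J m) ≤ Module.finrank k (qComp k J m') := by
  obtain ⟨s, hs⟩ := LinearMap.exists_rightInverse_of_surjective
    (Ideal.Quotient.mkₐ k J).toLinearMap
    (LinearMap.range_eq_top.2 (Ideal.Quotient.mkₐ_surjective k J))
  have hs' : ∀ P, s (Ideal.Quotient.mk J P) - P ∈ J := fun P =>
    (Ideal.Quotient.mk_eq_mk_iff_sub_mem _ _).1 (LinearMap.congr_fun hs (Ideal.Quotient.mk J P))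
  have hβ : ∀ P Q, β (s (Ideal.Quotient.mk J P)) (s (Ideal.Quotient.mk J Q)) = β P Q := by
    intro P Q
    rw [← sub_add_cancel (s (Ideal.Quotient.mk J P)) P, map_add, LinearMap.add_apply,
      h₁ _ _ (hs' P), zero_add, ← sub_add_cancel (s (Ideal.Quotient.mk J Q)) Q, map_add,
      h₂ _ _ (hs' Q), zero_add]
  let γ : qComp k J m →ₗ[k] Module.Dual k (qComp k J m') :=
    β.compl₁₂ (s.comp (qComp k J m).subtype) (s.comp (qComp k J m').subtype)
  have hγ : Function.Injective γ := by
    rw [← LinearMap.ker_eq_bot, LinearMap.ker_eq_bot']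
    rintro ⟨x, hx⟩ hγx
    obtain ⟨P, hP, rfl⟩ := mem_qComp.1 hx
    refine Subtype.ext (Ideal.Quotient.eq_zero_iff_mem.2 ?_)
    by_contra hPJ
    obtain ⟨Q, hQ, hne⟩ := h P hP hPJ
    refine hne ?_
    rw [← hβ]
    exact LinearMap.congr_fun hγx ⟨Ideal.Quotient.mk J Q, mem_qComp.2 ⟨Q, hQ, rfl⟩⟩
  rw [← Subspace.dual_finrank_eq (V := qComp k J m')]
  exact LinearMap.finrank_le_finrank_of_injective hγ

variable (J) in
/-- Multiplication by `ω` is injective on the degree-`m` component. -/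
def InjAt (ω : MvPolynomial ι k ⧸ J) (m : ℕ) : Prop := ∀ x ∈ qComp k J m, ω * x = 0 → x = 0

variable (J) in
/-- Multiplication by `ω` from degree `m` to degree `m + 1` is surjective. -/
def SurjAt (ω : MvPolynomial ι k ⧸ J) (m : ℕ) : Prop :=
  ∀ y ∈ qComp k J (m + 1), ∃ x ∈ qComp k J m, ω * x = y

/-- Multiplication by a linear form between consecutive graded components. -/
def mulQComp (J : Ideal (MvPolynomial ι k)) {W : MvPolynomial ι k} (hW : W.IsHomogeneous 1)
    (m : ℕ) : qComp k J m →ₗ[k] qComp k J (m + 1) :=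
  (LinearMap.mulLeft k (Ideal.Quotient.mk J W)).restrict fun _ hx => mk_mul_mem_qComp hW hx

theorem injAt_iff {W : MvPolynomial ι k} (hW : W.IsHomogeneous 1) {m : ℕ} :
    InjAt J (Ideal.Quotient.mk J W) m ↔ Function.Injective (mulQComp J hW m) := by
  rw [← LinearMap.ker_eq_bot, LinearMap.ker_eq_bot']
  constructor
  · rintro h ⟨x, hx⟩ h0
    exact Subtype.ext (h x hx (congrArg Subtype.val h0))
  · intro h x hx h0
    exact congrArg Subtype.val (h ⟨x, hx⟩ (Subtype.ext h0))

theorem surjAt_iff {W : MvPolynomial ι k} (hW : W.IsHomogeneous 1) {m : ℕ} :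
    SurjAt J (Ideal.Quotient.mk J W) m ↔ Function.Surjective (mulQComp J hW m) := by
  constructor
  · rintro h ⟨y, hy⟩
    obtain ⟨x, hx, h⟩ := h y hy
    exact ⟨⟨x, hx⟩, Subtype.ext h⟩
  · intro h y hy
    obtain ⟨⟨x, hx⟩, h⟩ := h ⟨y, hy⟩
    exact ⟨x, hx, congrArg Subtype.val h⟩

theorem InjAt.finrank_le [Fintype ι] {W : MvPolynomial ι k} (hW : W.IsHomogeneous 1) {m : ℕ}
    (h : InjAt J (Ideal.Quotient.mk J W) m) :
    Module.finrank k (qComp k J m) ≤ Module.finrank k (qComp k J (m + 1)) :=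
  LinearMap.finrank_le_finrank_of_injective ((injAt_iff hW).1 h)

theorem SurjAt.finrank_le [Fintype ι] {W : MvPolynomial ι k} (hW : W.IsHomogeneous 1) {m : ℕ}
    (h : SurjAt J (Ideal.Quotient.mk J W) m) :
    Module.finrank k (qComp k J (m + 1)) ≤ Module.finrank k (qComp k J m) :=
  LinearMap.finrank_le_finrank_of_surjective ((surjAt_iff hW).1 h)

theorem injAt_iff_surjAt [Fintype ι] {W : MvPolynomial ι k} (hW : W.IsHomogeneous 1) {m : ℕ}
    (h : Module.finrank k (qComp k J m) = Module.finrank k (qComp k J (m + 1))) :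
    InjAt J (Ideal.Quotient.mk J W) m ↔ SurjAt J (Ideal.Quotient.mk J W) m := by
  rw [injAt_iff hW, surjAt_iff hW]
  exact LinearMap.injective_iff_surjective_of_finrank_eq_finrank h

theorem SurjAt.succ {ω : MvPolynomial ι k ⧸ J} {m : ℕ} (h : SurjAt J ω m) :
    SurjAt J ω (m + 1) := by
  intro y hy
  obtain ⟨P, hP, rfl⟩ := mem_qComp.1 hy
  suffices hS : Ideal.Quotient.mk J P ∈
      (qComp k J (m + 1)).map (LinearMap.mulLeft k ω) from hS
  rw [P.as_sum, map_sum]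
  refine Submodule.sum_mem _ fun s hs => ?_
  have hdeg : s.degree = m + 1 + 1 := by
    by_contra hc
    exact mem_support_iff.1 hs (hP.coeff_eq_zero hc)
  obtain ⟨i, hi⟩ : ∃ i, s i ≠ 0 := by
    by_contra! hc
    have : s = 0 := Finsupp.ext hc
    simp [this] at hdeg
  obtain ⟨t, rfl⟩ : ∃ t, s = Finsupp.single i 1 + t :=
    ⟨s - Finsupp.single i 1, by
      rw [add_tsub_cancel_of_le]
      simpa [Finsupp.single_le_iff] using Nat.one_le_iff_ne_zero.2 hi⟩
  rw [map_add, Finsupp.degree_single] at hdeg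
  have ht : (monomial t (coeff (Finsupp.single i 1 + t) P)).IsHomogeneous (m + 1) :=
    isHomogeneous_monomial _ (by omega)
  obtain ⟨x, hx, hxy⟩ := h _ (mem_qComp.2 ⟨_, ht, rfl⟩)
  refine ⟨Ideal.Quotient.mk J (X i) * x, mk_mul_mem_qComp (isHomogeneous_X k i) hx, ?_⟩
  rw [LinearMap.mulLeft_apply, mul_left_comm, hxy, ← map_mul, X, monomial_mul, one_mul]

theorem InjAt.of_succ {W : MvPolynomial ι k} {m : ℕ}
    (hS : ∀ P : MvPolynomial ι k, P.IsHomogeneous m → (∀ i, X i * P ∈ J) → P ∈ J)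
    (h : InjAt J (Ideal.Quotient.mk J W) (m + 1)) : InjAt J (Ideal.Quotient.mk J W) m := by
  intro x hx h0
  obtain ⟨P, hP, rfl⟩ := mem_qComp.1 hx
  refine Ideal.Quotient.eq_zero_iff_mem.2 (hS P hP fun i => ?_)
  rw [← Ideal.Quotient.eq_zero_iff_mem, map_mul]
  refine h _ (mk_mul_mem_qComp (isHomogeneous_X k i) hx) ?_
  rw [mul_left_comm, h0, mul_zero]

theorem forall_mulMaxRank_iff [Fintype ι] {d : ℕ} (hd : 2 ≤ d)
    (hsymm : ∀ m m', m + m' = d →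
      Module.finrank k (qComp k J m) ≤ Module.finrank k (qComp k J m'))
    (hS : ∀ m, m + 1 < d → ∀ P : MvPolynomial ι k, P.IsHomogeneous m →
      (∀ i, X i * P ∈ J) → P ∈ J) {W : MvPolynomial ι k} (hW : W.IsHomogeneous 1) :
    (∀ m, mulMaxRank k J (Ideal.Quotient.mk J W) m) ↔
      InjAt J (Ideal.Quotient.mk J W) ((d - 1) / 2) ∧
        SurjAt J (Ideal.Quotient.mk J W) (d / 2) := by
  constructor
  · intro h
    obtain ⟨e, rfl | rfl⟩ : ∃ e, d = 2 * e + 2 ∨ d = 2 * e + 1 :=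
      ⟨(d - 1) / 2, by omega⟩
    · rw [show (2 * e + 2 - 1) / 2 = e by omega, show (2 * e + 2) / 2 = e + 1 by omega]
      have heq : Module.finrank k (qComp k J e) = Module.finrank k (qComp k J (e + 1 + 1)) :=
        le_antisymm (hsymm _ _ (by omega)) (hsymm _ _ (by omega))
      constructor
      · refine (h e).elim id fun hs => ?_
        have h1 := SurjAt.finrank_le hW hs
        have h2 := SurjAt.finrank_le hW (SurjAt.succ hs)
        exact (injAt_iff_surjAt hW (by omega)).2 hs
      · refine (h (e + 1)).elim (fun hi => ?_) id
        have h1 := InjAt.finrank_le hW hi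
        have h2 := (InjAt.of_succ (hS e (by omega)) hi).finrank_le hW
        exact (injAt_iff_surjAt hW (by omega)).1 hi
    · rw [show (2 * e + 1 - 1) / 2 = e by omega, show (2 * e + 1) / 2 = e by omega]
      have heq : Module.finrank k (qComp k J e) = Module.finrank k (qComp k J (e + 1)) :=
        le_antisymm (hsymm _ _ (by omega)) (hsymm _ _ (by omega))
      have h' := injAt_iff_surjAt (J := J) hW heq
      rcases h e with h | h
      · exact ⟨h, h'.1 h⟩
      · exact ⟨h'.2 h, h⟩
  · rintro ⟨hinj, hsurj⟩ m
    rcases le_or_gt (d / 2) m with hm | hm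
    · refine Or.inr ?_
      induction m, hm using Nat.le_induction with
      | base => exact hsurj
      | succ m _ ih => exact SurjAt.succ ih
    · refine Or.inl ?_
      have hm' : m ≤ (d - 1) / 2 := by omega
      clear hm
      induction hm' using Nat.decreasingInduction with
      | self => exact hinj
      | of_succ m hm' ih => exact InjAt.of_succ (hS m (by omega)) ih

end Graded

section Genericity
variable {k : Type} [Field k] {n : ℕ}

theorem exists_homogenization (g : MvPolynomial (Fin n) k) :
    ∃ (N : ℕ) (h : MvPolynomial (Fin (n + 1)) k), ∀ b : Fin (n + 1) → k, b (Fin.last n) ≠ 0 →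
      eval b h = b (Fin.last n) ^ N *
        eval (fun i : Fin n => (b (Fin.last n))⁻¹ * b i.castSucc) g := by
  induction g using MvPolynomial.induction_on with
  | C a => exact ⟨0, C a, fun b _ => by simp⟩
  | add p q hp hq =>
    obtain ⟨N, h, hh⟩ := hp
    obtain ⟨N', h', hh'⟩ := hq
    refine ⟨N + N', h * X (Fin.last n) ^ N' + h' * X (Fin.last n) ^ N, fun b hb => ?_⟩
    simp only [map_add, map_mul, map_pow, eval_X, hh b hb, hh' b hb]
    ring
  | mul_X p i hp =>
    obtain ⟨N, h, hh⟩ := hp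
    refine ⟨N + 1, h * X i.castSucc, fun b hb => ?_⟩
    simp only [map_mul, eval_X, hh b hb]
    field_simp
    ring

theorem exists_eval_ne_zero [Infinite k] {τ : Type} {g : MvPolynomial τ k} (hg : g ≠ 0) :
    ∃ b, eval b g ≠ 0 := by
  by_contra! hc
  exact hg (MvPolynomial.funext fun b => by simp [hc b])

theorem generic_iff_of_scaling [Infinite k] {Φ : (Fin (n + 1) → k) → Prop}
    {Ψ : (Fin n → k) → Prop}
    (h : ∀ b, b (Fin.last n) ≠ 0 →
      (Φ b ↔ Ψ fun i : Fin n => (b (Fin.last n))⁻¹ * b i.castSucc)) :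
    Generic k (Fin (n + 1)) Φ ↔ Generic k (Fin n) Ψ := by
  constructor
  · rintro ⟨g, hg, hgΦ⟩
    obtain ⟨x, hx⟩ := exists_eval_ne_zero (mul_ne_zero hg (X_ne_zero (Fin.last n)))
    rw [map_mul, eval_X, mul_ne_zero_iff] at hx
    obtain ⟨hxg, hx0⟩ := hx
    set a := x (Fin.last n) with ha
    let f := aeval (Fin.snoc (fun i : Fin n => C a * X i) (C a) :
      Fin (n + 1) → MvPolynomial (Fin n) k) g
    have hev : ∀ b : Fin n → k,
        eval b f = eval (Fin.snoc (fun i => a * b i) a : Fin (n + 1) → k) g := by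
      intro b
      simp only [f]
      rw [aeval_def, eval₂_eq', map_sum, eval_eq']
      refine Finset.sum_congr rfl fun m _ => ?_
      simp [Fin.prod_univ_castSucc]
    refine ⟨f, fun h0 => ?_, fun b hb => ?_⟩
    · refine hxg ?_
      have := hev fun i => a⁻¹ * x i.castSucc
      rw [h0, map_zero] at this
      rw [this]
      congr 2
      funext i
      refine Fin.lastCases ?_ (fun i => ?_) i
      · simp [ha]
      · simp [mul_inv_cancel_left₀ hx0]
    · rw [hev] at hb
      have := (h _ (by simpa using hx0)).1 (hgΦ _ hb)
      simpa [inv_mul_cancel_left₀ hx0] using this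
  · rintro ⟨g, hg, hgΨ⟩
    obtain ⟨N, p, hp⟩ := exists_homogenization g
    refine ⟨p * X (Fin.last n), fun h0 => ?_, fun b hb => ?_⟩
    · obtain ⟨b, hb⟩ := exists_eval_ne_zero hg
      have h1 := congrArg (eval (Fin.snoc b 1 : Fin (n + 1) → k)) h0
      rw [map_mul, hp _ (by simp)] at h1
      simp at h1
      exact hb h1
    · rw [map_mul, eval_X, mul_ne_zero_iff] at hb
      refine (h b hb.2).2 (hgΨ _ fun h0 => hb.1 ?_)
      rw [hp b hb.2, h0, mul_zero]

end Genericity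

section Final
variable {k : Type} [Field k] {n : ℕ}

theorem linForm_succ (b : Fin (n + 1) → k) :
    linForm k b = toT k (linForm k fun i => b i.castSucc) + C (b (Fin.last n)) * Tv k n := by
  simp [linForm, Fin.sum_univ_castSucc, toT, Tv]

theorem isHomogeneous_toT_linForm_add_Tv (c : Fin n → k) :
    (toT k (linForm k c) + Tv k n).IsHomogeneous 1 :=
  ((linForm_isHomogeneous c).rename_isHomogeneous (f := Fin.castSucc)).add
    (isHomogeneous_X k (Fin.last n))

theorem mulMaxRank_C_mul_iff {ι : Type} [Fintype ι] {J : Ideal (MvPolynomial ι k)} {a : k}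
    (ha : a ≠ 0) (W : MvPolynomial ι k) (m : ℕ) :
    mulMaxRank k J (Ideal.Quotient.mk J (C a * W)) m ↔
      mulMaxRank k J (Ideal.Quotient.mk J W) m := by
  have hu : IsUnit (Ideal.Quotient.mk J (C a)) := (ha.isUnit.map C).map (Ideal.Quotient.mk J)
  refine or_congr (forall₂_congr fun x hx => ?_) (forall₂_congr fun y hy => ?_)
  · rw [map_mul, mul_assoc, hu.mul_right_eq_zero]
  · have hsmul : ∀ (b : k) (x : MvPolynomial ι k ⧸ J),
        Ideal.Quotient.mk J (C b) * x = b • x := fun b x => by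
      obtain ⟨x, rfl⟩ := Ideal.Quotient.mk_surjective x
      rw [← map_mul, ← smul_eq_C_mul]
      rfl
    constructor
    · rintro ⟨x, hx, rfl⟩
      refine ⟨a • x, Submodule.smul_mem _ _ hx, ?_⟩
      rw [← hsmul, map_mul]
      ring
    · rintro ⟨x, hx, rfl⟩
      refine ⟨a⁻¹ • x, Submodule.smul_mem _ _ hx, ?_⟩
      rw [map_mul, mul_assoc, mul_smul_comm, hsmul, smul_inv_smul₀ ha]

theorem artWLP_iff_of_scaling [Infinite k] (J : Ideal (MvPolynomial (Fin (n + 1)) k)) :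
    artWLP k J ↔ Generic k (Fin n) fun c' => ∀ m,
      mulMaxRank k J (Ideal.Quotient.mk J (toT k (linForm k c') + Tv k n)) m := by
  refine generic_iff_of_scaling fun b hb => forall_congr' fun m => ?_
  rw [linForm_succ]
  have : (fun i : Fin n => (b (Fin.last n))⁻¹ * b i.castSucc) =
      (b (Fin.last n))⁻¹ • fun i => b i.castSucc := rfl
  have h : toT k (linForm k fun i => b i.castSucc) + C (b (Fin.last n)) * Tv k n =
      C (b (Fin.last n)) *
        (toT k (linForm k fun i => (b (Fin.last n))⁻¹ * b i.castSucc) + Tv k n) := by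
    rw [this, linForm_smul, map_mul, mul_add, ← mul_assoc,
      show toT k (C (b (Fin.last n))⁻¹) = C (b (Fin.last n))⁻¹ from rename_C _ _, ← C_mul,
      mul_inv_cancel₀ hb, C_1, one_mul]
  rw [h, mulMaxRank_C_mul_iff hb]

theorem Generic.congr {τ : Type} {Φ Ψ : (τ → k) → Prop} (h : ∀ c, Φ c ↔ Ψ c) :
    Generic k τ Φ ↔ Generic k τ Ψ := by
  rw [funext fun c => propext (h c)]

theorem extI_ofList {d : ℕ} (c : Fin d × Fin n → k) :
    extI k (Ideal.ofList (List.ofFn fun j => linForm k fun i => c (j, i))) = xForms k c := by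
  rw [extI, Ideal.ofList, Ideal.map_span, xForms]
  congr 1
  ext x
  simp [List.mem_ofFn]

end Final

/-- **Lemma.** `C` has the WLP iff for general `ω ∈ R₁` multiplication by `ω + T`
is injective `C_{p₁} → C_{p₁+1}` and surjective `C_{p₂} → C_{p₂+1}`. -/
theorem wlp_C_iff_inj_surj (k : Type) [Field k] [Infinite k]
    (n q d : ℕ) (hq : 1 ≤ q)
    (D : SC n) (hD : gorStar k D)
    (σ : Finset (Fin n)) (hσ : σ ∈ D.faces) (hcard : σ.card = q + 1)
    (hd : d = dimP D) :
    Generic k (Fin d × Fin n) fun c =>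
      artWLP k (IC k D σ q ⊔ xForms k c) ↔
        Generic k (Fin n) fun c' =>
          (∀ x ∈ qComp k (IC k D σ q ⊔ xForms k c) ((d - 1) / 2),
            Ideal.Quotient.mk (IC k D σ q ⊔ xForms k c)
              (toT k (linForm k c') + Tv k n) * x = 0 → x = 0) ∧
          (∀ y ∈ qComp k (IC k D σ q ⊔ xForms k c) (d / 2 + 1),
            ∃ x ∈ qComp k (IC k D σ q ⊔ xForms k c) (d / 2),
              Ideal.Quotient.mk (IC k D σ q ⊔ xForms k c)
                (toT k (linForm k c') + Tv k n) * x = y) := by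
  subst hd
  have hdim : q + 1 ≤ dimP D := hcard ▸ Finset.le_sup (f := Finset.card) hσ
  obtain ⟨g, hg, hgor⟩ := hD.2.1.2
  refine ⟨g * ∏ v, X v, mul_ne_zero hg (Finset.prod_ne_zero_iff.2 fun v _ => X_ne_zero v),
    fun c hc => ?_⟩
  rw [map_mul, mul_ne_zero_iff, map_prod, Finset.prod_ne_zero_iff] at hc
  obtain ⟨hGb, a, ha, hGl⟩ := hasSocleDegree_of_gorStar hD hσ (by omega) (hgor c hc.1) fun j v => by
    simpa using hc.2 (j, v) (Finset.mem_univ _)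
  rw [hcard] at ha
  set K := Ideal.ofList (List.ofFn fun j => linForm k fun i => c (j, i)) with hK
  have hHI : ∀ τ, IsHomogIdeal (starIdeal k D τ ⊔ K) := fun τ =>
      (starIdeal_isHomogIdeal D τ).sup_ofList fun f hf => by
    obtain ⟨j, rfl⟩ := (List.mem_ofFn' _ _).1 hf
    exact ⟨1, linForm_isHomogeneous _⟩
  have hbl : starIdeal k D ∅ ⊔ K ≤ starIdeal k D σ ⊔ K :=
      sup_le_sup_right (starIdeal_mono D (Finset.empty_subset σ)) K
  have hC : IC k D σ q ⊔ xForms k c = coneIdeal hbl q := by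
    rw [← coneIdeal_eq hbl rfl rfl, IC, srIdeal_eq_starIdeal, linkIdeal_eq_starIdeal, hK,
        extI_ofList]
  rw [hC, artWLP_iff_of_scaling]
  rw [ha] at hGb
  obtain ⟨β, h₁, h₂, h₃⟩ := exists_pairing_coneIdeal (hbl := hbl) (hHI ∅) (hHI σ) hGb hGl
  refine Generic.congr fun c' => forall_mulMaxRank_iff (by omega) (fun m m' hm => ?_)
    (fun m hm P hP hX => ?_) (isHomogeneous_toT_linForm_add_Tv c')
  · exact finrank_qComp_le_of_pairing β h₁ h₂ fun P hP => h₃ m m' P (hm.trans ha) hP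
  · exact mem_coneIdeal_of_X_mul_mem (hHI ∅) (hHI σ) hGb hGl (by omega) hP hX

end SRWLP
end
end

section
/- Let H = k[x_1,…,x_n, T, z]/(I, Tz, T·I_L), with all variables of degree 1. Then H is Cohen–Macaulay and dim H = d + 1. -/
open MvPolynomial

set_option synthInstance.maxHeartbeats 1000000
set_option maxHeartbeats 1000000

noncomputable section

namespace SRWLP

variable (k : Type) [Field k]

variable {n : ℕ}

variable {ι : Type} [Fintype ι]

/-- The inclusion `R = k[x₁,…,xₙ] → k[x₁,…,xₙ,T,z]`. -/
def toTZ {n : ℕ} : MvPolynomial (Fin n) k →ₐ[k] MvPolynomial (Fin (n + 2)) k :=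
  rename (Fin.castAdd 2)

/-- The variable `T` of `k[x₁,…,xₙ,T,z]`. -/
def Tv2 (n : ℕ) : MvPolynomial (Fin (n + 2)) k := X ⟨n, by omega⟩

/-- The variable `z` of `k[x₁,…,xₙ,T,z]`. -/
def zv2 (n : ℕ) : MvPolynomial (Fin (n + 2)) k := X ⟨n + 1, by omega⟩

/-- The ideal `(I, Tz, T·I_L)` of `k[x₁,…,xₙ,T,z]`. -/
def Hideal (D : SC n) (σ : Finset (Fin n)) : Ideal (MvPolynomial (Fin (n + 2)) k) :=
  Ideal.map (toTZ k) (srIdeal k D) ⊔ Ideal.span {Tv2 k n * zv2 k n} ⊔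
    Ideal.span ((fun f => Tv2 k n * toTZ k f) ''
      ((linkIdeal k D σ : Set (MvPolynomial (Fin n) k))))


section Depth

variable {A : Type*} [CommRing A]

/-- `f` is a nonzerodivisor on `A ⧸ J`. -/
def RegMod (J : Ideal A) (f : A) : Prop := ∀ g, f * g ∈ J → g ∈ J

/-- There is a weakly regular sequence of length `t` on `A ⧸ J` consisting of elements of `m`. -/
def DepthAtLeast (m : Ideal A) : ℕ → Ideal A → Prop
  | 0, _ => True
  | t + 1, J => ∃ f ∈ m, RegMod J f ∧ DepthAtLeast m t (J ⊔ Ideal.span {f})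

theorem mem_sup_span_singleton {J : Ideal A} {f g : A} :
    g ∈ J ⊔ Ideal.span {f} ↔ ∃ h, g - f * h ∈ J := by
  rw [Submodule.mem_sup]
  constructor
  · rintro ⟨j, hj, y, hy, rfl⟩
    obtain ⟨h, rfl⟩ := Ideal.mem_span_singleton'.1 hy
    exact ⟨h, by convert hj using 1; ring⟩
  · rintro ⟨h, hh⟩
    exact ⟨_, hh, f * h, Ideal.mul_mem_right _ _ (Ideal.mem_span_singleton_self f), by ring⟩

theorem mem_colon_singleton' {J : Ideal A} {f g : A} :
    g ∈ Submodule.colon J {f} ↔ f * g ∈ J := by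
  rw [Submodule.mem_colon_singleton, smul_eq_mul, mul_comm]

theorem RegMod.swap {J : Ideal A} {f h : A} (hf : RegMod J f)
    (hh : RegMod (J ⊔ Ideal.span {f}) h) : RegMod (J ⊔ Ideal.span {h}) f := by
  intro u hu
  obtain ⟨v, hv⟩ := mem_sup_span_singleton.1 hu
  have : h * v ∈ J ⊔ Ideal.span {f} :=
    mem_sup_span_singleton.2 ⟨u, by simpa using J.neg_mem hv⟩
  obtain ⟨w, hw⟩ := mem_sup_span_singleton.1 (hh v this)
  refine mem_sup_span_singleton.2 ⟨w, hf _ ?_⟩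
  have := J.add_mem hv (J.mul_mem_left h hw)
  convert this using 1
  ring

theorem RegMod.colon {J : Ideal A} {r : A} (hr : RegMod J r) (f : A) :
    RegMod (Submodule.colon J {f}) r := by
  intro g hg
  rw [mem_colon_singleton'] at hg ⊢
  exact hr _ (by convert hg using 1; ring)

theorem RegMod.of_colon {J : Ideal A} {r f : A} (h₁ : RegMod (Submodule.colon J {f}) r)
    (h₂ : RegMod (J ⊔ Ideal.span {f}) r) : RegMod J r := by
  intro g hg
  obtain ⟨h, hh⟩ := mem_sup_span_singleton.1 (h₂ g (Ideal.mem_sup_left hg))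
  have key : f * (r * h) ∈ J := by
    have := J.sub_mem hg (J.mul_mem_left r hh)
    convert this using 1
    ring
  have := mem_colon_singleton'.1 (h₁ h (mem_colon_singleton'.2 key))
  simpa using J.add_mem hh this

theorem colon_sup_span {J : Ideal A} {r f : A} (h : RegMod (J ⊔ Ideal.span {f}) r) :
    Submodule.colon (J ⊔ Ideal.span {r}) {f} = Submodule.colon J {f} ⊔ Ideal.span {r} := by
  ext g
  rw [mem_colon_singleton']
  constructor
  · intro hg
    obtain ⟨s, hs⟩ := mem_sup_span_singleton.1 hg
    have : r * s ∈ J ⊔ Ideal.span {f} :=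
      mem_sup_span_singleton.2 ⟨g, by simpa using J.neg_mem hs⟩
    obtain ⟨w, hw⟩ := mem_sup_span_singleton.1 (h s this)
    refine mem_sup_span_singleton.2 ⟨w, mem_colon_singleton'.2 ?_⟩
    have := J.add_mem hs (J.mul_mem_left r hw)
    convert this using 1
    ring
  · intro hg
    obtain ⟨s, hs⟩ := mem_sup_span_singleton.1 hg
    rw [mem_colon_singleton'] at hs
    exact mem_sup_span_singleton.2 ⟨f * s, by convert hs using 1; ring⟩

theorem DepthAtLeast.mul_notMem {m : Ideal A} {t : ℕ} {J : Ideal A}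
    (h : DepthAtLeast m (t + 1) J) (u : A) (hu : u ∉ J) : ∃ f ∈ m, f * u ∉ J := by
  obtain ⟨f, hf, hr, -⟩ := h
  exact ⟨f, hf, fun h => hu (hr u h)⟩

variable [Infinite k] [Algebra k A] [IsNoetherianRing A]

/-- Prime avoidance for linear subspaces over an infinite field. -/
theorem exists_regMod (V : Submodule k A) {κ : Type*} [Finite κ] (J : κ → Ideal A)
    (h : ∀ i u, u ∉ J i → ∃ f ∈ V, f * u ∉ J i) : ∃ f ∈ V, ∀ i, RegMod (J i) f := by
  by_contra! hcon
  have (i : κ) : Finite (associatedPrimes A (A ⧸ J i)) := associatedPrimes.finite A _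
  let p : (Σ i, associatedPrimes A (A ⧸ J i)) → Submodule k V := fun P =>
    ((P.2 : Ideal A).restrictScalars k).comap V.subtype
  have hcov : ⋃ P, (p P : Set V) = Set.univ := by
    refine Set.eq_univ_of_forall fun f => ?_
    obtain ⟨i, hi⟩ := hcon f f.2
    have : ∃ g, (f : A) * g ∈ J i ∧ g ∉ J i := by simpa [RegMod] using hi
    obtain ⟨g, hg, hg'⟩ := this
    have hmem : (f : A) ∈ ⋃ P ∈ associatedPrimes A (A ⧸ J i), (P : Set A) := by
      rw [biUnion_associatedPrimes_eq_zero_divisors]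
      exact ⟨Ideal.Quotient.mk _ g, by rwa [Ne, Ideal.Quotient.eq_zero_iff_mem],
        Ideal.Quotient.eq_zero_iff_mem.2 hg⟩
    obtain ⟨P, hP, hfP⟩ := Set.mem_iUnion₂.1 hmem
    exact Set.mem_iUnion.2 ⟨⟨i, P, hP⟩, hfP⟩
  obtain ⟨⟨i, P, hP⟩, hT⟩ := Subspace.exists_eq_top_of_iUnion_eq_univ hcov
  obtain ⟨hprime, x, hx⟩ := isAssociatedPrime_iff.1 hP
  obtain ⟨u, rfl⟩ := Ideal.Quotient.mk_surjective x
  have hmem (f : A) : f ∈ P ↔ f * u ∈ J i := by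
    rw [hx, Submodule.mem_colon_singleton, Submodule.mem_bot]
    exact Ideal.Quotient.eq_zero_iff_mem
  have hu : u ∉ J i := fun hu => hprime.ne_top ((Ideal.eq_top_iff_one _).2 ((hmem 1).2 (by simpa)))
  obtain ⟨f, hf, hfu⟩ := h i u hu
  have : (⟨f, hf⟩ : V) ∈ p ⟨i, P, hP⟩ := hT ▸ Submodule.mem_top
  exact hfu ((hmem f).1 this)

include k in
theorem exists_regMod_pair {m : Ideal A} {J₁ J₂ : Ideal A} {s t : ℕ}
    (h₁ : DepthAtLeast m (s + 1) J₁) (h₂ : DepthAtLeast m (t + 1) J₂) :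
    ∃ r ∈ m, RegMod J₁ r ∧ RegMod J₂ r := by
  obtain ⟨r, hr, h⟩ := exists_regMod k (m.restrictScalars k) (fun b : Bool => cond b J₁ J₂) <| by
    rintro (_ | _) u hu
    · exact h₂.mul_notMem u hu
    · exact h₁.mul_notMem u hu
  exact ⟨r, hr, h true, h false⟩

include k in
/-- All maximal regular sequences have the same length: one may start with any regular element. -/
theorem DepthAtLeast.sup_span {m : Ideal A} (t : ℕ) : ∀ {J : Ideal A} {f : A}, f ∈ m → RegMod J f →
    DepthAtLeast m (t + 1) J → DepthAtLeast m t (J ⊔ Ideal.span {f}) := by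
  induction t with
  | zero => intros; trivial
  | succ t ih =>
    rintro J f hfm hf ⟨g, hgm, hg, hd⟩
    have hsoc (u : A) (hu : u ∉ J ⊔ Ideal.span {f}) : ∃ h ∈ m, h * u ∉ J ⊔ Ideal.span {f} := by
      by_contra! hcon
      obtain ⟨w, hw⟩ := mem_sup_span_singleton.1 (hcon g hgm)
      have hwm : ∀ h ∈ m, h * w ∈ J ⊔ Ideal.span {g} := by
        intro h hm
        obtain ⟨s, hs⟩ := mem_sup_span_singleton.1 (hcon h hm)
        refine mem_sup_span_singleton.2 ⟨s, hf _ ?_⟩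
        have := J.sub_mem (J.mul_mem_left g hs) (J.mul_mem_left h hw)
        convert this using 1
        ring
      have hwJ : w ∈ J ⊔ Ideal.span {g} := by
        by_contra hwJ
        obtain ⟨h, hm, hh⟩ := hd.mul_notMem w hwJ
        exact hh (hwm h hm)
      obtain ⟨s, hs⟩ := mem_sup_span_singleton.1 hwJ
      refine hu (mem_sup_span_singleton.2 ⟨s, hg _ ?_⟩)
      have := J.add_mem hw (J.mul_mem_left f hs)
      convert this using 1
      ring
    obtain ⟨h, hm, hh⟩ := exists_regMod k (m.restrictScalars k)
      (fun i : Fin 3 => ![J, J ⊔ Ideal.span {f}, J ⊔ Ideal.span {g}] i) <| by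
        intro i u hu
        fin_cases i
        · exact ⟨g, hgm, fun h => hu (hg u h)⟩
        · exact hsoc u hu
        · exact hd.mul_notMem u hu
    have h0 : RegMod J h := hh 0
    have h1 : RegMod (J ⊔ Ideal.span {f}) h := hh 1
    have h2 : RegMod (J ⊔ Ideal.span {g}) h := hh 2
    refine ⟨h, hm, h1, ?_⟩
    rw [sup_right_comm]
    refine ih hfm (hf.swap h1) ⟨g, hgm, hg.swap h2, ?_⟩
    rw [sup_right_comm]
    exact ih hm h2 hd

include k in
theorem DepthAtLeast.of_colon {m : Ideal A} (f : A) (t : ℕ) : ∀ {J : Ideal A},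
    DepthAtLeast m t (Submodule.colon J {f}) → DepthAtLeast m t (J ⊔ Ideal.span {f}) →
    DepthAtLeast m t J := by
  induction t with
  | zero => intros; trivial
  | succ t ih =>
    intro J h₁ h₂
    obtain ⟨r, hr, hr₁, hr₂⟩ := exists_regMod_pair k h₁ h₂
    refine ⟨r, hr, .of_colon hr₁ hr₂, ih ?_ ?_⟩
    · rw [colon_sup_span hr₂]
      exact h₁.sup_span k t hr hr₁
    · rw [sup_right_comm]
      exact h₂.sup_span k t hr hr₂

include k in
theorem DepthAtLeast.colon {m : Ideal A} (f : A) (t : ℕ) : ∀ {J : Ideal A},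
    DepthAtLeast m (t + 1) J → DepthAtLeast m t (J ⊔ Ideal.span {f}) →
    DepthAtLeast m (t + 1) (Submodule.colon J {f}) := by
  induction t with
  | zero =>
    rintro J ⟨r, hr, hr', -⟩ -
    exact ⟨r, hr, hr'.colon f, trivial⟩
  | succ t ih =>
    intro J h₁ h₂
    obtain ⟨r, hr, hr₁, hr₂⟩ := exists_regMod_pair k h₁ h₂
    refine ⟨r, hr, hr₁.colon f, ?_⟩
    rw [← colon_sup_span hr₂]
    refine ih (h₁.sup_span k _ hr hr₁) ?_
    rw [sup_right_comm]
    exact h₂.sup_span k t hr hr₂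

end Depth

section VertexDeletion

attribute [local instance] MvPolynomial.gradedAlgebra

variable {τ : Type}

/-- The ideal generated by the variables. -/
def irrelevant (τ : Type) : Ideal (MvPolynomial τ k) := Ideal.span (Set.range X)

theorem isHomogeneous_colon {J : Ideal (MvPolynomial τ k)}
    (hJ : J.IsHomogeneous (homogeneousSubmodule τ k)) {f : MvPolynomial τ k} {d : ℕ}
    (hf : f ∈ homogeneousSubmodule τ k d) :
    (Submodule.colon J {f}).IsHomogeneous (homogeneousSubmodule τ k) := by
  intro i p hp
  rw [mem_colon_singleton'] at hp ⊢
  rw [← DirectSum.coe_decompose_mul_add_of_left_mem _ hf]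
  exact hJ _ hp

theorem isHomogeneous_sup_span {J : Ideal (MvPolynomial τ k)}
    (hJ : J.IsHomogeneous (homogeneousSubmodule τ k)) {f : MvPolynomial τ k} {d : ℕ}
    (hf : f ∈ homogeneousSubmodule τ k d) :
    (J ⊔ Ideal.span {f}).IsHomogeneous (homogeneousSubmodule τ k) :=
  hJ.sup (Ideal.homogeneous_span _ _ (by rintro _ rfl; exact ⟨d, hf⟩))

theorem mem_of_forall_mem_sup_span_pow {J : Ideal (MvPolynomial τ k)}
    (hJ : J.IsHomogeneous (homogeneousSubmodule τ k)) (v : τ) {u : MvPolynomial τ k}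
    (h : ∀ N, u ∈ J ⊔ Ideal.span {X v ^ N}) : u ∈ J := by
  rw [mem_iff_homogeneousComponent_mem hJ]
  intro n
  obtain ⟨s, hs⟩ := mem_sup_span_singleton.1 (h (n + 1))
  have := homogeneousComponent_mem_of_mem hJ hs n
  rw [map_sub] at this
  have h0 : homogeneousComponent n (X v ^ (n + 1) * s) = 0 := by
    ext d
    rw [coeff_homogeneousComponent, coeff_zero]
    split_ifs with hd
    · rw [X_pow_eq_monomial, coeff_monomial_mul', if_neg]
      intro hle
      have := Finsupp.degree_mono hle
      simp [hd] at this
    · rfl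
  rwa [h0, sub_zero] at this

variable [DecidableEq τ]

/-- The substitution `X v ↦ 0`. -/
def zeroAt (v : τ) : MvPolynomial τ k →ₐ[k] MvPolynomial τ k :=
  aeval fun i => if i = v then 0 else X i

theorem sub_zeroAt_mem (v : τ) (p : MvPolynomial τ k) :
    p - zeroAt k v p ∈ Ideal.span {X v} := by
  rw [← Ideal.Quotient.eq_zero_iff_mem, map_sub, sub_eq_zero]
  have : (Ideal.Quotient.mkₐ k (Ideal.span {X v})) =
      (Ideal.Quotient.mkₐ k (Ideal.span {X v})).comp (zeroAt k v) := by
    refine MvPolynomial.algHom_ext fun i => ?_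
    by_cases hi : i = v
    · subst hi
      simp [zeroAt]
    · simp [zeroAt, hi]
  exact DFunLike.congr_fun this p

@[simp]
theorem zeroAt_X_self (v : τ) : zeroAt k v (X v) = 0 := by simp [zeroAt]

theorem zeroAt_X_of_ne {i v : τ} (h : i ≠ v) : zeroAt k v (X i) = X i := by simp [zeroAt, h]

variable {k} in
theorem mem_sup_X_iff {J : Ideal (MvPolynomial τ k)} {v : τ} (hJ : ∀ p ∈ J, zeroAt k v p ∈ J)
    (p : MvPolynomial τ k) : p ∈ J ⊔ Ideal.span {X v} ↔ zeroAt k v p ∈ J := by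
  constructor
  · intro h
    obtain ⟨g, hg⟩ := mem_sup_span_singleton.1 h
    simpa using hJ _ hg
  · intro h
    have := Submodule.add_mem_sup h (sub_zeroAt_mem k v p)
    simpa using this

variable {k} in
theorem RegMod.sup_X {J : Ideal (MvPolynomial τ k)} {v : τ} (hJ : ∀ p ∈ J, zeroAt k v p ∈ J)
    {θ : MvPolynomial τ k} (hθ : zeroAt k v θ = θ) (h : RegMod J θ) :
    RegMod (J ⊔ Ideal.span {X v}) θ := by
  intro g hg
  rw [mem_sup_X_iff hJ] at hg ⊢
  rw [map_mul, hθ] at hg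
  exact h _ hg

/-- The linear forms not involving `X v`. -/
def linearFormsAvoiding (v : τ) : Submodule k (MvPolynomial τ k) :=
  Submodule.span k (X '' {i | i ≠ v})

variable {k} in
theorem mem_of_forall_linearFormsAvoiding_mul_mem {J : Ideal (MvPolynomial τ k)}
    (hJ : J.IsHomogeneous (homogeneousSubmodule τ k)) (v : τ)
    (hd : DepthAtLeast (irrelevant k τ) 2 J) {u : MvPolynomial τ k}
    (hu : ∀ f ∈ linearFormsAvoiding k v, f * u ∈ J) : u ∈ J := by
  obtain ⟨f, hfm, hf, hd⟩ := hd
  have hX (w : MvPolynomial τ k) (hw : ∀ i ≠ v, X i * w ∈ J) (r : MvPolynomial τ k)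
      (hr : r ∈ Ideal.span (X '' {i | i ≠ v})) : r * w ∈ J := by
    have hle : Ideal.span (X '' {i | i ≠ v}) ≤ Submodule.colon J {w} := by
      rw [Ideal.span_le]
      rintro _ ⟨i, hi, rfl⟩
      exact Submodule.mem_colon_singleton.2 (hw i hi)
    exact Submodule.mem_colon_singleton.1 (hle hr)
  have hirr (g : MvPolynomial τ k) (hg : g ∈ irrelevant k τ) :
      ∃ c, g - X v * c ∈ Ideal.span (X '' {i | i ≠ v}) := by
    have hle : irrelevant k τ ≤ Ideal.span (X '' {i | i ≠ v}) ⊔ Ideal.span {X v} := by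
      refine Ideal.span_le.2 ?_
      rintro _ ⟨i, rfl⟩
      by_cases hi : i = v
      · subst hi
        exact Ideal.mem_sup_right (Ideal.mem_span_singleton_self _)
      · exact Ideal.mem_sup_left (Ideal.subset_span ⟨i, hi, rfl⟩)
    exact mem_sup_span_singleton.1 (hle hg)
  obtain ⟨c, hc⟩ := hirr f hfm
  have step (u : MvPolynomial τ k) (hu : ∀ i ≠ v, X i * u ∈ J) :
      ∃ s, (∀ i ≠ v, X i * s ∈ J) ∧ u - X v * s ∈ J := by
    have hw : c * u ∈ J ⊔ Ideal.span {f} := by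
      by_contra hw
      obtain ⟨g, hg, hgw⟩ := hd.mul_notMem _ hw
      obtain ⟨e, he⟩ := hirr g hg
      refine hgw (mem_sup_span_singleton.2 ⟨e * u, ?_⟩)
      have := J.sub_mem (J.mul_mem_left c (hX u hu _ he)) (J.mul_mem_left e (hX u hu _ hc))
      convert this using 1
      ring
    obtain ⟨s, hs⟩ := mem_sup_span_singleton.1 hw
    have hsU : ∀ i ≠ v, X i * s ∈ J := by
      intro i hi
      refine hf _ ?_
      have := J.sub_mem (J.mul_mem_left c (hu i hi)) (J.mul_mem_left (X i) hs)
      convert this using 1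
      ring
    refine ⟨s, hsU, hf _ ?_⟩
    have h1 := hX u hu _ hc
    have := J.add_mem h1 (J.mul_mem_left (X v) hs)
    convert this using 1
    ring
  have key (N : ℕ) : ∃ s, (∀ i ≠ v, X i * s ∈ J) ∧ u - X v ^ N * s ∈ J := by
    induction N with
    | zero => exact ⟨u, fun i hi => hu _ (Submodule.subset_span ⟨i, hi, rfl⟩), by simp⟩
    | succ N ih =>
      obtain ⟨s, hs, hus⟩ := ih
      obtain ⟨s', hs', hss⟩ := step s hs
      refine ⟨s', hs', ?_⟩
      have := J.add_mem hus (J.mul_mem_left (X v ^ N) hss)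
      convert this using 1
      ring
  exact mem_of_forall_mem_sup_span_pow k hJ v fun N =>
    mem_sup_span_singleton.2 ((key N).imp fun _ h => h.2)

variable [Infinite k] [Finite τ]

variable {k} in
/-- Setting a variable to zero lowers the depth by at most one. -/
theorem DepthAtLeast.sup_X (v : τ) (t : ℕ) : ∀ {J : Ideal (MvPolynomial τ k)},
    J.IsHomogeneous (homogeneousSubmodule τ k) → (∀ p ∈ J, zeroAt k v p ∈ J) →
    DepthAtLeast (irrelevant k τ) (t + 1) J →
    DepthAtLeast (irrelevant k τ) t (J ⊔ Ideal.span {X v}) := by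
  induction t with
  | zero => intros; trivial
  | succ t ih =>
    intro J hJ hz hd
    have hd2 : DepthAtLeast (irrelevant k τ) 2 J := by
      obtain ⟨f, hf, hf', g, hg, hg', -⟩ := hd
      exact ⟨f, hf, hf', g, hg, hg', trivial⟩
    obtain ⟨θ, hθ, hreg⟩ := exists_regMod k (linearFormsAvoiding k v) (fun _ : Unit => J) <| by
      intro _ u hu
      by_contra! hcon
      exact hu (mem_of_forall_linearFormsAvoiding_mul_mem hJ v hd2 hcon)
    have hθz : zeroAt k v θ = θ := by
      clear hreg
      induction hθ using Submodule.span_induction with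
      | mem x hx =>
        obtain ⟨i, hi, rfl⟩ := hx
        exact zeroAt_X_of_ne k hi
      | zero => simp
      | add x y _ _ hx hy => rw [map_add, hx, hy]
      | smul a x _ hx => rw [map_smul, hx]
    have hθm : θ ∈ irrelevant k τ := by
      have : linearFormsAvoiding k v ≤ (irrelevant k τ).restrictScalars k := by
        refine Submodule.span_le.2 ?_
        rintro _ ⟨i, -, rfl⟩
        exact Ideal.subset_span ⟨i, rfl⟩
      exact this hθ
    have hθ1 : θ ∈ homogeneousSubmodule τ k 1 := by
      have : linearFormsAvoiding k v ≤ homogeneousSubmodule τ k 1 := by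
        refine Submodule.span_le.2 ?_
        rintro _ ⟨i, -, rfl⟩
        exact isHomogeneous_X k i
      exact this hθ
    refine ⟨θ, hθm, (hreg ()).sup_X hz hθz, ?_⟩
    rw [sup_right_comm]
    refine ih (isHomogeneous_sup_span k hJ hθ1) ?_ (hd.sup_span k _ hθm (hreg ()))
    intro p hp
    obtain ⟨g, hg⟩ := mem_sup_span_singleton.1 hp
    refine mem_sup_span_singleton.2 ⟨zeroAt k v g, ?_⟩
    simpa [hθz] using hz _ hg

variable {k} in
theorem DepthAtLeast.colon_prod_X (σ : Finset τ) {t : ℕ} : ∀ {J : Ideal (MvPolynomial τ k)},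
    J.IsHomogeneous (homogeneousSubmodule τ k) → (∀ v ∈ σ, ∀ p ∈ J, zeroAt k v p ∈ J) →
    DepthAtLeast (irrelevant k τ) t J →
    DepthAtLeast (irrelevant k τ) t (Submodule.colon J {∏ i ∈ σ, X i}) := by
  induction σ using Finset.induction_on with
  | empty =>
    intro J _ _ hd
    convert hd
    ext g
    simp [Submodule.mem_colon_singleton]
  | insert v σ hv ih =>
    intro J hJ hz hd
    have hstep : DepthAtLeast (irrelevant k τ) t (Submodule.colon J {X v}) := by
      cases t with
      | zero => trivial
      | succ t => exact hd.colon k _ t (hd.sup_X v t hJ (hz v (by simp)))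
    have heq : Submodule.colon J {∏ i ∈ insert v σ, X i} =
        Submodule.colon (Submodule.colon J {X v}) {∏ i ∈ σ, X i} := by
      ext g
      rw [mem_colon_singleton', mem_colon_singleton', mem_colon_singleton', Finset.prod_insert hv,
        mul_assoc]
    rw [heq]
    refine ih (isHomogeneous_colon k hJ (isHomogeneous_X k v)) ?_ hstep
    intro w hw p hp
    rw [mem_colon_singleton'] at hp ⊢
    have := hz w (by simp [hw]) _ hp
    rwa [map_mul, zeroAt_X_of_ne k (by rintro rfl; exact hv hw)] at this

end VertexDeletion

section RegularSequence

variable {A : Type*} [CommRing A]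

theorem depthAtLeast_iff_exists_list {m : Ideal A} (t : ℕ) : ∀ {J : Ideal A}, DepthAtLeast m t J ↔
    ∃ rs : List A, rs.length = t ∧ (∀ f ∈ rs, f ∈ m) ∧
      ∀ i (h : i < rs.length), RegMod (J ⊔ Ideal.ofList (rs.take i)) rs[i] := by
  induction t with
  | zero =>
    intro J
    refine ⟨fun _ => ⟨[], rfl, by simp, by simp⟩, fun _ => trivial⟩
  | succ t ih =>
    intro J
    constructor
    · rintro ⟨f, hf, hr, hd⟩
      obtain ⟨rs, hl, hm, hrs⟩ := ih.1 hd
      refine ⟨f :: rs, by simp [hl], by simpa using ⟨hf, hm⟩, ?_⟩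
      rintro (_ | i) h
      · simpa using hr
      · simpa [sup_assoc] using hrs i (by simpa using h)
    · rintro ⟨_ | ⟨f, rs⟩, hl, hm, hrs⟩
      · simp at hl
      · have h0 : RegMod (J ⊔ Ideal.ofList []) f := hrs 0 (by simp)
        refine ⟨f, hm f (by simp), by simpa using h0, ih.2 ⟨rs, by simpa using hl,
          fun g hg => hm g (by simp [hg]), fun i hi => ?_⟩⟩
        have hi : RegMod (J ⊔ Ideal.ofList (f :: rs.take i)) rs[i] :=
          hrs (i + 1) (by simpa using hi)
        simpa [sup_assoc] using hi

theorem isSMulRegular_quotient_ofList_iff {J : Ideal A} (rs : List A) (f : A) :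
    IsSMulRegular ((A ⧸ J) ⧸ (Ideal.ofList (rs.map (Ideal.Quotient.mk J)) • ⊤ :
      Submodule (A ⧸ J) (A ⧸ J))) (Ideal.Quotient.mk J f) ↔ RegMod (J ⊔ Ideal.ofList rs) f := by
  rw [isSMulRegular_quotient_iff_mem_of_smul_mem, Ideal.Quotient.mk_surjective.forall]
  have hmem (g : A) : Ideal.Quotient.mk J g ∈ (Ideal.ofList (rs.map (Ideal.Quotient.mk J)) • ⊤ :
      Submodule (A ⧸ J) (A ⧸ J)) ↔ g ∈ J ⊔ Ideal.ofList rs := by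
    rw [smul_eq_mul, Ideal.mul_top, ← Ideal.map_ofList, ← Ideal.mem_comap,
      Ideal.comap_map_of_surjective _ Ideal.Quotient.mk_surjective, sup_comm, ← RingHom.ker,
      Ideal.mk_ker]
  exact forall_congr' fun g => imp_congr (hmem (f * g)) (hmem g)

theorem isWeaklyRegular_quotient_iff {J : Ideal A} (rs : List A) :
    RingTheory.Sequence.IsWeaklyRegular (A ⧸ J) (rs.map (Ideal.Quotient.mk J)) ↔
      ∀ i (h : i < rs.length), RegMod (J ⊔ Ideal.ofList (rs.take i)) rs[i] := by
  rw [RingTheory.Sequence.isWeaklyRegular_iff]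
  simp only [List.length_map, List.getElem_map]
  refine forall₂_congr fun i h => ?_
  rw [← isSMulRegular_quotient_ofList_iff, List.map_take]

variable {k} {τ : Type}

theorem depthGE.depthAtLeast {J : Ideal (MvPolynomial τ k)} {t : ℕ} (h : depthGE k J t) :
    DepthAtLeast (irrelevant k τ) t J := by
  obtain ⟨rs, hl, hm, hr⟩ := h
  exact (depthAtLeast_iff_exists_list t).2
    ⟨rs, hl, hm, (isWeaklyRegular_quotient_iff rs).1 hr.toIsWeaklyRegular⟩

theorem irrelevant_ne_top : irrelevant k τ ≠ ⊤ := by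
  intro h
  have hle : irrelevant k τ ≤ RingHom.ker (aeval (fun _ => 0) : MvPolynomial τ k →ₐ[k] k) := by
    refine Ideal.span_le.2 ?_
    rintro _ ⟨i, rfl⟩
    simp
  have := hle (h ▸ Submodule.mem_top : (1 : MvPolynomial τ k) ∈ _)
  simp at this

theorem DepthAtLeast.depthGE {J : Ideal (MvPolynomial τ k)} (hJ : J ≤ irrelevant k τ) {t : ℕ}
    (h : DepthAtLeast (irrelevant k τ) t J) : depthGE k J t := by
  obtain ⟨rs, hl, hm, hr⟩ := (depthAtLeast_iff_exists_list t).1 h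
  refine ⟨rs, hl, hm, (isWeaklyRegular_quotient_iff rs).2 hr, fun htop => irrelevant_ne_top (k := k)
    (τ := τ) ?_⟩
  rw [smul_eq_mul, Ideal.mul_top, ← Ideal.map_ofList] at htop
  have h1 : (1 : MvPolynomial τ k) ∈
      (Ideal.map (Ideal.Quotient.mk J) (Ideal.ofList rs)).comap (Ideal.Quotient.mk J) := by
    rw [← htop]; trivial
  rw [Ideal.comap_map_of_surjective _ Ideal.Quotient.mk_surjective, ← RingHom.ker,
    Ideal.mk_ker] at h1
  exact (Ideal.eq_top_iff_one _).2 (sup_le (Ideal.span_le.2 hm) hJ h1)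

end RegularSequence

section Extension

variable {k}

/-- `k[x₁,…,xₙ,T,z]` as a polynomial ring in `T`, `z` over `k[x₁,…,xₙ]`. -/
def splitTZ : MvPolynomial (Fin (n + 2)) k ≃ₐ[k] MvPolynomial (Fin 2) (MvPolynomial (Fin n) k) :=
  (renameEquiv k (finSumFinEquiv.symm.trans (Equiv.sumComm (Fin n) (Fin 2)))).trans
    (sumAlgEquiv k (Fin 2) (Fin n))

theorem splitTZ_toTZ (p : MvPolynomial (Fin n) k) : splitTZ (toTZ k p) = C p := by
  have : (splitTZ (k := k) (n := n)).toAlgHom.comp (toTZ k) =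
      IsScalarTower.toAlgHom k (MvPolynomial (Fin n) k) (MvPolynomial (Fin 2) _) := by
    refine MvPolynomial.algHom_ext fun i => ?_
    simp [splitTZ, toTZ, finSumFinEquiv_symm_apply_castAdd]
  exact DFunLike.congr_fun this p

theorem splitTZ_Tv2 : splitTZ (Tv2 k n) = X 0 := by
  have : (⟨n, by omega⟩ : Fin (n + 2)) = Fin.natAdd n (0 : Fin 2) := by ext; simp
  simp [splitTZ, Tv2, this]

theorem splitTZ_zv2 : splitTZ (zv2 k n) = X 1 := by
  have : (⟨n + 1, by omega⟩ : Fin (n + 2)) = Fin.natAdd n (1 : Fin 2) := by ext; simp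
  simp [splitTZ, zv2, this]

theorem mem_map_toTZ {J : Ideal (MvPolynomial (Fin n) k)} {p : MvPolynomial (Fin (n + 2)) k} :
    p ∈ J.map (toTZ k) ↔ ∀ m, coeff m (splitTZ p) ∈ J := by
  rw [← mem_map_C_iff]
  have : J.map C = (J.map (toTZ k)).map (splitTZ (k := k) (n := n)) := by
    rw [← Ideal.map_coe (toTZ k), ← Ideal.map_coe splitTZ, Ideal.map_map]
    exact congrArg (J.map ·) (RingHom.ext fun p => (splitTZ_toTZ p).symm)
  rw [this, ← Ideal.map_coe splitTZ]
  constructor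
  · exact Ideal.mem_map_of_mem _
  · intro h
    obtain ⟨q, hq, hqp⟩ := (Ideal.mem_map_iff_of_surjective _ splitTZ.surjective).1 h
    rwa [← splitTZ.injective hqp]

theorem RegMod.map_toTZ {J : Ideal (MvPolynomial (Fin n) k)} {f : MvPolynomial (Fin n) k}
    (h : RegMod J f) : RegMod (J.map (toTZ k)) (toTZ k f) := by
  intro g hg
  rw [mem_map_toTZ] at hg ⊢
  intro m
  refine h _ ?_
  simpa [splitTZ_toTZ] using hg m

theorem regMod_map_toTZ_Tv2 (J : Ideal (MvPolynomial (Fin n) k)) :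
    RegMod (J.map (toTZ k)) (Tv2 k n) := by
  intro g hg
  rw [mem_map_toTZ] at hg ⊢
  intro m
  have := hg (Finsupp.single 0 1 + m)
  rwa [map_mul, splitTZ_Tv2, coeff_X_mul] at this

theorem regMod_map_toTZ_zv2 (J : Ideal (MvPolynomial (Fin n) k)) :
    RegMod (J.map (toTZ k)) (zv2 k n) := by
  intro g hg
  rw [mem_map_toTZ] at hg ⊢
  intro m
  have := hg (Finsupp.single 1 1 + m)
  rwa [map_mul, splitTZ_zv2, coeff_X_mul] at this

theorem Tv2_mem_irrelevant : Tv2 k n ∈ irrelevant k (Fin (n + 2)) := Ideal.subset_span ⟨_, rfl⟩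

theorem zv2_mem_irrelevant : zv2 k n ∈ irrelevant k (Fin (n + 2)) := Ideal.subset_span ⟨_, rfl⟩

theorem map_irrelevant_le : (irrelevant k (Fin n)).map (toTZ k) ≤ irrelevant k (Fin (n + 2)) := by
  rw [irrelevant, Ideal.map_span, Ideal.span_le]
  rintro _ ⟨_, ⟨i, rfl⟩, rfl⟩
  exact Ideal.subset_span ⟨_, (rename_X _ _).symm⟩

theorem DepthAtLeast.map_toTZ (t : ℕ) : ∀ {J : Ideal (MvPolynomial (Fin n) k)},
    DepthAtLeast (irrelevant k (Fin n)) t J →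
    DepthAtLeast (irrelevant k (Fin (n + 2))) (t + 2) (J.map (toTZ k)) := by
  induction t with
  | zero =>
    intro J _
    refine ⟨Tv2 k n, Tv2_mem_irrelevant, regMod_map_toTZ_Tv2 J, zv2 k n, zv2_mem_irrelevant, ?_,
      trivial⟩
    let v : Fin (n + 2) := ⟨n, by omega⟩
    have hcomp : (zeroAt k v).comp (toTZ k) = toTZ k := by
      refine MvPolynomial.algHom_ext fun i => ?_
      simp only [AlgHom.comp_apply, toTZ, rename_X]
      exact zeroAt_X_of_ne k (by simp [v, Fin.ext_iff, i.2.ne])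
    have hz : zeroAt k v (zv2 k n) = zv2 k n := zeroAt_X_of_ne k (by simp [v])
    refine RegMod.sup_X (v := v) (fun p hp => ?_) hz (regMod_map_toTZ_zv2 J)
    have := Ideal.mem_map_of_mem (zeroAt k v) hp
    rwa [Ideal.map_mapₐ, hcomp] at this
  | succ t ih =>
    rintro J ⟨f, hf, hr, hd⟩
    refine ⟨toTZ k f, map_irrelevant_le (Ideal.mem_map_of_mem _ hf), hr.map_toTZ, ?_⟩
    have := ih hd
    rwa [Ideal.map_sup, Ideal.map_span, Set.image_singleton] at this

end Extension

section KrullDimension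

variable {k}

/-- A quotient of `k[x₁,…,xₙ,T,z] ⧸ I` generated over `k[x₁,…,xₙ] ⧸ I` by one variable `y`. -/
theorem ringKrullDim_quotient_le {I : Ideal (MvPolynomial (Fin n) k)} {d : ℕ}
    (hd : ringKrullDim (MvPolynomial (Fin n) k ⧸ I) = d) {K : Ideal (MvPolynomial (Fin (n + 2)) k)}
    (hI : I.map (toTZ k) ≤ K) (y : MvPolynomial (Fin (n + 2)) k)
    (hT : Tv2 k n ∈ K ∨ Tv2 k n = y) (hz : zv2 k n ∈ K ∨ zv2 k n = y) :
    ringKrullDim (MvPolynomial (Fin (n + 2)) k ⧸ K) ≤ (d + 1 : ℕ) := by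
  let g : MvPolynomial (Fin n) k ⧸ I →+* MvPolynomial (Fin (n + 2)) k ⧸ K :=
    Ideal.Quotient.lift I ((Ideal.Quotient.mk K).comp (toTZ k).toRingHom) fun p hp =>
      Ideal.Quotient.eq_zero_iff_mem.2 (hI (Ideal.mem_map_of_mem (toTZ k) hp))
  let φ := Polynomial.eval₂RingHom g (Ideal.Quotient.mk K y)
  have hg (p) : Ideal.Quotient.mk K (toTZ k p) ∈ φ.range :=
    ⟨Polynomial.C (Ideal.Quotient.mk I p), by simp [φ, g]⟩
  have haux (w : MvPolynomial (Fin (n + 2)) k) (hw : w ∈ K ∨ w = y) :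
      Ideal.Quotient.mk K w ∈ φ.range := by
    rcases hw with hw | rfl
    · rw [Ideal.Quotient.eq_zero_iff_mem.2 hw]
      exact zero_mem _
    · exact ⟨Polynomial.X, by simp [φ]⟩
  have hvar (i : Fin (n + 2)) : Ideal.Quotient.mk K (X i) ∈ φ.range := by
    induction i using Fin.addCases with
    | left i => simpa [toTZ] using hg (X i)
    | right i =>
      fin_cases i
      · exact haux _ hT
      · exact haux _ hz
  have hsurj : Function.Surjective φ := by
    intro w
    obtain ⟨p, rfl⟩ := Ideal.Quotient.mk_surjective w
    change Ideal.Quotient.mk K p ∈ φ.range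
    induction p using MvPolynomial.induction_on with
    | C a => simpa [toTZ] using hg (C a)
    | add p q hp hq => simpa using add_mem hp hq
    | mul_X p i hp => simpa using mul_mem hp (hvar i)
  have : ringKrullDim (MvPolynomial (Fin (n + 2)) k ⧸ K) ≤
      ringKrullDim (Polynomial (MvPolynomial (Fin n) k ⧸ I)) :=
    ringKrullDim_le_of_surjective φ hsurj
  rw [Polynomial.ringKrullDim_of_isNoetherianRing, hd] at this
  exact_mod_cast this

theorem length_le_ringKrullDim_quotient {A : Type*} [CommRing A] {J : Ideal A}
    (l : LTSeries (PrimeSpectrum.zeroLocus (J : Set A))) {w : A} (hw : w ∈ l.head.1.asIdeal) :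
    (l.length : WithBot ℕ∞) ≤ ringKrullDim (A ⧸ J ⊔ Ideal.span {w}) := by
  have hsub (i) : (l i).1 ∈ PrimeSpectrum.zeroLocus ((J ⊔ Ideal.span {w} : Ideal A) : Set A) :=
    sup_le (show J ≤ (l i).1.asIdeal from (l i).2)
      ((Ideal.span_singleton_le_iff_mem _).2 (l.monotone (Fin.zero_le i) hw))
  rw [ringKrullDim_quotient]
  exact Order.LTSeries.length_le_krullDim
    { length := l.length, toFun := fun i => ⟨(l i).1, hsub i⟩, step := l.step }

theorem ringKrullDim_Hideal_le (D : SC n) (σ : Finset (Fin n)) {d : ℕ}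
    (hd : ringKrullDim (MvPolynomial (Fin n) k ⧸ srIdeal k D) = d) :
    ringKrullDim (MvPolynomial (Fin (n + 2)) k ⧸ Hideal k D σ) ≤ (d + 1 : ℕ) := by
  have main (w y : MvPolynomial (Fin (n + 2)) k)
      (hT : Tv2 k n = w ∨ Tv2 k n = y) (hz : zv2 k n = w ∨ zv2 k n = y) :
      ringKrullDim (MvPolynomial (Fin (n + 2)) k ⧸ Hideal k D σ ⊔ Ideal.span {w}) ≤
        (d + 1 : ℕ) := by
    have hI : (srIdeal k D).map (toTZ k) ≤ Hideal k D σ := le_sup_left.trans le_sup_left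
    have hw : w ∈ Hideal k D σ ⊔ Ideal.span {w} :=
      Ideal.mem_sup_right (Ideal.mem_span_singleton_self w)
    refine ringKrullDim_quotient_le hd (hI.trans le_sup_left) y ?_ ?_
    · exact hT.imp_left fun h => by rwa [h]
    · exact hz.imp_left fun h => by rwa [h]
  rw [ringKrullDim_quotient, Order.krullDim]
  refine iSup_le fun l => ?_
  have hTz : Tv2 k n * zv2 k n ∈ l.head.1.asIdeal :=
    l.head.2 (Ideal.mem_sup_left (Ideal.mem_sup_right (Ideal.mem_span_singleton_self _)))
  rcases l.head.1.isPrime.mem_or_mem hTz with h | h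
  · exact (length_le_ringKrullDim_quotient l h).trans (main _ (zv2 k n) (.inl rfl) (.inr rfl))
  · exact (length_le_ringKrullDim_quotient l h).trans (main _ (Tv2 k n) (.inr rfl) (.inl rfl))

theorem le_ringKrullDim_Hideal (D : SC n) (σ : Finset (Fin n)) {d : ℕ}
    (hd : ringKrullDim (MvPolynomial (Fin n) k ⧸ srIdeal k D) = d) :
    (d + 1 : ℕ) ≤ ringKrullDim (MvPolynomial (Fin (n + 2)) k ⧸ Hideal k D σ) := by
  let A := MvPolynomial (Fin n) k ⧸ srIdeal k D
  let v : Fin (n + 2) → Polynomial A := Fin.append (fun i : Fin n =>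
    Polynomial.C (Ideal.Quotient.mk (srIdeal k D) (X i))) ![0, Polynomial.X]
  let φ : MvPolynomial (Fin (n + 2)) k →ₐ[k] Polynomial A := aeval v
  have hφT : φ (Tv2 k n) = 0 := by
    have : (⟨n, by omega⟩ : Fin (n + 2)) = Fin.natAdd n (0 : Fin 2) := by ext; simp
    rw [Tv2, this, aeval_X]
    exact Fin.append_right _ _ _
  have hφz : φ (zv2 k n) = Polynomial.X := by
    have : (⟨n + 1, by omega⟩ : Fin (n + 2)) = Fin.natAdd n (1 : Fin 2) := by ext; simp
    rw [zv2, this, aeval_X]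
    exact Fin.append_right _ _ _
  have hφ (p) : φ (toTZ k p) = Polynomial.C (Ideal.Quotient.mk (srIdeal k D) p) := by
    have : φ.comp (toTZ k) = Polynomial.CAlgHom.comp (Ideal.Quotient.mkₐ k (srIdeal k D)) := by
      refine MvPolynomial.algHom_ext fun i => ?_
      simp [φ, toTZ, v]
    exact DFunLike.congr_fun this p
  have hker : ∀ p ∈ Hideal k D σ, φ p = 0 := by
    change Hideal k D σ ≤ RingHom.ker φ
    refine sup_le (sup_le ?_ ?_) ?_
    · rw [Ideal.map_le_iff_le_comap]
      intro p hp
      rw [Ideal.mem_comap, RingHom.mem_ker, hφ, Ideal.Quotient.eq_zero_iff_mem.2 hp, map_zero]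
    · simp [RingHom.mem_ker, hφT]
    · rw [Ideal.span_le]
      rintro _ ⟨f, -, rfl⟩
      simp [RingHom.mem_ker, hφT]
  have hsurj : Function.Surjective φ := by
    intro w
    change w ∈ φ.range
    induction w using Polynomial.induction_on' with
    | add p q hp hq => exact add_mem hp hq
    | monomial m a =>
      obtain ⟨p, rfl⟩ := Ideal.Quotient.mk_surjective a
      rw [← Polynomial.C_mul_X_pow_eq_monomial]
      refine ⟨toTZ k p * zv2 k n ^ m, ?_⟩
      rw [map_mul, map_pow]
      exact congrArg₂ _ (hφ p) (congrArg (· ^ m) hφz)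
  have : ringKrullDim (Polynomial A) ≤
      ringKrullDim (MvPolynomial (Fin (n + 2)) k ⧸ Hideal k D σ) :=
    ringKrullDim_le_of_surjective (Ideal.Quotient.lift (Hideal k D σ) φ.toRingHom hker)
      (Ideal.Quotient.lift_surjective_of_surjective _ hker hsurj)
  rw [Polynomial.ringKrullDim_of_isNoetherianRing, hd] at this
  exact_mod_cast this

theorem ringKrullDim_Hideal (D : SC n) (σ : Finset (Fin n)) {d : ℕ}
    (hd : ringKrullDim (MvPolynomial (Fin n) k ⧸ srIdeal k D) = d) :
    ringKrullDim (MvPolynomial (Fin (n + 2)) k ⧸ Hideal k D σ) = (d + 1 : ℕ) :=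
  (ringKrullDim_Hideal_le D σ hd).antisymm (le_ringKrullDim_Hideal D σ hd)

end KrullDimension

section StanleyReisner

attribute [local instance] MvPolynomial.gradedAlgebra

theorem prod_X_mem_homogeneousSubmodule (s : Finset (Fin n)) :
    (∏ i ∈ s, X i : MvPolynomial (Fin n) k) ∈ homogeneousSubmodule (Fin n) k s.card := by
  simpa using IsHomogeneous.prod s (fun i => (X i : MvPolynomial (Fin n) k)) (fun _ => 1)
    fun i _ => isHomogeneous_X k i

theorem srIdeal_isHomogeneous (D : SC n) :
    (srIdeal k D).IsHomogeneous (homogeneousSubmodule (Fin n) k) := by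
  refine Ideal.homogeneous_span _ _ ?_
  rintro _ ⟨s, -, rfl⟩
  exact ⟨_, prod_X_mem_homogeneousSubmodule k s⟩

variable {k}

theorem zeroAt_mem_srIdeal (D : SC n) (v : Fin n) :
    ∀ p ∈ srIdeal k D, zeroAt k v p ∈ srIdeal k D := by
  change srIdeal k D ≤ (srIdeal k D).comap (zeroAt k v)
  refine Ideal.span_le.2 ?_
  rintro _ ⟨s, hs, rfl⟩
  change zeroAt k v _ ∈ srIdeal k D
  rw [map_prod]
  by_cases hv : v ∈ s
  · rw [Finset.prod_eq_zero hv (zeroAt_X_self k v)]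
    exact zero_mem _
  · rw [Finset.prod_congr rfl fun i hi => zeroAt_X_of_ne k (ne_of_mem_of_not_mem hi hv)]
    exact Ideal.subset_span ⟨s, hs, rfl⟩

theorem linkIdeal_eq_colon_singleton (D : SC n) (σ : Finset (Fin n)) :
    linkIdeal k D σ = Submodule.colon (srIdeal k D) {∏ i ∈ σ, X i} := by
  rw [linkIdeal, xFace]
  exact Submodule.colon_span

theorem srIdeal_le_linkIdeal (D : SC n) (σ : Finset (Fin n)) :
    srIdeal k D ≤ linkIdeal k D σ := by
  intro p hp
  rw [linkIdeal_eq_colon_singleton, mem_colon_singleton']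
  exact Ideal.mul_mem_left _ _ hp

theorem srIdeal_le_irrelevant {D : SC n} (h : ∅ ∈ D.faces) :
    srIdeal k D ≤ irrelevant k (Fin n) := by
  refine Ideal.span_le.2 ?_
  rintro _ ⟨s, hs, rfl⟩
  obtain ⟨i, hi⟩ : s.Nonempty := Finset.nonempty_iff_ne_empty.2 fun h0 => hs (h0 ▸ h)
  exact Ideal.mem_of_dvd _ (Finset.dvd_prod_of_mem _ hi) (Ideal.subset_span ⟨i, rfl⟩)

theorem Hideal_le_irrelevant {D : SC n} (h : ∅ ∈ D.faces) (σ : Finset (Fin n)) :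
    Hideal k D σ ≤ irrelevant k (Fin (n + 2)) := by
  refine sup_le (sup_le ((Ideal.map_mono (srIdeal_le_irrelevant h)).trans map_irrelevant_le) ?_) ?_
  · exact (Ideal.span_singleton_le_iff_mem _).2 (Ideal.mul_mem_right _ _ Tv2_mem_irrelevant)
  · refine Ideal.span_le.2 ?_
    rintro _ ⟨f, -, rfl⟩
    exact Ideal.mul_mem_right _ _ Tv2_mem_irrelevant

open scoped Pointwise in
theorem Hideal_eq (D : SC n) (σ : Finset (Fin n)) :
    Hideal k D σ = (srIdeal k D).map (toTZ k) ⊔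
      Ideal.span {Tv2 k n} * ((linkIdeal k D σ).map (toTZ k) ⊔ Ideal.span {zv2 k n}) := by
  have : (fun f => Tv2 k n * toTZ k f) '' (linkIdeal k D σ : Set (MvPolynomial (Fin n) k)) =
      ({Tv2 k n} : Set (MvPolynomial (Fin (n + 2)) k)) *
        (toTZ k '' (linkIdeal k D σ : Set (MvPolynomial (Fin n) k))) := by
    rw [Set.singleton_mul, Set.image_image]
  rw [Hideal, this, ← Ideal.span_mul_span', ← Ideal.span_singleton_mul_span_singleton, sup_assoc,
    ← Ideal.mul_sup, sup_comm (Ideal.span {zv2 k n})]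
  rfl

theorem Hideal_sup_Tv2 (D : SC n) (σ : Finset (Fin n)) :
    Hideal k D σ ⊔ Ideal.span {Tv2 k n} =
      (srIdeal k D).map (toTZ k) ⊔ Ideal.span {Tv2 k n} := by
  have : Ideal.span {Tv2 k n} * ((linkIdeal k D σ).map (toTZ k) ⊔ Ideal.span {zv2 k n}) ≤
      Ideal.span {Tv2 k n} := Ideal.mul_le_left
  rw [Hideal_eq, sup_assoc, sup_eq_right.2 this]

theorem Hideal_colon_Tv2 (D : SC n) (σ : Finset (Fin n)) :
    Submodule.colon (Hideal k D σ) {Tv2 k n} =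
      (linkIdeal k D σ).map (toTZ k) ⊔ Ideal.span {zv2 k n} := by
  ext p
  rw [mem_colon_singleton', Hideal_eq]
  constructor
  · intro h
    obtain ⟨i, hi, j, hj, hij⟩ := Submodule.mem_sup.1 h
    obtain ⟨l, hl, rfl⟩ := Ideal.mem_span_singleton_mul.1 hj
    have hpl : p - l ∈ (srIdeal k D).map (toTZ k) := by
      refine regMod_map_toTZ_Tv2 _ _ ?_
      rwa [mul_sub, ← hij, add_sub_cancel_right]
    rw [← sub_add_cancel p l]
    exact add_mem (Ideal.mem_sup_left (Ideal.map_mono (srIdeal_le_linkIdeal D σ) hpl)) hl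
  · exact fun h => Ideal.mem_sup_right (Ideal.mul_mem_mul (Ideal.mem_span_singleton_self _) h)

end StanleyReisner

/-- **Proposition.** `H = k[x₁,…,xₙ,T,z]/(I, Tz, T·I_L)` is Cohen–Macaulay of
Krull dimension `d + 1`. -/
theorem H_cohen_macaulay (k : Type) [Field k] [Infinite k]
    (n q d : ℕ) (hq : 1 ≤ q)
    (D : SC n) (hD : gorStar k D)
    (σ : Finset (Fin n)) (hσ : σ ∈ D.faces) (hcard : σ.card = q + 1)
    (hd : d = dimP D) :
    isCM k (Hideal k D σ) (d + 1) := by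
  subst hd
  obtain ⟨hdim, hdepth⟩ := hD.2.1.1
  have hI := hdepth.depthAtLeast
  have hL : DepthAtLeast (irrelevant k (Fin n)) (dimP D) (linkIdeal k D σ) := by
    rw [linkIdeal_eq_colon_singleton]
    exact hI.colon_prod_X σ (srIdeal_isHomogeneous k D) fun v _ => zeroAt_mem_srIdeal D v
  refine ⟨ringKrullDim_Hideal D σ hdim, DepthAtLeast.depthGE
    (Hideal_le_irrelevant (D.down_closed σ hσ ∅ (Finset.empty_subset σ)) σ) ?_⟩
  refine DepthAtLeast.of_colon k (Tv2 k n) _ ?_ ?_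
  · rw [Hideal_colon_Tv2]
    exact hL.map_toTZ.sup_span k _ zv2_mem_irrelevant (regMod_map_toTZ_zv2 _)
  · rw [Hideal_sup_Tv2]
    exact hI.map_toTZ.sup_span k _ Tv2_mem_irrelevant (regMod_map_toTZ_Tv2 _)

end SRWLP
end
end
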